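/- Let n ≥ 2, p ∈ (1,∞), δ ∈ (0,1), Λ > 0, x₀ ∈ ℝⁿ, r > 0. Let ā : ℝ → ℝ^{n×n} be measurable with values in symmetric matrices satisfying δ|ξ|² ≤ ā(s)ξ·ξ for all ξ ∈ ℝⁿ, s ∈ ℝ, and entries bounded in absolute value by Λ. Let η : ℝⁿ → ℝ be smooth with 0 ≤ η ≤ 1, η ≡ 1 on B_{2r/3}(x₀), η ≡ 0 outside B_r(x₀), and |∇η| ≤ 5/r, and define ã(x) := η(x)·ā(xⁿ) + δ(1 − η(x))·Id. Let F ∈ L^p(B_{r/2}(x₀)) and let v be twice continuously differentiable on the closure of B_r(x₀) with v = 0 on ∂B_r(x₀) and Σ_{i,j} ã^{ij}(x) D_{ij}v(x) = F(x)·1_{B_{r/2}(x₀)}(x) for a.e. x ∈ B_r(x₀). Then there is a constant C = C(n, p, δ, Λ) such that for every t > 0, |{x ∈ B_{r/2}(x₀) : |D²v(x)| > t}| ≤（C/t)·∫_{B_{r/2}(x₀)} |F| dx. -/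

import Mathlib

open MeasureTheory Metric Set Matrix

/-- Second partial derivative `D_{ij} v`. -/
noncomputable def D2 {n : ℕ} (u : EuclideanSpace ℝ (Fin n) → ℝ)
    (x : EuclideanSpace ℝ (Fin n)) (i j : Fin n) : ℝ :=
  fderiv ℝ (fun y => fderiv ℝ u y (EuclideanSpace.single j 1)) x (EuclideanSpace.single i 1)

/-- A symmetric matrix which is uniformly elliptic with constant `δ` and has entries
bounded by `Λ`. -/
def IsElliptic (n : ℕ) (δ Λ : ℝ) (a : Matrix (Fin n) (Fin n) ℝ) : Prop :=
  aᵀ = a ∧ (∀ ξ : Fin n → ℝ, δ * ∑ i, ξ i ^ 2 ≤ ∑ i, ∑ j, a i j * ξ i * ξ j) ∧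
    ∀ i j, |a i j| ≤ Λ

namespace Lattice

set_option linter.unusedSectionVars false

variable {ι : Type*} [Fintype ι] [DecidableEq ι]

/-- Forward difference in the direction `i` of a function on the lattice `ℤ^ι`. -/
def fdiff (i : ι) (u : (ι → ℤ) → ℝ) (x : ι → ℤ) : ℝ := u (x + Pi.single i 1) - u x

/-- The cube of radius `ρ` centred at `y`. -/
noncomputable def cube (y : ι → ℤ) (ρ : ℝ) : Finset (ι → ℤ) :=
  (isCompact_closedBall y ρ).finite_of_discrete.toFinset

/-- The energy form of the divergence form operator whose coefficients `A` depend only on the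
coordinate `ℓ`. -/
noncomputable def energy (A : ℤ → Matrix ι ι ℝ) (ℓ : ι) (φ w : (ι → ℤ) → ℝ) : ℝ :=
  ∑' x, ∑ i, ∑ j, A (x ℓ) i j * fdiff j φ x * fdiff i w x

/-- `w` is a local solution, on the cube of radius `ρ` at `y`, of the adjoint equation with
zeroth-order term `ε`. -/
def IsAdjointSolution (A : ℤ → Matrix ι ι ℝ) (ℓ : ι) (ε : ℝ) (y : ι → ℤ) (ρ : ℝ)
    (w : (ι → ℤ) → ℝ) : Prop :=
  ∀ φ : (ι → ℤ) → ℝ, (∀ x, ρ < dist x y → φ x = 0) →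
    ε * ∑' x, φ x * w x + energy A ℓ φ w = 0

/-- Bounded coefficients with an ellipticity constant `lam`. -/
structure UniformlyElliptic (A : ℤ → Matrix ι ι ℝ) (lam K : ℝ) : Prop where
  pos : 0 < lam
  coercive : ∀ s (ξ : ι → ℝ), lam * ∑ i, ξ i ^ 2 ≤ ∑ i, ∑ j, A s i j * ξ j * ξ i
  bound : ∀ s i j, |A s i j| ≤ K

@[simp] lemma mem_cube {x y : ι → ℤ} {ρ : ℝ} : x ∈ cube y ρ ↔ dist x y ≤ ρ := by
  simp [cube]

lemma dist_add_single (x : ι → ℤ) (i : ι) : dist (x + Pi.single i 1) x = 1 := by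
  rw [dist_eq_norm, add_sub_cancel_left]
  apply le_antisymm
  · rw [pi_norm_le_iff_of_nonneg zero_le_one]
    intro j
    rcases eq_or_ne j i with rfl | h
    · simp
    · simp [Pi.single_eq_of_ne h]
  · simpa using norm_le_pi_norm (Pi.single i 1 : ι → ℤ) i

lemma dist_add_single_le (x y : ι → ℤ) (i : ι) : dist (x + Pi.single i 1) y ≤ dist x y + 1 := by
  have := dist_triangle (x + Pi.single i 1) x y
  rw [dist_add_single] at this; linarith

lemma dist_le_add_single (x y : ι → ℤ) (i : ι) : dist x y ≤ dist (x + Pi.single i 1) y + 1 := by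
  have := dist_triangle x (x + Pi.single i 1) y
  rw [dist_comm x (x + _), dist_add_single] at this; linarith

lemma sum_cube_add_single_le {g : (ι → ℤ) → ℝ} (hg : ∀ x, 0 ≤ g x) (y : ι → ℤ) (ρ : ℝ) (i : ι) :
    ∑ x ∈ cube y ρ, g (x + Pi.single i 1) ≤ ∑ x ∈ cube y (ρ + 1), g x := by
  rw [← Finset.sum_image (s := cube y ρ) (g := fun x => x + Pi.single i 1)
    (fun a _ b _ h => add_right_cancel h)]
  refine Finset.sum_le_sum_of_subset_of_nonneg ?_ fun x _ _ => hg x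
  intro x hx
  obtain ⟨z, hz, rfl⟩ := Finset.mem_image.1 hx
  rw [mem_cube] at hz ⊢
  linarith [dist_add_single_le z y i]

lemma sum_cube_mono {g : (ι → ℤ) → ℝ} (hg : ∀ x, 0 ≤ g x) (y : ι → ℤ) {ρ ρ' : ℝ} (h : ρ ≤ ρ') :
    ∑ x ∈ cube y ρ, g x ≤ ∑ x ∈ cube y ρ', g x := by
  refine Finset.sum_le_sum_of_subset_of_nonneg ?_ fun x _ _ => hg x
  intro x hx
  rw [mem_cube] at hx ⊢
  linarith

lemma fdiff_comm (i j : ι) (u : (ι → ℤ) → ℝ) : fdiff i (fdiff j u) = fdiff j (fdiff i u) := by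
  ext x
  simp only [fdiff, add_right_comm x (Pi.single i 1) (Pi.single j 1)]
  ring

lemma fdiff_sq_mul (i : ι) (z w : (ι → ℤ) → ℝ) (x : ι → ℤ) :
    fdiff i (fun x => z x ^ 2 * w x) x = z x ^ 2 * fdiff i w x +
      w (x + Pi.single i 1) * (2 * z x * fdiff i z x + fdiff i z x ^ 2) := by
  simp only [fdiff]; ring

lemma fdiff_eq_zero_of_far {φ : (ι → ℤ) → ℝ} {y : ι → ℤ} {ρ : ℝ}
    (h : ∀ x, ρ < dist x y → φ x = 0) (i : ι) (x : ι → ℤ) (hx : ρ + 1 < dist x y) :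
    fdiff i φ x = 0 := by
  have := dist_le_add_single x y i
  rw [fdiff, h x (by linarith), h _ (by linarith), sub_zero]

lemma energy_eq_sum {A : ℤ → Matrix ι ι ℝ} {ℓ : ι} {φ w : (ι → ℤ) → ℝ} {y : ι → ℤ} {ρ : ℝ}
    (h : ∀ x, ρ < dist x y → φ x = 0) :
    energy A ℓ φ w = ∑ x ∈ cube y (ρ + 1), ∑ i, ∑ j, A (x ℓ) i j * fdiff j φ x * fdiff i w x := by
  refine tsum_eq_sum fun x hx => ?_
  rw [mem_cube, not_le] at hx
  refine Finset.sum_eq_zero fun i _ => Finset.sum_eq_zero fun j _ => ?_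
  rw [fdiff_eq_zero_of_far h j x hx]; ring

/-- Pointwise inequality behind the Caccioppoli estimate. -/
lemma caccioppoli_pointwise {a : Matrix ι ι ℝ} {lam K q z : ℝ} {p W Z : ι → ℝ} {w0 : ℝ}
    (hlam : 0 < lam) (hK : ∀ i j, |a i j| ≤ K)
    (ha : lam * ∑ i, p i ^ 2 ≤ ∑ i, ∑ j, a i j * p j * p i)
    (hp : ∀ i, p i = W i - w0) (hZ : ∀ i, |Z i| ≤ q) :
    lam / 2 * (z ^ 2 * ∑ i, p i ^ 2) ≤
      ∑ i, ∑ j, a i j * (z ^ 2 * p j + W j * (2 * z * Z j + Z j ^ 2)) * p i +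
      (2 * K ^ 2 * (Fintype.card ι) / lam + 2 * K) * (Fintype.card ι) *
        (q ^ 2 * (∑ i, W i ^ 2 + Fintype.card ι * w0 ^ 2)) := by
  rcases isEmpty_or_nonempty ι with hι | hι
  · simp
  set N : ℝ := (Fintype.card ι : ℝ) with hN
  have hN0 : 0 < N := by rw [hN]; exact_mod_cast Fintype.card_pos
  have hK0 : 0 ≤ K := (abs_nonneg _).trans (hK hι.some hι.some)
  have hq0 : 0 ≤ q := (abs_nonneg _).trans (hZ hι.some)
  have hZq : ∀ j, Z j ^ 2 ≤ q ^ 2 := fun j => sq_le_sq' (by linarith [abs_le.1 (hZ j)])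
    (by linarith [abs_le.1 (hZ j)])
  have key : ∀ i j, a i j * (z ^ 2 * p j) * p i ≤
      a i j * (z ^ 2 * p j + W j * (2 * z * Z j + Z j ^ 2)) * p i +
      (lam / (2 * N) * (z ^ 2 * p i ^ 2) + 2 * N * K ^ 2 / lam * (q ^ 2 * W j ^ 2) +
        K * q ^ 2 * (W j ^ 2 / 2 + W i ^ 2 + w0 ^ 2)) := by
    intro i j
    have h1 : -(a i j * W j * (2 * z * Z j) * p i) ≤
        lam / (2 * N) * (z ^ 2 * p i ^ 2) + 2 * N * K ^ 2 / lam * (q ^ 2 * W j ^ 2) := by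
      have e1 : a i j ^ 2 ≤ K ^ 2 := sq_le_sq' (by linarith [abs_le.1 (hK i j)])
        (by linarith [abs_le.1 (hK i j)])
      have e2 : a i j ^ 2 * Z j ^ 2 * W j ^ 2 ≤ K ^ 2 * (q ^ 2 * W j ^ 2) := by
        rw [← mul_assoc (K ^ 2)]
        exact mul_le_mul_of_nonneg_right (mul_le_mul e1 (hZq j) (sq_nonneg _) (sq_nonneg _))
          (sq_nonneg _)
      have e3 : 0 ≤ lam / (2 * N) * (z * p i + 2 * N / lam * (a i j * W j * Z j)) ^ 2 := by
        positivity
      have e4 : lam / (2 * N) * (z * p i + 2 * N / lam * (a i j * W j * Z j)) ^ 2 =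
          lam / (2 * N) * (z ^ 2 * p i ^ 2) + a i j * W j * (2 * z * Z j) * p i +
          2 * N / lam * (a i j ^ 2 * Z j ^ 2 * W j ^ 2) := by
        field_simp; ring
      have e5 : 2 * N / lam * (a i j ^ 2 * Z j ^ 2 * W j ^ 2) ≤
          2 * N / lam * (K ^ 2 * (q ^ 2 * W j ^ 2)) := by gcongr
      have e6 : 2 * N / lam * (K ^ 2 * (q ^ 2 * W j ^ 2)) =
        2 * N * K ^ 2 / lam * (q ^ 2 * W j ^ 2) := by ring
      linarith
    have h2 : -(a i j * W j * Z j ^ 2 * p i) ≤ K * q ^ 2 * (W j ^ 2 / 2 + W i ^ 2 + w0 ^ 2) := by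
      have e1 : |W j * p i| ≤ W j ^ 2 / 2 + W i ^ 2 + w0 ^ 2 := by
        rw [hp, abs_le]
        constructor <;> nlinarith [sq_nonneg (W j + W i - w0), sq_nonneg (W j - W i + w0),
          sq_nonneg (W i + w0)]
      calc -(a i j * W j * Z j ^ 2 * p i) ≤ |a i j * W j * Z j ^ 2 * p i| := neg_le_abs _
        _ = |a i j| * Z j ^ 2 * |W j * p i| := by
          rw [show a i j * W j * Z j ^ 2 * p i = a i j * Z j ^ 2 * (W j * p i) by ring, abs_mul,
            abs_mul, abs_of_nonneg (sq_nonneg (Z j))]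
        _ ≤ K * q ^ 2 * (W j ^ 2 / 2 + W i ^ 2 + w0 ^ 2) := by
          exact mul_le_mul (mul_le_mul (hK i j) (hZq j) (sq_nonneg _) hK0) e1 (abs_nonneg _)
            (by positivity)
    nlinarith
  have hsum := Finset.sum_le_sum fun i (_ : i ∈ Finset.univ) =>
    Finset.sum_le_sum fun j (_ : j ∈ Finset.univ) => key i j
  have hl : ∑ i, ∑ j, a i j * (z ^ 2 * p j) * p i = z ^ 2 * ∑ i, ∑ j, a i j * p j * p i := by
    simp only [Finset.mul_sum]
    exact Finset.sum_congr rfl fun i _ => Finset.sum_congr rfl fun j _ => by ring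
  have hr : ∑ i, ∑ j, (lam / (2 * N) * (z ^ 2 * p i ^ 2) +
      2 * N * K ^ 2 / lam * (q ^ 2 * W j ^ 2) + K * q ^ 2 * (W j ^ 2 / 2 + W i ^ 2 + w0 ^ 2)) =
      lam / 2 * (z ^ 2 * ∑ i, p i ^ 2) + 2 * N ^ 2 * K ^ 2 / lam * (q ^ 2 * ∑ i, W i ^ 2) +
      K * q ^ 2 * (3 / 2 * N * ∑ i, W i ^ 2 + N ^ 2 * w0 ^ 2) := by
    simp only [Finset.sum_add_distrib, ← Finset.mul_sum, Finset.sum_const, Finset.card_univ,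
      nsmul_eq_mul, ← Finset.sum_div, ← hN]
    field_simp
    ring
  rw [hl] at hsum
  rw [Finset.sum_congr rfl fun i _ => Finset.sum_add_distrib, Finset.sum_add_distrib, hr] at hsum
  have hz : z ^ 2 * (lam * ∑ i, p i ^ 2) ≤ z ^ 2 * ∑ i, ∑ j, a i j * p j * p i := by gcongr
  have h3 : 0 ≤ ∑ i, W i ^ 2 := Finset.sum_nonneg fun i _ => sq_nonneg _
  have h4 : 2 * N ^ 2 * K ^ 2 / lam * (q ^ 2 * ∑ i, W i ^ 2) +
      K * q ^ 2 * (3 / 2 * N * ∑ i, W i ^ 2 + N ^ 2 * w0 ^ 2) ≤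
      (2 * K ^ 2 * N / lam + 2 * K) * N * (q ^ 2 * (∑ i, W i ^ 2 + N * w0 ^ 2)) := by
    have e : (2 * K ^ 2 * N / lam + 2 * K) * N * (q ^ 2 * (∑ i, W i ^ 2 + N * w0 ^ 2)) -
      (2 * N ^ 2 * K ^ 2 / lam * (q ^ 2 * ∑ i, W i ^ 2) +
      K * q ^ 2 * (3 / 2 * N * ∑ i, W i ^ 2 + N ^ 2 * w0 ^ 2)) =
      2 * K ^ 2 * N / lam * N * q ^ 2 * (N * w0 ^ 2) + K * q ^ 2 * N / 2 * (∑ i, W i ^ 2) +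
      K * N * q ^ 2 * (N * w0 ^ 2) := by ring
    have : 0 ≤ 2 * K ^ 2 * N / lam * N * q ^ 2 * (N * w0 ^ 2) +
      K * q ^ 2 * N / 2 * (∑ i, W i ^ 2) + K * N * q ^ 2 * (N * w0 ^ 2) := by positivity
    linarith
  linarith

/-- The constant of the Caccioppoli estimate. -/
noncomputable def caccioppoliConst (lam K : ℝ) (N : ℕ) : ℝ :=
  2 / lam * ((2 * K ^ 2 * N / lam + 2 * K) * N * (4 * (2 * N)))

/-- Caccioppoli estimate on lattice cubes. -/
lemma caccioppoli {A : ℤ → Matrix ι ι ℝ} {ℓ : ι} {lam K ε : ℝ} (hA : UniformlyElliptic A lam K)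
    (hε : 0 ≤ ε) {y : ι → ℤ} {σ d : ℝ} (hd : 4 ≤ d) {w : (ι → ℤ) → ℝ}
    (hw : IsAdjointSolution A ℓ ε y (σ + d) w) :
    ∑ x ∈ cube y σ, ∑ i, fdiff i w x ^ 2 ≤
      caccioppoliConst lam K (Fintype.card ι) / d ^ 2 * ∑ x ∈ cube y (σ + d), w x ^ 2 := by
  have hlam := hA.pos
  have hK0 : 0 ≤ K := (abs_nonneg _).trans (hA.bound 0 ℓ ℓ)
  set N : ℝ := (Fintype.card ι : ℝ) with hN
  set z : (ι → ℤ) → ℝ := fun x => max 0 (min 1 ((σ + d - 2 - dist x y) / (d - 2))) with hz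
  have hz0 : ∀ x, σ + d - 2 ≤ dist x y → z x = 0 := by
    intro x hx
    have : (σ + d - 2 - dist x y) / (d - 2) ≤ 0 :=
      div_nonpos_of_nonpos_of_nonneg (by linarith) (by linarith)
    simp only [hz]
    exact max_eq_left ((min_le_right _ _).trans this)
  have hz1 : ∀ x, dist x y ≤ σ → z x = 1 := by
    intro x hx
    have : 1 ≤ (σ + d - 2 - dist x y) / (d - 2) := by
      rw [le_div_iff₀ (by linarith)]; linarith
    simp only [hz]
    rw [min_eq_left this]; norm_num
  have hzd : ∀ x i, |fdiff i z x| ≤ 2 / d := by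
    intro x i
    have h1 : |fdiff i z x| ≤ |(σ + d - 2 - dist (x + Pi.single i 1) y) / (d - 2) -
        (σ + d - 2 - dist x y) / (d - 2)| := by
      simp only [fdiff, hz]
      rw [max_comm 0, max_comm 0, min_comm 1, min_comm 1]
      exact (abs_max_sub_max_le_abs _ _ _).trans (abs_inf_sub_inf_le_abs _ _ _)
    refine h1.trans ?_
    rw [← sub_div, abs_div, abs_of_pos (show 0 < d - 2 by linarith),
      div_le_div_iff₀ (by linarith) (by linarith)]
    have : |σ + d - 2 - dist (x + Pi.single i 1) y - (σ + d - 2 - dist x y)| ≤ 1 := by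
      rw [abs_le]
      constructor <;> linarith [dist_add_single_le x y i, dist_le_add_single x y i]
    nlinarith
  set φ : (ι → ℤ) → ℝ := fun x => z x ^ 2 * w x with hφ
  have hφ0 : ∀ x, σ + d - 2 < dist x y → φ x = 0 := fun x hx => by simp [hφ, hz0 x hx.le]
  have heq := hw φ fun x hx => hφ0 x (by linarith)
  have hεφ : 0 ≤ ε * ∑' x, φ x * w x := by
    refine mul_nonneg hε (tsum_nonneg fun x => ?_)
    simp only [hφ]
    nlinarith [mul_nonneg (sq_nonneg (z x)) (sq_nonneg (w x))]
  have hneg : energy A ℓ φ w ≤ 0 := by linarith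
  rw [energy_eq_sum hφ0, show σ + d - 2 + 1 = σ + d - 1 by ring] at hneg
  have hpt := Finset.sum_le_sum fun x (_ : x ∈ cube y (σ + d - 1)) =>
    caccioppoli_pointwise (a := A (x ℓ)) (K := K) (z := z x) (p := fun i => fdiff i w x)
      (W := fun i => w (x + Pi.single i 1)) (Z := fun i => fdiff i z x) (w0 := w x) (q := 2 / d)
      hlam (hA.bound _) (hA.coercive _ _) (fun i => rfl) (hzd x)
  simp only [← fdiff_sq_mul] at hpt
  rw [Finset.sum_add_distrib] at hpt
  have hw0 : ∀ x, 0 ≤ w x ^ 2 := fun x => sq_nonneg _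
  have hS0 : 0 ≤ ∑ x ∈ cube y (σ + d), w x ^ 2 := Finset.sum_nonneg fun x _ => hw0 x
  have hR : ∑ x ∈ cube y (σ + d - 1), (2 * K ^ 2 * N / lam + 2 * K) * N *
      ((2 / d) ^ 2 * (∑ i, w (x + Pi.single i 1) ^ 2 + N * w x ^ 2)) ≤
      (2 * K ^ 2 * N / lam + 2 * K) * N * ((2 / d) ^ 2 *
        (2 * N * ∑ x ∈ cube y (σ + d), w x ^ 2)) := by
    rw [← Finset.mul_sum, ← Finset.mul_sum, Finset.sum_add_distrib, ← Finset.mul_sum,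
      Finset.sum_comm]
    have h1 : ∑ i : ι, ∑ x ∈ cube y (σ + d - 1), w (x + Pi.single i 1) ^ 2 ≤
        N * ∑ x ∈ cube y (σ + d), w x ^ 2 := by
      have : ∀ i ∈ (Finset.univ : Finset ι), ∑ x ∈ cube y (σ + d - 1), w (x + Pi.single i 1) ^ 2 ≤
          ∑ x ∈ cube y (σ + d), w x ^ 2 := fun i _ => by
        simpa using sum_cube_add_single_le (g := fun x => w x ^ 2) hw0 y (σ + d - 1) i
      simpa [hN] using Finset.sum_le_sum this
    have h2 : ∑ x ∈ cube y (σ + d - 1), w x ^ 2 ≤ ∑ x ∈ cube y (σ + d), w x ^ 2 :=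
      sum_cube_mono hw0 y (by linarith)
    have h3 : N * ∑ x ∈ cube y (σ + d - 1), w x ^ 2 ≤ N * ∑ x ∈ cube y (σ + d), w x ^ 2 := by
      gcongr
    gcongr
    linarith
  have hL : lam / 2 * ∑ x ∈ cube y σ, ∑ i, fdiff i w x ^ 2 ≤
      ∑ x ∈ cube y (σ + d - 1), lam / 2 * (z x ^ 2 * ∑ i, fdiff i w x ^ 2) := by
    rw [← Finset.mul_sum]
    gcongr
    have hs : ∀ x, 0 ≤ ∑ i, fdiff i w x ^ 2 := fun x => Finset.sum_nonneg fun i _ => sq_nonneg _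
    refine le_trans (le_of_eq ?_) (sum_cube_mono (ρ := σ)
      (fun x => mul_nonneg (sq_nonneg (z x)) (hs x)) y (by linarith))
    exact Finset.sum_congr rfl fun x hx => by rw [hz1 x (mem_cube.1 hx)]; ring
  have hfin := hL.trans (hpt.trans (add_le_add hneg hR))
  have e : caccioppoliConst lam K (Fintype.card ι) / d ^ 2 * ∑ x ∈ cube y (σ + d), w x ^ 2 =
      2 / lam * ((2 * K ^ 2 * N / lam + 2 * K) * N * ((2 / d) ^ 2 *
        (2 * N * ∑ x ∈ cube y (σ + d), w x ^ 2))) := by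
    unfold caccioppoliConst
    rw [← hN]
    field_simp
    ring
  rw [e]
  rw [zero_add] at hfin
  calc ∑ x ∈ cube y σ, ∑ i, fdiff i w x ^ 2
      = 2 / lam * (lam / 2 * ∑ x ∈ cube y σ, ∑ i, fdiff i w x ^ 2) := by field_simp
    _ ≤ _ := by gcongr

lemma summable_of_far {φ : (ι → ℤ) → ℝ} {y : ι → ℤ} {ρ : ℝ} (h : ∀ x, ρ < dist x y → φ x = 0) :
    Summable φ :=
  summable_of_hasFiniteSupport <| (cube y ρ).finite_toSet.subset fun x hx => by
    by_contra hc
    simp only [Finset.mem_coe, mem_cube, not_le] at hc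
    exact hx (h x hc)

/-- Differences in directions other than `ℓ` of local solutions are local solutions. -/
lemma IsAdjointSolution.fdiff {A : ℤ → Matrix ι ι ℝ} {ℓ k : ι} (hk : k ≠ ℓ) {ε : ℝ} {y : ι → ℤ}
    {ρ : ℝ} {w : (ι → ℤ) → ℝ} (hw : IsAdjointSolution A ℓ ε y (ρ + 1) w) :
    IsAdjointSolution A ℓ ε y ρ (fdiff k w) := by
  intro φ hφ
  have hS : ∀ x, ρ + 1 < dist x y → φ (x - Pi.single k 1) = 0 := fun x hx => hφ _ (by
    have := dist_add_single_le (x - Pi.single k 1) y k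
    rw [sub_add_cancel] at this
    linarith)
  have h1 := hw φ fun x hx => hφ x (by linarith)
  have h2 := hw (fun x => φ (x - Pi.single k 1)) hS
  have e1 : ∑' x, φ (x - Pi.single k 1) * w x = ∑' x, φ x * w (x + Pi.single k 1) := by
    rw [← (Equiv.addRight (Pi.single k 1 : ι → ℤ)).tsum_eq]
    simp
  have e2 : energy A ℓ (fun x => φ (x - Pi.single k 1)) w =
      energy A ℓ φ (fun x => w (x + Pi.single k 1)) := by
    unfold energy
    rw [← (Equiv.addRight (Pi.single k 1 : ι → ℤ)).tsum_eq]
    refine tsum_congr fun x => Finset.sum_congr rfl fun i _ => Finset.sum_congr rfl fun j _ => ?_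
    have : (x + (Pi.single k 1 : ι → ℤ)) ℓ = x ℓ := by simp [Pi.single_eq_of_ne hk.symm]
    simp only [Equiv.coe_addRight, this, Lattice.fdiff, add_sub_cancel_right,
      add_right_comm x (Pi.single k 1)]
  have e3 : ∑' x, φ x * Lattice.fdiff k w x =
      ∑' x, φ x * w (x + Pi.single k 1) - ∑' x, φ x * w x := by
    rw [← Summable.tsum_sub]
    · exact tsum_congr fun x => by simp only [Lattice.fdiff]; ring
    · exact summable_of_far (y := y) (ρ := ρ) fun x hx => by rw [hφ x hx, zero_mul]
    · exact summable_of_far (y := y) (ρ := ρ) fun x hx => by rw [hφ x hx, zero_mul]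
  have e4 : energy A ℓ φ (Lattice.fdiff k w) =
      energy A ℓ φ (fun x => w (x + Pi.single k 1)) - energy A ℓ φ w := by
    simp only [energy_eq_sum hφ, ← Finset.sum_sub_distrib]
    refine Finset.sum_congr rfl fun x _ => Finset.sum_congr rfl fun i _ =>
      Finset.sum_congr rfl fun j _ => ?_
    rw [fdiff_comm i k]
    simp only [Lattice.fdiff, add_right_comm x (Pi.single k 1)]
    ring
  rw [e3, e4]
  rw [e1, e2] at h2
  linarith

/-- The box with lower corner `y` and side `M`. -/
noncomputable def box (y : ι → ℤ) (M : ℕ) : Finset (ι → ℤ) :=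
  Fintype.piFinset fun i => Finset.Ico (y i) (y i + M)

/-- The slice of a box through `x` on which the coordinates in `J` are frozen. -/
noncomputable def slice (J : Finset ι) (y : ι → ℤ) (M : ℕ) (x : ι → ℤ) : Finset (ι → ℤ) :=
  Fintype.piFinset fun i => if i ∈ J then {x i} else Finset.Ico (y i) (y i + M)

lemma mem_box {y x : ι → ℤ} {M : ℕ} : x ∈ box y M ↔ ∀ i, y i ≤ x i ∧ x i < y i + M := by
  simp [box]

lemma mem_slice {J : Finset ι} {y x z : ι → ℤ} {M : ℕ} :
    z ∈ slice J y M x ↔ ∀ i, if i ∈ J then z i = x i else y i ≤ z i ∧ z i < y i + M := by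
  simp only [slice, Fintype.mem_piFinset]
  refine forall_congr' fun i => ?_
  split_ifs <;> simp

lemma slice_empty (y : ι → ℤ) (M : ℕ) (x : ι → ℤ) : slice ∅ y M x = box y M := by
  simp [slice, box]

lemma sub_eq_sum_Ico (f : ℤ → ℝ) {s t : ℤ} (h : s ≤ t) :
    f t - f s = ∑ r ∈ Finset.Ico s t, (f (r + 1) - f r) := by
  induction t, h using Int.leInduction with
  | base => simp
  | succ t ht ih =>
    rw [← Finset.insert_Ico_right_eq_Ico_add_one ht, Finset.sum_insert (by simp), ← ih]
    ring

lemma sq_sub_le_of_subset (f : ℤ → ℝ) {s t : ℤ} {I : Finset ℤ} (h : s ≤ t)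
    (hI : Finset.Ico s t ⊆ I) :
    (f t - f s) ^ 2 ≤ (t - s : ℝ) * ∑ r ∈ I, (f (r + 1) - f r) ^ 2 := by
  have h1 : (f t - f s) ^ 2 ≤ (Finset.Ico s t).card *
      ∑ r ∈ Finset.Ico s t, (f (r + 1) - f r) ^ 2 := by
    rw [sub_eq_sum_Ico f h]
    exact sq_sum_le_card_mul_sum_sq
  have h2 : ((Finset.Ico s t).card : ℝ) = t - s := by
    rw [Int.card_Ico, ← Int.cast_natCast, Int.toNat_of_nonneg (by linarith)]
    push_cast; ring
  rw [h2] at h1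
  have h3 : (0 : ℝ) ≤ t - s := by
    rw [sub_nonneg]; exact_mod_cast h
  exact h1.trans (mul_le_mul_of_nonneg_left
    (Finset.sum_le_sum_of_subset_of_nonneg hI fun _ _ _ => sq_nonneg _) h3)

lemma sq_sub_le_Ico (f : ℤ → ℝ) {a s t : ℤ} {M : ℕ} (hs : s ∈ Finset.Ico a (a + M))
    (ht : t ∈ Finset.Ico a (a + M)) :
    (f t - f s) ^ 2 ≤ |(t : ℝ) - s| * ∑ r ∈ Finset.Ico a (a + M), (f (r + 1) - f r) ^ 2 := by
  rw [Finset.mem_Ico] at hs ht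
  rcases le_total s t with h | h
  · rw [abs_of_nonneg (by rw [sub_nonneg]; exact_mod_cast h)]
    exact sq_sub_le_of_subset f h fun r hr => by
      rw [Finset.mem_Ico] at hr ⊢; omega
  · rw [abs_of_nonpos (by rw [sub_nonpos]; exact_mod_cast h), neg_sub, ← neg_sq, neg_sub]
    exact sq_sub_le_of_subset f h fun r hr => by
      rw [Finset.mem_Ico] at hr ⊢; omega

/-- One-dimensional discrete Sobolev inequality. -/
lemma sq_le_average_add (f : ℤ → ℝ) {a s : ℤ} {M : ℕ} (hs : s ∈ Finset.Ico a (a + M)) :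
    f s ^ 2 ≤ 2 / M * ∑ r ∈ Finset.Ico a (a + M), f r ^ 2 +
      2 * M * ∑ r ∈ Finset.Ico a (a + M), (f (r + 1) - f r) ^ 2 := by
  have hM : 0 < (M : ℝ) := by
    rw [Finset.mem_Ico] at hs
    have : 0 < M := by omega
    exact_mod_cast this
  set D := ∑ r ∈ Finset.Ico a (a + M), (f (r + 1) - f r) ^ 2 with hD
  have hD0 : 0 ≤ D := Finset.sum_nonneg fun _ _ => sq_nonneg _
  have h1 : ∀ r ∈ Finset.Ico a (a + M), f s ^ 2 ≤ 2 * f r ^ 2 + 2 * (M * D) := by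
    intro r hr
    have h2 := sq_sub_le_Ico f hr hs
    have h3 : |(s : ℝ) - r| ≤ M := by
      rw [Finset.mem_Ico] at hs hr
      rw [abs_le]
      constructor
      · have : (r : ℝ) ≤ s + M := by exact_mod_cast (by omega : r ≤ s + M)
        linarith
      · have : (s : ℝ) ≤ r + M := by exact_mod_cast (by omega : s ≤ r + M)
        linarith
    have h4 : |(s : ℝ) - r| * D ≤ M * D := by gcongr
    nlinarith [sq_nonneg (f s - 2 * f r)]
  have h2 := Finset.sum_le_sum h1
  rw [Finset.sum_const, Finset.sum_add_distrib, Finset.sum_const, ← Finset.mul_sum] at h2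
  simp only [Int.card_Ico, add_sub_cancel_left, Int.toNat_natCast, nsmul_eq_mul] at h2
  have h3 : f s ^ 2 = (M * f s ^ 2) / M := by field_simp
  rw [h3, div_le_iff₀ hM]
  refine h2.trans (le_of_eq ?_)
  field_simp

lemma sum_update_slice_le {J : Finset ι} {k : ι} (hk : k ∉ J) {y x : ι → ℤ} {M : ℕ}
    {h : (ι → ℤ) → ℝ} (hh : ∀ z, 0 ≤ h z) :
    ∑ z ∈ slice (insert k J) y M x, ∑ r ∈ Finset.Ico (y k) (y k + M), h (Function.update z k r) ≤
      ∑ z ∈ slice J y M x, h z := by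
  rw [← Finset.sum_product']
  rw [← Finset.sum_image (g := fun p : (ι → ℤ) × ℤ => Function.update p.1 k p.2)]
  · refine Finset.sum_le_sum_of_subset_of_nonneg ?_ fun z _ _ => hh z
    intro z hz
    obtain ⟨⟨z', r⟩, hp, rfl⟩ := Finset.mem_image.1 hz
    rw [Finset.mem_product, mem_slice, Finset.mem_Ico] at hp
    rw [mem_slice]
    intro i
    have hi := hp.1 i
    rcases eq_or_ne i k with rfl | hik
    · simpa [hk] using hp.2
    · simpa [hik] using hi
  · rintro ⟨z, r⟩ hp ⟨z', r'⟩ hp' heq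
    simp only [Finset.coe_product, mem_prod, Finset.mem_coe, mem_slice] at hp hp' heq
    have h1 := hp.1 k
    have h2 := hp'.1 k
    simp only [Finset.mem_insert, true_or, if_true] at h1 h2
    have h3 := congr_fun heq k
    simp only [Function.update_self] at h3
    refine Prod.ext (funext fun i => ?_) h3
    rcases eq_or_ne i k with rfl | hik
    · exact h1.trans h2.symm
    · simpa [hik] using congr_fun heq i

lemma fdiff_update (g : (ι → ℤ) → ℝ) (z : ι → ℤ) (k : ι) (r : ℤ) :
    fdiff k g (Function.update z k r) =
      g (Function.update z k (r + 1)) - g (Function.update z k r) := by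
  rw [fdiff]
  congr 2
  ext i
  rcases eq_or_ne i k with rfl | hik
  · simp
  · simp [hik]

lemma sum_slice_insert_le {J : Finset ι} {k : ι} (hk : k ∉ J) {y x : ι → ℤ} {M : ℕ}
    (hx : x ∈ box y M) (g : (ι → ℤ) → ℝ) :
    ∑ z ∈ slice (insert k J) y M x, g z ^ 2 ≤ 2 / M * ∑ z ∈ slice J y M x, g z ^ 2 +
      2 * M * ∑ z ∈ slice J y M x, fdiff k g z ^ 2 := by
  have h1 : ∀ z ∈ slice (insert k J) y M x, g z ^ 2 ≤
      2 / M * ∑ r ∈ Finset.Ico (y k) (y k + M), g (Function.update z k r) ^ 2 +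
      2 * M * ∑ r ∈ Finset.Ico (y k) (y k + M), fdiff k g (Function.update z k r) ^ 2 := by
    intro z hz
    have hzk : z k = x k := by simpa using mem_slice.1 hz k
    have := sq_le_average_add (fun r => g (Function.update z k r)) (a := y k) (s := z k) (M := M)
      (by rw [hzk, Finset.mem_Ico]; exact mem_box.1 hx k)
    simp only [fdiff_update]
    simpa using this
  refine (Finset.sum_le_sum h1).trans ?_
  rw [Finset.sum_add_distrib, ← Finset.mul_sum, ← Finset.mul_sum]
  gcongr
  · exact sum_update_slice_le hk (h := fun z => g z ^ 2) fun z => sq_nonneg _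
  · exact sum_update_slice_le hk (h := fun z => fdiff k g z ^ 2) fun z => sq_nonneg _

/-- Scale-invariant control on a box of the `ℓ²` norms of all differences up to order `m` in
directions other than `ℓ`. -/
def TangentialBound (ℓ : ι) (y : ι → ℤ) (M : ℕ) : ℕ → ((ι → ℤ) → ℝ) → ℝ → Prop
  | 0, g, a => ∑ z ∈ box y M, g z ^ 2 ≤ a
  | m + 1, g, a => ∑ z ∈ box y M, g z ^ 2 ≤ a ∧
      ∀ k, k ≠ ℓ → TangentialBound ℓ y M m (fdiff k g) (a / M ^ 2)

lemma TangentialBound.sum_le {ℓ : ι} {y : ι → ℤ} {M m : ℕ} {g : (ι → ℤ) → ℝ} {a : ℝ}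
    (h : TangentialBound ℓ y M m g a) : ∑ z ∈ box y M, g z ^ 2 ≤ a := by
  cases m with
  | zero => exact h
  | succ m => exact h.1

lemma TangentialBound.mono {ℓ : ι} {y : ι → ℤ} {M m : ℕ} : ∀ {g : (ι → ℤ) → ℝ} {a b : ℝ},
    TangentialBound ℓ y M m g a → a ≤ b → TangentialBound ℓ y M m g b := by
  induction m with
  | zero => intro g a b h hab; exact le_trans h hab
  | succ m ih =>
    intro g a b h hab
    exact ⟨h.1.trans hab, fun k hk => ih (h.2 k hk) (by gcongr)⟩

lemma TangentialBound.sum_slice_le {ℓ : ι} {y x : ι → ℤ} {M : ℕ} (hx : x ∈ box y M)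
    (J : Finset ι) (hJ : ℓ ∉ J) : ∀ {m : ℕ} {g : (ι → ℤ) → ℝ} {a : ℝ}, J.card ≤ m →
      TangentialBound ℓ y M m g a →
      ∑ z ∈ slice J y M x, g z ^ 2 ≤ 4 ^ J.card / M ^ J.card * a := by
  have hM : 0 < (M : ℝ) := by
    have := mem_box.1 hx ℓ
    have : 0 < M := by omega
    exact_mod_cast this
  induction J using Finset.induction_on with
  | empty => intro m g a _ h; simpa [slice_empty] using h.sum_le
  | insert k J hk ih =>
    intro m g a hm h
    rw [Finset.card_insert_of_notMem hk] at hm ⊢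
    obtain ⟨m, rfl⟩ : ∃ m', m = m' + 1 := ⟨m - 1, by omega⟩
    have hkl : k ≠ ℓ := fun h => hJ (by simp [h])
    have hJl : ℓ ∉ J := fun h => hJ (by simp [h])
    have h1 : ∑ z ∈ slice J y M x, g z ^ 2 ≤ 4 ^ J.card / M ^ J.card * a := ih hJl (by omega) h
    have h2 := ih hJl (by omega) (h.2 k hkl)
    refine (sum_slice_insert_le hk hx g).trans ?_
    calc _ ≤ 2 / M * (4 ^ J.card / M ^ J.card * a) +
          2 * M * (4 ^ J.card / M ^ J.card * (a / M ^ 2)) := by gcongr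
      _ = _ := by field_simp; ring

lemma IsAdjointSolution.mono {A : ℤ → Matrix ι ι ℝ} {ℓ : ι} {ε : ℝ} {y : ι → ℤ} {ρ ρ' : ℝ}
    {w : (ι → ℤ) → ℝ} (hw : IsAdjointSolution A ℓ ε y ρ w) (h : ρ' ≤ ρ) :
    IsAdjointSolution A ℓ ε y ρ' w :=
  fun φ hφ => hw φ fun x hx => hφ x (h.trans_lt hx)

lemma box_subset_cube (y : ι → ℤ) (M : ℕ) : box y M ⊆ cube y M := by
  intro x hx
  rw [mem_box] at hx
  rw [mem_cube, dist_pi_le_iff (Nat.cast_nonneg M)]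
  intro i
  rw [Int.dist_eq, abs_le]
  have h1 : (y i : ℝ) ≤ x i := by exact_mod_cast (hx i).1
  have h2 : (x i : ℝ) < y i + M := by exact_mod_cast (hx i).2
  constructor <;> linarith

lemma sum_fdiff_le_sum_sum_fdiff (s : Finset (ι → ℤ)) (k : ι) (w : (ι → ℤ) → ℝ) :
    ∑ x ∈ s, fdiff k w x ^ 2 ≤ ∑ x ∈ s, ∑ i, fdiff i w x ^ 2 :=
  Finset.sum_le_sum fun x _ => Finset.single_le_sum (f := fun i => fdiff i w x ^ 2)
    (fun _ _ => sq_nonneg _) (Finset.mem_univ k)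

section Regularity

variable {A : ℤ → Matrix ι ι ℝ} {ℓ : ι} {lam K ε c : ℝ} {y : ι → ℤ} {M : ℕ}

lemma sum_fdiff_sq_le (hA : UniformlyElliptic A lam K) (hε : 0 ≤ ε) (hM : 4 ≤ M)
    (hc : caccioppoliConst lam K (Fintype.card ι) ≤ c) (k : ι) {w : (ι → ℤ) → ℝ} {ρ : ℝ}
    (hw : IsAdjointSolution A ℓ ε y (ρ + M) w) :
    ∑ x ∈ cube y ρ, fdiff k w x ^ 2 ≤ c / M ^ 2 * ∑ x ∈ cube y (ρ + M), w x ^ 2 := by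
  refine (sum_fdiff_le_sum_sum_fdiff _ k w).trans
    ((caccioppoli hA hε (by exact_mod_cast hM) hw).trans ?_)
  gcongr

lemma tangentialBound_solution (hA : UniformlyElliptic A lam K) (hε : 0 ≤ ε) (hM : 4 ≤ M)
    (hc : caccioppoliConst lam K (Fintype.card ι) ≤ c) (hc1 : 1 ≤ c) (m : ℕ) :
    ∀ {w : (ι → ℤ) → ℝ}, IsAdjointSolution A ℓ ε y (M + m * M) w →
      TangentialBound ℓ y M m w (c ^ m * ∑ x ∈ cube y (M + m * M), w x ^ 2) := by
  have hM1 : (4 : ℝ) ≤ M := by exact_mod_cast hM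
  induction m with
  | zero =>
    intro w _
    simp only [TangentialBound, pow_zero, one_mul, Nat.cast_zero, zero_mul, add_zero]
    exact Finset.sum_le_sum_of_subset_of_nonneg (box_subset_cube y M) fun _ _ _ => sq_nonneg _
  | succ m ih =>
    intro w hw
    push_cast at hw ⊢
    rw [show (M : ℝ) + (m + 1) * M = M + m * M + M by ring] at hw ⊢
    constructor
    · have h1 : ∑ z ∈ box y M, w z ^ 2 ≤ ∑ x ∈ cube y (M + m * M + M), w x ^ 2 :=
        (Finset.sum_le_sum_of_subset_of_nonneg (box_subset_cube y M)
          fun _ _ _ => sq_nonneg _).trans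
          (sum_cube_mono (fun x => sq_nonneg _) y (by nlinarith [Nat.cast_nonneg (α := ℝ) m]))
      refine h1.trans (le_mul_of_one_le_left ?_ (one_le_pow₀ hc1))
      exact Finset.sum_nonneg fun _ _ => sq_nonneg _
    · intro k hk
      have hwk : IsAdjointSolution A ℓ ε y (M + m * M) (fdiff k w) :=
        (hw.mono (by linarith)).fdiff hk
      refine (ih hwk).mono ?_
      calc c ^ m * ∑ x ∈ cube y (M + m * M), fdiff k w x ^ 2
          ≤ c ^ m * (c / M ^ 2 * ∑ x ∈ cube y (M + m * M + M), w x ^ 2) := by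
            gcongr
            exact sum_fdiff_sq_le hA hε hM hc k hw
        _ = _ := by ring

lemma tangentialBound_fdiff_solution (hA : UniformlyElliptic A lam K) (hε : 0 ≤ ε) (hM : 4 ≤ M)
    (hc : caccioppoliConst lam K (Fintype.card ι) ≤ c) (hc1 : 1 ≤ c) (m : ℕ) :
    ∀ {w : (ι → ℤ) → ℝ}, IsAdjointSolution A ℓ ε y (M + m * M + M) w →
      TangentialBound ℓ y M m (fdiff ℓ w)
        (c ^ m * (c / M ^ 2 * ∑ x ∈ cube y (M + m * M + M), w x ^ 2)) := by
  have hM1 : (4 : ℝ) ≤ M := by exact_mod_cast hM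
  induction m with
  | zero =>
    intro w hw
    simp only [TangentialBound, pow_zero, one_mul, Nat.cast_zero, zero_mul, add_zero] at hw ⊢
    exact (Finset.sum_le_sum_of_subset_of_nonneg (box_subset_cube y M)
      fun _ _ _ => sq_nonneg _).trans (sum_fdiff_sq_le hA hε hM hc ℓ hw)
  | succ m ih =>
    intro w hw
    push_cast at hw ⊢
    rw [show (M : ℝ) + (m + 1) * M = M + m * M + M by ring] at hw ⊢
    have hm0 : (0 : ℝ) ≤ m := Nat.cast_nonneg m
    constructor
    · have h1 : ∑ z ∈ box y M, fdiff ℓ w z ^ 2 ≤ ∑ x ∈ cube y (M + m * M + M), fdiff ℓ w x ^ 2 :=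
        (Finset.sum_le_sum_of_subset_of_nonneg (box_subset_cube y M)
          fun _ _ _ => sq_nonneg _).trans
          (sum_cube_mono (fun x => sq_nonneg _) y (by nlinarith))
      refine (h1.trans (sum_fdiff_sq_le hA hε hM hc ℓ hw)).trans
        (le_mul_of_one_le_left ?_ (one_le_pow₀ hc1))
      have : 0 ≤ ∑ x ∈ cube y (M + m * M + M + M), w x ^ 2 :=
        Finset.sum_nonneg fun _ _ => sq_nonneg _
      positivity
    · intro k hk
      have hwk : IsAdjointSolution A ℓ ε y (M + m * M + M) (fdiff k w) :=
        (hw.mono (by linarith)).fdiff hk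
      rw [fdiff_comm]
      refine (ih hwk).mono ?_
      calc c ^ m * (c / M ^ 2 * ∑ x ∈ cube y (M + m * M + M), fdiff k w x ^ 2)
          ≤ c ^ m * (c / M ^ 2 * (c / M ^ 2 * ∑ x ∈ cube y (M + m * M + M + M), w x ^ 2)) := by
            gcongr
            exact sum_fdiff_sq_le hA hε hM hc k hw
        _ = _ := by ring

lemma sum_slice_fdiff_le (hA : UniformlyElliptic A lam K) (hε : 0 ≤ ε) (hM : 4 ≤ M)
    (hc : caccioppoliConst lam K (Fintype.card ι) ≤ c) (hc1 : 1 ≤ c) {w : (ι → ℤ) → ℝ}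
    (hw : IsAdjointSolution A ℓ ε y ((Fintype.card ι + 3) * M) w) {x : ι → ℤ} (hx : x ∈ box y M)
    (k : ι) :
    ∑ z ∈ slice (Finset.univ.erase k) y M x, fdiff k w z ^ 2 ≤
      (4 * c) ^ (Fintype.card ι + 2) / M ^ (Fintype.card ι + 1) *
        ∑ z ∈ cube y ((Fintype.card ι + 3) * M), w z ^ 2 := by
  set N := Fintype.card ι with hN
  have hM1 : (4 : ℝ) ≤ M := by exact_mod_cast hM
  have hM0 : (0 : ℝ) < M := by linarith
  have hN1 : 1 ≤ N := Fintype.card_pos_iff.2 ⟨ℓ⟩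
  set S := ∑ z ∈ cube y ((N + 3) * M), w z ^ 2 with hS
  have hS0 : 0 ≤ S := Finset.sum_nonneg fun _ _ => sq_nonneg _
  rcases eq_or_ne k ℓ with rfl | hk
  · have hcard : (Finset.univ.erase k).card + 1 = N := by
      rw [Finset.card_erase_of_mem (Finset.mem_univ k), Finset.card_univ, ← hN]; omega
    have h1 := TangentialBound.sum_slice_le hx (Finset.univ.erase k) (by simp)
      (m := N) (by omega) (tangentialBound_fdiff_solution (ℓ := k) hA hε hM hc hc1 N
        (hw.mono (by nlinarith)))
    refine h1.trans ?_
    have h2 : ∑ x ∈ cube y (M + N * M + M), w x ^ 2 ≤ S :=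
      sum_cube_mono (fun x => sq_nonneg _) y (by nlinarith)
    generalize (Finset.univ.erase k).card = q at hcard
    rw [← hcard] at h2 ⊢
    calc (4 : ℝ) ^ q / M ^ q * (c ^ (q + 1) * (c / M ^ 2 *
            ∑ x ∈ cube y (M + ((q + 1 : ℕ) : ℝ) * M + M), w x ^ 2))
        ≤ (4 : ℝ) ^ q / M ^ q * (c ^ (q + 1) * (c / M ^ 2 * S)) := by gcongr
      _ = 4 ^ q * c ^ (q + 2) * 1 / M ^ (q + 1 + 1) * S := by field_simp; ring
      _ ≤ 4 ^ q * c ^ (q + 2) * (4 ^ 3 * c) / M ^ (q + 1 + 1) * S := by gcongr; nlinarith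
      _ = _ := by ring
  · set J := (Finset.univ.erase k).erase ℓ with hJ
    have hℓ : ℓ ∈ Finset.univ.erase k := by simp [hk.symm]
    have hins : insert ℓ J = Finset.univ.erase k := Finset.insert_erase hℓ
    have hcard : J.card + 2 = N := by
      have h1 := Finset.card_erase_add_one hℓ
      rw [← hJ, Finset.card_erase_of_mem (Finset.mem_univ k), Finset.card_univ, ← hN] at h1
      have h2 : 0 < (Finset.univ.erase k).card := Finset.card_pos.2 ⟨ℓ, hℓ⟩
      rw [Finset.card_erase_of_mem (Finset.mem_univ k), Finset.card_univ, ← hN] at h2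
      omega
    have hg : IsAdjointSolution A ℓ ε y (M + N * M + M) (fdiff k w) :=
      (hw.mono (by nlinarith)).fdiff hk
    have h1 := TangentialBound.sum_slice_le hx J (by simp [hJ]) (m := N) (by omega)
      (tangentialBound_solution hA hε hM hc hc1 N (hg.mono (by linarith)))
    have h2 := TangentialBound.sum_slice_le hx J (by simp [hJ]) (m := N) (by omega)
      (tangentialBound_fdiff_solution hA hε hM hc hc1 N hg)
    have h3 : ∑ x ∈ cube y (M + N * M + M), fdiff k w x ^ 2 ≤ c / M ^ 2 * S := by
      have := sum_fdiff_sq_le hA hε hM hc k (ρ := M + N * M + M) (hw.mono (by nlinarith))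
      rwa [show (M : ℝ) + N * M + M + M = (N + 3) * M by ring] at this
    have h4 : ∑ x ∈ cube y (M + N * M), fdiff k w x ^ 2 ≤ c / M ^ 2 * S :=
      (sum_cube_mono (fun x => sq_nonneg _) y (by linarith)).trans h3
    rw [← hins]
    refine (sum_slice_insert_le (by simp [hJ]) hx _).trans ?_
    generalize J.card = q at *
    calc _ ≤ 2 / M * (4 ^ q / M ^ q * (c ^ N * (c / M ^ 2 * S))) +
          2 * M * (4 ^ q / M ^ q * (c ^ N * (c / M ^ 2 * (c / M ^ 2 * S)))) := by
          gcongr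
          · exact h1.trans (by gcongr)
          · exact h2.trans (by gcongr)
      _ = 4 ^ q * c ^ (q + 2) * (2 * c + 2 * c ^ 2) / M ^ (q + 3) * S := by
          rw [← hcard]; field_simp; ring
      _ ≤ 4 ^ q * c ^ (q + 2) * (4 ^ 4 * c ^ 2) / M ^ (q + 3) * S := by gcongr; nlinarith
      _ = _ := by rw [← hcard]; ring

/-- Hölder estimate (with exponent `1/2`) for local adjoint solutions. -/
lemma abs_sub_le_of_isAdjointSolution (hA : UniformlyElliptic A lam K) (hε : 0 ≤ ε) (hM : 4 ≤ M)
    (hc : caccioppoliConst lam K (Fintype.card ι) ≤ c) (hc1 : 1 ≤ c) {w : (ι → ℤ) → ℝ}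
    (hw : IsAdjointSolution A ℓ ε y ((Fintype.card ι + 3) * M) w) {x z : ι → ℤ}
    (hx : x ∈ box y M) (hz : z ∈ box y M) :
    |w z - w x| ≤ Fintype.card ι * √(dist z x * ((4 * c) ^ (Fintype.card ι + 2) /
      M ^ (Fintype.card ι + 1) * ∑ z ∈ cube y ((Fintype.card ι + 3) * M), w z ^ 2)) := by
  set B := (4 * c) ^ (Fintype.card ι + 2) / M ^ (Fintype.card ι + 1) *
    ∑ z ∈ cube y ((Fintype.card ι + 3) * M), w z ^ 2 with hB
  have hB0 : 0 ≤ B := by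
    have : 0 ≤ ∑ z ∈ cube y ((Fintype.card ι + 3) * M), w z ^ 2 :=
      Finset.sum_nonneg fun _ _ => sq_nonneg _
    positivity
  have key : ∀ J : Finset ι, |w (J.piecewise z x) - w x| ≤ J.card * √(dist z x * B) := by
    intro J
    induction J using Finset.induction_on with
    | empty => simp
    | insert k J hk ih =>
      set v := J.piecewise z x with hv
      have hvb : v ∈ box y M := by
        rw [mem_box] at *
        intro i
        by_cases hi : i ∈ J <;> simp [hv, hi, hx i, hz i]
      have h1 := sq_sub_le_Ico (fun r => w (Function.update v k r)) (a := y k) (M := M)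
        (Finset.mem_Ico.2 (mem_box.1 hvb k)) (Finset.mem_Ico.2 (mem_box.1 hz k))
      simp only [Function.update_eq_self, ← fdiff_update] at h1
      have h2 := sum_update_slice_le (J := Finset.univ.erase k) (k := k) (by simp) (y := y)
        (x := v) (M := M) (h := fun z => fdiff k w z ^ 2) fun z => sq_nonneg _
      rw [Finset.insert_erase (Finset.mem_univ k), show slice Finset.univ y M v = {v} by
        simp [slice], Finset.sum_singleton] at h2
      have h3 := h2.trans (sum_slice_fdiff_le hA hε hM hc hc1 hw hvb k)
      have hvk : v k = x k := by simp [hv, hk]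
      have h4 : |(z k : ℝ) - v k| ≤ dist z x := by
        rw [hvk, ← Int.dist_eq]
        exact dist_le_pi_dist z x k
      have h5 : (w (Function.update v k (z k)) - w v) ^ 2 ≤ dist z x * B :=
        h1.trans (mul_le_mul h4 h3 (Finset.sum_nonneg fun _ _ => sq_nonneg _) dist_nonneg)
      rw [Finset.piecewise_insert, Finset.card_insert_of_notMem hk]
      have h6 := Real.abs_le_sqrt h5
      calc |w (Function.update v k (z k)) - w x|
          ≤ |w (Function.update v k (z k)) - w v| + |w v - w x| := abs_sub_le _ _ _
        _ ≤ √(dist z x * B) + J.card * √(dist z x * B) := add_le_add h6 ih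
        _ = _ := by push_cast; ring
  simpa using key Finset.univ

end Regularity

/-- Square-summable functions on the lattice. -/
abbrev Ell2 (ι : Type*) := lp (fun _ : ι → ℤ => ℝ) 2

lemma summable_sq (u : Ell2 ι) : Summable fun x => u x ^ 2 := by
  simpa [pow_two] using lp.summable_inner (𝕜 := ℝ) u u

lemma norm_sq_eq_tsum (u : Ell2 ι) : ‖u‖ ^ 2 = ∑' x, u x ^ 2 := by
  rw [← real_inner_self_eq_norm_sq, lp.inner_eq_tsum]
  simp [pow_two]

lemma inner_eq_tsum_mul (u v : Ell2 ι) : inner ℝ u v = ∑' x, u x * v x := by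
  rw [lp.inner_eq_tsum]
  simp [mul_comm]

lemma summable_mul (u v : Ell2 ι) : Summable fun x => u x * v x := by
  simpa [mul_comm] using lp.summable_inner (𝕜 := ℝ) u v

lemma sum_sq_le_norm_sq (u : Ell2 ι) (s : Finset (ι → ℤ)) : ∑ x ∈ s, u x ^ 2 ≤ ‖u‖ ^ 2 := by
  rw [norm_sq_eq_tsum]
  exact (summable_sq u).sum_le_tsum s fun _ _ => sq_nonneg _

lemma coe_add (u v : Ell2 ι) (x : ι → ℤ) : (u + v) x = u x + v x := rfl

lemma coe_sum {κ : Type*} (s : Finset κ) (F : κ → Ell2 ι) (x : ι → ℤ) :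
    (∑ i ∈ s, F i) x = ∑ i ∈ s, F i x := by
  rw [lp.coeFn_sum]
  exact Finset.sum_apply x s fun i => (F i : (ι → ℤ) → ℝ)

lemma memℓp_two_of_summable {f : (ι → ℤ) → ℝ} (h : Summable fun x => f x ^ 2) :
    Memℓp f 2 := memℓp_gen (by simpa using h)

/-- A square-summable function as an element of `ℓ²`. -/
def ofSummable (f : (ι → ℤ) → ℝ) (h : Summable fun x => f x ^ 2) : Ell2 ι :=
  ⟨f, memℓp_two_of_summable h⟩

@[simp] lemma ofSummable_apply (f : (ι → ℤ) → ℝ) (h : Summable fun x => f x ^ 2) (x : ι → ℤ) :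
    ofSummable f h x = f x := rfl

lemma summable_sq_of_finite {f : (ι → ℤ) → ℝ} (h : f.support.Finite) :
    Summable fun x => f x ^ 2 :=
  summable_of_ne_finset_zero (s := h.toFinset) fun x hx => by simpa using hx

/-- A pointwise defined bounded linear operator on `ℓ²`. -/
noncomputable def opOfBound (T : ((ι → ℤ) → ℝ) →ₗ[ℝ] ((ι → ℤ) → ℝ)) (K : ℝ) (hK : 0 ≤ K)
    (hs : ∀ u : Ell2 ι, Summable fun x => T u x ^ 2)
    (hT : ∀ u : Ell2 ι, ∑' x, T u x ^ 2 ≤ K ^ 2 * ∑' x, u x ^ 2) : Ell2 ι →L[ℝ] Ell2 ι :=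
  LinearMap.mkContinuous (σ := RingHom.id ℝ) (E := Ell2 ι) (F := Ell2 ι)
    { toFun := fun u => ofSummable (T u) (hs u)
      map_add' := fun u v => Subtype.ext (T.map_add (u : (ι → ℤ) → ℝ) v)
      map_smul' := fun c u => Subtype.ext (T.map_smul c (u : (ι → ℤ) → ℝ)) } K (by
    intro u
    refine ((sq_le_sq₀ (norm_nonneg _) (by positivity)).1 ?_)
    rw [mul_pow, norm_sq_eq_tsum, norm_sq_eq_tsum]
    exact hT u)

/-- Translation as a bounded operator on `ℓ²`. -/
noncomputable def shift (a : ι → ℤ) : Ell2 ι →L[ℝ] Ell2 ι :=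
  opOfBound (LinearMap.funLeft ℝ ℝ fun x => x + a) 1 zero_le_one
    (fun u => (summable_sq u).comp_injective (add_left_injective a))
    (fun u => by
      rw [one_pow, one_mul, ← (Equiv.addRight a).tsum_eq fun x => u x ^ 2]
      rfl)

@[simp] lemma shift_apply (a : ι → ℤ) (u : Ell2 ι) (x : ι → ℤ) : shift a u x = u (x + a) := rfl

lemma mul_sq_le {m K : ℝ} (h : |m| ≤ K) (a : ℝ) : (m * a) ^ 2 ≤ K ^ 2 * a ^ 2 := by
  rw [mul_pow, ← sq_abs m]
  gcongr

lemma summable_mul_sq {m : (ι → ℤ) → ℝ} {K : ℝ} (hm : ∀ x, |m x| ≤ K) (u : Ell2 ι) :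
    Summable fun x => (m x * u x) ^ 2 :=
  ((summable_sq u).mul_left (K ^ 2)).of_nonneg_of_le (fun _ => sq_nonneg _)
    fun x => mul_sq_le (hm x) _

/-- Multiplication by a bounded function as a bounded operator on `ℓ²`. -/
noncomputable def mulOp (m : (ι → ℤ) → ℝ) {K : ℝ} (hm : ∀ x, |m x| ≤ K) : Ell2 ι →L[ℝ] Ell2 ι :=
  opOfBound (LinearMap.mulLeft ℝ m) K ((abs_nonneg _).trans (hm 0)) (summable_mul_sq hm)
    (fun u => by
      rw [← tsum_mul_left]
      exact (summable_mul_sq hm u).tsum_le_tsum (fun x => mul_sq_le (hm x) _)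
        ((summable_sq u).mul_left _))

@[simp] lemma mulOp_apply (m : (ι → ℤ) → ℝ) {K : ℝ} (hm : ∀ x, |m x| ≤ K) (u : Ell2 ι)
    (x : ι → ℤ) : mulOp m hm u x = m x * u x := rfl

/-- Forward difference operator on `ℓ²`. -/
noncomputable def diff (i : ι) : Ell2 ι →L[ℝ] Ell2 ι := shift (Pi.single i 1) - 1

/-- Backward difference operator on `ℓ²` (with sign), the adjoint of the forward one. -/
noncomputable def bdiff (i : ι) : Ell2 ι →L[ℝ] Ell2 ι := shift (-Pi.single i 1) - 1

@[simp] lemma diff_apply (i : ι) (u : Ell2 ι) (x : ι → ℤ) : diff i u x = fdiff i u x := rfl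

@[simp] lemma bdiff_apply (i : ι) (u : Ell2 ι) (x : ι → ℤ) :
    bdiff i u x = u (x - Pi.single i 1) - u x := by
  rw [sub_eq_add_neg]; rfl

lemma coe_diff (i : ι) (u : Ell2 ι) : (diff i u : (ι → ℤ) → ℝ) = fdiff i u := rfl

lemma inner_shift (a : ι → ℤ) (u v : Ell2 ι) : inner ℝ (shift (-a) u) v = inner ℝ u (shift a v) := by
  rw [inner_eq_tsum_mul, inner_eq_tsum_mul, ← (Equiv.addRight a).tsum_eq]
  simp

lemma inner_bdiff (i : ι) (u v : Ell2 ι) : inner ℝ (bdiff i u) v = inner ℝ u (diff i v) := by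
  simp only [bdiff, diff, _root_.sub_apply, inner_sub_left, inner_sub_right,
    inner_shift, one_apply_eq_self]

section Operator

variable {A : ℤ → Matrix ι ι ℝ} {lam K : ℝ}

/-- The divergence form operator `ε u - Σ ∂_i^*(A_ij ∂_j u)` on `ℓ²`. -/
noncomputable def ellOp (hA : UniformlyElliptic A lam K) (ℓ : ι) (ε : ℝ) : Ell2 ι →L[ℝ] Ell2 ι :=
  ε • 1 + ∑ i, bdiff i ∘L ∑ j, mulOp (fun x => A (x ℓ) i j) (fun x => hA.bound (x ℓ) i j) ∘L diff j

variable (hA : UniformlyElliptic A lam K) (ℓ : ι) (ε : ℝ)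

lemma ellOp_apply (u : Ell2 ι) (x : ι → ℤ) : ellOp hA ℓ ε u x = ε * u x +
    ∑ i, (∑ j, A ((x - Pi.single i 1 : ι → ℤ) ℓ) i j * fdiff j u (x - Pi.single i 1) -
      ∑ j, A (x ℓ) i j * fdiff j u x) := by
  simp only [ellOp, _root_.add_apply, _root_.sum_apply, ContinuousLinearMap.comp_apply,
    coe_add, coe_sum, bdiff_apply, mulOp_apply, diff_apply]
  rfl

lemma inner_ellOp (u v : Ell2 ι) :
    inner ℝ (ellOp hA ℓ ε u) v = ε * inner ℝ u v + energy A ℓ u v := by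
  have h : energy A ℓ u v = ∑ i, ∑ j, inner ℝ (mulOp (fun x => A (x ℓ) i j)
      (fun x => hA.bound (x ℓ) i j) (diff j u)) (diff i v) := by
    simp only [inner_eq_tsum_mul, energy]
    rw [Summable.tsum_finsetSum fun i _ => summable_sum fun j _ => ?_]
    · refine Finset.sum_congr rfl fun i _ => ?_
      rw [Summable.tsum_finsetSum fun j _ => ?_]
      · simp
      · exact summable_mul (mulOp (fun x => A (x ℓ) i j)
          (fun x => hA.bound (x ℓ) i j) (diff j u)) (diff i v)
    · exact summable_mul (mulOp (fun x => A (x ℓ) i j)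
        (fun x => hA.bound (x ℓ) i j) (diff j u)) (diff i v)
  rw [h]
  simp only [ellOp, _root_.add_apply, inner_add_left, _root_.smul_apply,
    one_apply_eq_self, real_inner_smul_left, _root_.sum_apply,
    sum_inner, ContinuousLinearMap.comp_apply, inner_bdiff]

lemma energy_coercive (hA : UniformlyElliptic A lam K) (ℓ : ι) (u : Ell2 ι) : lam * ∑ i, ‖diff i u‖ ^ 2 ≤ energy A ℓ u u := by
  have hs : Summable fun x => ∑ i, fdiff i u x ^ 2 := summable_sum fun i _ => summable_sq (diff i u)
  have h1 : ∑ i, ‖diff i u‖ ^ 2 = ∑' x, ∑ i, fdiff i u x ^ 2 := by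
    simp only [norm_sq_eq_tsum]
    exact (Summable.tsum_finsetSum fun i _ => summable_sq (diff i u)).symm
  rw [h1, ← tsum_mul_left]
  refine (hs.mul_left lam).tsum_le_tsum (fun x => hA.coercive (x ℓ) fun i => fdiff i u x) ?_
  exact summable_sum fun i _ => summable_sum fun j _ => summable_mul (mulOp (fun x => A (x ℓ) i j)
        (fun x => hA.bound (x ℓ) i j) (diff j u)) (diff i u)

lemma isUnit_ellOp (hε : 0 < ε) : IsUnit (ellOp hA ℓ ε) := by
  refine ContinuousLinearMap.isUnit_of_forall_le_norm_inner_map _ (c := ⟨ε, hε.le⟩) hε fun u => ?_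
  rw [inner_ellOp, real_inner_self_eq_norm_sq]
  have h1 := energy_coercive hA ℓ u
  have h2 : 0 ≤ lam * ∑ i, ‖diff i u‖ ^ 2 :=
    mul_nonneg hA.pos.le (Finset.sum_nonneg fun _ _ => sq_nonneg _)
  refine le_trans ?_ (le_abs_self _)
  change ‖u‖ ^ 2 * ε ≤ _
  linarith

lemma diff_ellOp {k : ι} (hk : k ≠ ℓ) (u : Ell2 ι) :
    diff k (ellOp hA ℓ ε u) = ellOp hA ℓ ε (diff k u) := by
  ext x
  have h1 : ((x + Pi.single k 1 : ι → ℤ)) ℓ = x ℓ := by simp [Pi.single_eq_of_ne hk.symm]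
  have h2 : ∀ i, ((x + Pi.single k 1 - Pi.single i 1 : ι → ℤ)) ℓ
      = (x - Pi.single i 1 : ι → ℤ) ℓ := by simp [Pi.single_eq_of_ne hk.symm]
  have h3 : ∀ (j : ι) z, fdiff j (diff k u) z = fdiff j u (z + Pi.single k 1) - fdiff j u z := by
    intro j z
    rw [coe_diff, fdiff_comm]; rfl
  rw [diff_apply, fdiff, ellOp_apply, ellOp_apply, ellOp_apply]
  simp only [h1, h2, h3, diff_apply, mul_sub, Finset.sum_sub_distrib,
    sub_add_eq_add_sub]
  rw [fdiff]
  ring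

/-- The operator `∂_i ∂_k (ellOp)⁻¹`. -/
noncomputable def secondDiffOp (i k : ι) : Ell2 ι →L[ℝ] Ell2 ι :=
  diff i ∘L diff k ∘L Ring.inverse (ellOp hA ℓ ε)

lemma secondDiffOp_ellOp (hε : 0 < ε) (i k : ι) (u : Ell2 ι) :
    secondDiffOp hA ℓ ε i k (ellOp hA ℓ ε u) = diff i (diff k u) := by
  have := congrArg (fun f => f u) (Ring.inverse_mul_cancel _ (isUnit_ellOp hA ℓ ε hε))
  simp only [mul_apply_eq_comp, one_apply_eq_self] at this
  simp [secondDiffOp, this]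

lemma norm_bdiff (k : ι) (u : Ell2 ι) : ‖bdiff k u‖ = ‖diff k u‖ := by
  refine (sq_eq_sq₀ (norm_nonneg _) (norm_nonneg _)).1 ?_
  rw [norm_sq_eq_tsum, norm_sq_eq_tsum, ← (Equiv.addRight (Pi.single k 1)).tsum_eq]
  refine tsum_congr fun x => ?_
  simp [fdiff]
  ring

lemma norm_secondDiffOp_le (hε : 0 < ε) (i : ι) {k : ι} (hk : k ≠ ℓ) (f : Ell2 ι) :
    ‖secondDiffOp hA ℓ ε i k f‖ ≤ lam⁻¹ * ‖f‖ := by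
  obtain ⟨u, rfl⟩ : ∃ u, ellOp hA ℓ ε u = f := ⟨Ring.inverse (ellOp hA ℓ ε) f, by
    have := congrArg (fun g => g f) (Ring.mul_inverse_cancel _ (isUnit_ellOp hA ℓ ε hε))
    simpa using this⟩
  rw [secondDiffOp_ellOp hA ℓ ε hε]
  set f := ellOp hA ℓ ε u with hf
  have h1 : lam * ∑ i, ‖diff i (diff k u)‖ ^ 2 ≤ ‖f‖ * ‖diff k (diff k u)‖ :=
    calc _ ≤ energy A ℓ (diff k u) (diff k u) := energy_coercive hA ℓ _
      _ ≤ inner ℝ (ellOp hA ℓ ε (diff k u)) (diff k u) := by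
        rw [inner_ellOp]
        have := real_inner_self_nonneg (x := diff k u)
        nlinarith
      _ = inner ℝ f (bdiff k (diff k u)) := by
        rw [← diff_ellOp hA ℓ ε hk, real_inner_comm, ← inner_bdiff, real_inner_comm]
      _ ≤ ‖f‖ * ‖bdiff k (diff k u)‖ := real_inner_le_norm _ _
      _ = _ := by rw [norm_bdiff]
  have h2 : ∀ j, ‖diff j (diff k u)‖ ^ 2 ≤ ∑ i, ‖diff i (diff k u)‖ ^ 2 := fun j =>
    Finset.single_le_sum (f := fun i => ‖diff i (diff k u)‖ ^ 2)
      (fun _ _ => sq_nonneg _) (Finset.mem_univ j)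
  have hlam := hA.pos
  have h3 : lam * ‖diff k (diff k u)‖ ≤ ‖f‖ := by
    rcases (norm_nonneg (diff k (diff k u))).eq_or_lt with h | h
    · rw [← h, mul_zero]; positivity
    · have := (mul_le_mul_of_nonneg_left (h2 k) hlam.le).trans h1
      rw [pow_two, ← mul_assoc] at this
      exact le_of_mul_le_mul_right this h
  rw [inv_mul_eq_div, le_div_iff₀ hlam, mul_comm]
  have h4 := (mul_le_mul_of_nonneg_left (h2 i) hlam.le).trans h1
  refine abs_le_of_sq_le_sq' ?_ (norm_nonneg f) |>.2
  nlinarith [norm_nonneg f, norm_nonneg (diff k (diff k u))]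

lemma isAdjointSolution_adjoint (hε : 0 < ε) (i k : ι) {y : ι → ℤ} {ρ : ℝ} (g : Ell2 ι)
    (hg : ∀ x, dist x y ≤ ρ + 2 → g x = 0) :
    IsAdjointSolution A ℓ ε y ρ ((secondDiffOp hA ℓ ε i k).adjoint g) := by
  intro φ hφ
  have hfin : φ.support.Finite := (cube y ρ).finite_toSet.subset fun x hx => by
    by_contra h
    exact hx (hφ x (by simpa using h))
  set u := ofSummable φ (summable_sq_of_finite hfin)
  have h1 := inner_ellOp hA ℓ ε u ((secondDiffOp hA ℓ ε i k).adjoint g)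
  rw [ContinuousLinearMap.adjoint_inner_right, secondDiffOp_ellOp hA ℓ ε hε,
    inner_eq_tsum_mul, inner_eq_tsum_mul] at h1
  have h2 : ∀ x, (diff i (diff k u)) x * g x = 0 := by
    intro x
    by_cases hx : dist x y ≤ ρ + 2
    · rw [hg x hx, mul_zero]
    · rw [diff_apply, coe_diff]
      have : fdiff i (fdiff k φ) x = 0 :=
        fdiff_eq_zero_of_far (ρ := ρ + 1) (fun z hz => fdiff_eq_zero_of_far hφ k z hz) i x
          (by linarith)
      change fdiff i (fdiff k φ) x * _ = 0
      rw [this, zero_mul]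
  simp only [h2, tsum_zero] at h1
  exact h1.symm

end Operator

lemma card_cube_le (y : ι → ℤ) (R : ℕ) : (cube y R).card ≤ (2 * R + 1) ^ Fintype.card ι := by
  have h : cube y R ⊆ Fintype.piFinset fun i => Finset.Icc (y i - R) (y i + R) := by
    intro x hx
    rw [mem_cube, dist_pi_le_iff (Nat.cast_nonneg R)] at hx
    rw [Fintype.mem_piFinset]
    intro i
    have := hx i
    rw [Int.dist_eq, abs_le] at this
    rw [Finset.mem_Icc]
    have h1 : -(R : ℤ) ≤ x i - y i := by exact_mod_cast this.1
    have h2 : (x i : ℤ) - y i ≤ R := by exact_mod_cast this.2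
    constructor <;> linarith
  refine (Finset.card_le_card h).trans ?_
  rw [Fintype.card_piFinset]
  simp only [Int.card_Icc]
  rw [Finset.prod_congr rfl (g := fun _ => 2 * R + 1) fun i _ => by omega]
  simp

lemma dist_le_of_mem_box {y x : ι → ℤ} {M : ℕ} (hx : x ∈ box y M) : dist x y ≤ M :=
  mem_cube.1 (box_subset_cube y M hx)

lemma self_mem_box (y : ι → ℤ) {M : ℕ} (hM : 0 < M) : y ∈ box y M := by
  rw [mem_box]
  intro i
  constructor <;> omega

lemma box_mono (y : ι → ℤ) {M M' : ℕ} (h : M ≤ M') : box y M ⊆ box y M' := by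
  intro x hx
  rw [mem_box] at hx ⊢
  intro i
  have := hx i
  constructor <;> omega

lemma inner_eq_sum {b : Ell2 ι} {s : Finset (ι → ℤ)} (hb : ∀ x ∉ s, b x = 0) (w : Ell2 ι) :
    inner ℝ b w = ∑ x ∈ s, b x * w x := by
  rw [inner_eq_tsum_mul, tsum_eq_sum fun x hx => by rw [hb x hx, zero_mul]]

section Hormander

variable {A : ℤ → Matrix ι ι ℝ} {lam K : ℝ} (hA : UniformlyElliptic A lam K) (ℓ : ι) {ε : ℝ}

/-- The constant in the estimate on a shell. -/
noncomputable def shellConst (lam K : ℝ) (N c₁ : ℕ) : ℝ :=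
  N * √((4 * max (caccioppoliConst lam K N) 1) ^ (N + 2) * (lam⁻¹ ^ 2 * (2 * c₁ + 1) ^ N))

lemma sum_shell_le (hε : 0 < ε) (i : ι) {k : ι} (hk : k ≠ ℓ) {y : ι → ℤ} {M₀ M c₁ : ℕ}
    (hM₀ : 0 < M₀) (hM : 4 ≤ M) (hMM : M₀ ≤ M) {b : Ell2 ι} (hb : ∀ x ∉ box y M₀, b x = 0)
    (hb0 : ∑ x ∈ box y M₀, b x = 0) {X : Finset (ι → ℤ)}
    (hX : ∀ x ∈ X, (Fintype.card ι + 3) * M + 2 < dist x y) (hX' : ∀ x ∈ X, dist x y ≤ c₁ * M) :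
    ∑ x ∈ X, |secondDiffOp hA ℓ ε i k b x| ≤
      shellConst lam K (Fintype.card ι) c₁ * √(M₀ / M) * ∑ x ∈ box y M₀, |b x| := by
  set N := Fintype.card ι with hN
  set c := max (caccioppoliConst lam K N) 1
  have hM0 : (0 : ℝ) < M := by exact_mod_cast (by omega : 0 < M)
  set T := secondDiffOp hA ℓ ε i k
  set gf : (ι → ℤ) → ℝ := fun x => if x ∈ X then SignType.sign (T b x) else 0 with hgf
  have hfin : gf.support.Finite := X.finite_toSet.subset fun x hx => by
    by_contra h
    exact hx (if_neg h)
  set g : Ell2 ι := ofSummable gf (summable_sq_of_finite hfin) with hg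
  have hgX : ∀ x ∉ X, g x = 0 := fun x hx => if_neg hx
  set w := T.adjoint g with hw
  have hsol : IsAdjointSolution A ℓ ε y ((N + 3) * M) w :=
    isAdjointSolution_adjoint hA ℓ ε hε i k g fun x hx => hgX x fun h => by
      linarith [hX x h]
  have h1 : ∑ x ∈ X, |T b x| = ∑ x ∈ box y M₀, b x * w x := by
    rw [← inner_eq_sum hb, hw, ContinuousLinearMap.adjoint_inner_right, real_inner_comm,
      inner_eq_sum hgX]
    refine Finset.sum_congr rfl fun x hx => ?_
    change |T b x| = gf x * T b x
    rw [hgf]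
    simp only [if_pos hx, sign_mul_self]
  have h2 : ∑ x ∈ box y M₀, b x * w x = ∑ x ∈ box y M₀, b x * (w x - w y) := by
    simp only [mul_sub, Finset.sum_sub_distrib]
    rw [← Finset.sum_mul, hb0, zero_mul, sub_zero]
  have hgn : ‖g‖ ^ 2 ≤ ((2 * c₁ + 1) * M) ^ N := by
    have h3 : ‖g‖ ^ 2 ≤ X.card := by
      rw [← real_inner_self_eq_norm_sq, inner_eq_sum hgX, Finset.card_eq_sum_ones]
      push_cast
      refine Finset.sum_le_sum fun x _ => ?_
      change gf x * gf x ≤ 1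
      simp only [hgf]
      split_ifs
      · rcases lt_trichotomy (T b x) 0 with h | h | h <;> simp [h]
    have h4 : X.card ≤ (2 * (c₁ * M) + 1) ^ N :=
      (Finset.card_le_card fun x hx => by
        rw [mem_cube]; push_cast; exact hX' x hx).trans (card_cube_le y (c₁ * M))
    refine h3.trans ((Nat.cast_le.2 h4).trans ?_)
    push_cast
    gcongr
    have : (1 : ℝ) ≤ M := by exact_mod_cast (by omega : 1 ≤ M)
    nlinarith
  have hlam := hA.pos
  have hTn : ‖T.adjoint g‖ ≤ lam⁻¹ * ‖g‖ := by
    refine (ContinuousLinearMap.le_opNorm _ _).trans ?_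
    rw [LinearIsometryEquiv.norm_map]
    gcongr
    exact ContinuousLinearMap.opNorm_le_bound _ (by positivity)
      (norm_secondDiffOp_le hA ℓ ε hε i hk)
  have hS : ∑ z ∈ cube y ((N + 3) * M), w z ^ 2 ≤ lam⁻¹ ^ 2 * ((2 * c₁ + 1) * M) ^ N := by
    refine (sum_sq_le_norm_sq w _).trans ?_
    calc ‖w‖ ^ 2 ≤ (lam⁻¹ * ‖g‖) ^ 2 := by gcongr
      _ = lam⁻¹ ^ 2 * ‖g‖ ^ 2 := mul_pow _ _ _
      _ ≤ _ := by gcongr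
  have hosc : ∀ x ∈ box y M₀, |w x - w y| ≤ shellConst lam K N c₁ * √(M₀ / M) := by
    intro x hx
    have := abs_sub_le_of_isAdjointSolution hA hε.le hM (le_max_left _ 1) (le_max_right _ 1) hsol
      (box_mono y hMM (self_mem_box y hM₀)) (box_mono y hMM hx)
    refine this.trans ?_
    rw [shellConst, mul_assoc, ← Real.sqrt_mul' _ (by positivity)]
    refine mul_le_mul_of_nonneg_left (Real.sqrt_le_sqrt ?_) (Nat.cast_nonneg _)
    calc _ ≤ (M₀ : ℝ) * ((4 * c) ^ (N + 2) / M ^ (N + 1) *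
            (lam⁻¹ ^ 2 * ((2 * c₁ + 1) * M) ^ N)) := by
          gcongr
          exact dist_le_of_mem_box hx
      _ = _ := by
          rw [pow_succ (M : ℝ), mul_pow, mul_pow]
          field_simp
  rw [h1, h2, Finset.mul_sum]
  refine Finset.sum_le_sum fun x hx => ?_
  refine (le_abs_self _).trans ?_
  rw [abs_mul, mul_comm]
  gcongr
  exact hosc x hx

/-- Factor by which a cube is dilated in Hörmander's condition. -/
def dilation (N : ℕ) : ℕ := 4 * (N + 3) + 3

/-- Hörmander's condition for the operator `∂_i ∂_k (ellOp)⁻¹`. -/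
lemma sum_far_le (hε : 0 < ε) (i : ι) {k : ι} (hk : k ≠ ℓ) {y : ι → ℤ} {M₀ : ℕ}
    (hM₀ : 0 < M₀) {b : Ell2 ι} (hb : ∀ x ∉ box y M₀, b x = 0)
    (hb0 : ∑ x ∈ box y M₀, b x = 0) {X : Finset (ι → ℤ)}
    (hX : ∀ x ∈ X, dilation (Fintype.card ι) * M₀ < dist x y) :
    ∑ x ∈ X, |secondDiffOp hA ℓ ε i k b x| ≤
      4 * shellConst lam K (Fintype.card ι) (dilation (Fintype.card ι)) *
        ∑ x ∈ box y M₀, |b x| := by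
  set N := Fintype.card ι with hN
  set c₀ := dilation N with hc₀
  have hc₀' : (c₀ : ℝ) = 4 * (N + 3) + 3 := by simp [hc₀, dilation]
  have hc₀0 : (0 : ℝ) < c₀ := by rw [hc₀']; positivity
  have hM1 : (1 : ℝ) ≤ M₀ := by exact_mod_cast hM₀
  set μ : (ι → ℤ) → ℕ := fun x => Nat.log 2 ⌊dist x y / (c₀ * M₀)⌋₊
  have hμ : ∀ x ∈ X, c₀ * (2 ^ μ x * M₀) ≤ dist x y ∧ dist x y ≤ c₀ * (2 * (2 ^ μ x * M₀)) := by
    intro x hx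
    have h1 : 1 ≤ dist x y / (c₀ * M₀) := by
      rw [le_div_iff₀ (by positivity), one_mul]; exact (hX x hx).le
    have h2 : ⌊dist x y / (c₀ * M₀)⌋₊ ≠ 0 := (Nat.floor_pos.2 h1).ne'
    have h3 : ((2 ^ μ x : ℕ) : ℝ) ≤ dist x y / (c₀ * M₀) :=
      (Nat.cast_le.2 (Nat.pow_log_le_self 2 h2)).trans (Nat.floor_le (by positivity))
    have h4 : dist x y / (c₀ * M₀) < ((2 ^ (μ x + 1) : ℕ) : ℝ) :=
      (Nat.floor_lt (by positivity)).1 (Nat.lt_pow_succ_log_self one_lt_two _)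
    push_cast at h3 h4
    rw [le_div_iff₀ (by positivity)] at h3
    rw [div_lt_iff₀ (by positivity)] at h4
    constructor
    · linarith
    · rw [pow_succ] at h4; linarith
  set q : ℝ := √(1 / 2) with hq
  have hq0 : 0 ≤ q := Real.sqrt_nonneg _
  have hq1 : q ≤ 3 / 4 := by
    rw [hq, Real.sqrt_le_left (by norm_num)]; norm_num
  have hC : 0 ≤ shellConst lam K N c₀ := by unfold shellConst; positivity
  have hS : 0 ≤ ∑ x ∈ box y M₀, |b x| := Finset.sum_nonneg fun _ _ => abs_nonneg _
  have hshell : ∀ m ∈ X.image μ, ∑ x ∈ X with μ x = m, |secondDiffOp hA ℓ ε i k b x| ≤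
      q ^ m * (shellConst lam K N c₀ * ∑ x ∈ box y M₀, |b x|) := by
    intro m _
    have h2m : (1 : ℝ) ≤ 2 ^ m := one_le_pow₀ one_le_two
    have h := sum_shell_le hA ℓ hε i hk (M := 4 * 2 ^ m * M₀) (c₁ := c₀) hM₀
      (by nlinarith [Nat.one_le_two_pow (n := m)]) (by nlinarith [Nat.one_le_two_pow (n := m)])
      hb hb0 (X := X.filter fun x => μ x = m) (fun x hx => by
        rw [Finset.mem_filter] at hx
        have := (hμ x hx.1).1
        rw [hx.2, hc₀'] at this
        push_cast
        nlinarith [mul_le_mul h2m hM1 zero_le_one (by positivity)]) (fun x hx => by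
        rw [Finset.mem_filter] at hx
        have := (hμ x hx.1).2
        rw [hx.2] at this
        push_cast
        refine this.trans (mul_le_mul_of_nonneg_left ?_ hc₀0.le)
        nlinarith [mul_le_mul h2m hM1 zero_le_one (by positivity)])
    refine h.trans ?_
    have : √((M₀ : ℝ) / ((4 * 2 ^ m * M₀ : ℕ) : ℝ)) ≤ q ^ m := by
      rw [Real.sqrt_le_left (by positivity), ← pow_mul, mul_comm m 2, pow_mul, hq,
        Real.sq_sqrt (by norm_num)]
      push_cast
      rw [div_le_iff₀ (by positivity), one_div, inv_pow]
      field_simp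
      linarith
    calc _ ≤ shellConst lam K N c₀ * q ^ m * ∑ x ∈ box y M₀, |b x| := by gcongr
      _ = _ := by ring
  rw [← Finset.sum_fiberwise_of_maps_to (t := X.image μ) (g := μ)
    fun x hx => Finset.mem_image_of_mem μ hx]
  refine (Finset.sum_le_sum hshell).trans ?_
  rw [← Finset.sum_mul, mul_assoc]
  gcongr
  have hq' : q < 1 := by linarith
  refine ((summable_geometric_of_lt_one hq0 hq').sum_le_tsum _ fun m _ => by positivity).trans ?_
  rw [tsum_geometric_of_lt_one hq0 hq', inv_le_comm₀ (by linarith) (by norm_num)]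
  linarith

end Hormander

lemma sum_abs_le_of_support {f : (ι → ℤ) → ℝ} {F : Finset (ι → ℤ)} (hF : ∀ x ∉ F, f x = 0)
    (s : Finset (ι → ℤ)) : ∑ x ∈ s, |f x| ≤ ∑ x ∈ F, |f x| := by
  have h : ∑ x ∈ F, |f x| = ∑ x ∈ s ∪ F, |f x| :=
    Finset.sum_subset Finset.subset_union_right fun x _ hx => by rw [hF x hx, abs_zero]
  rw [h]
  exact Finset.sum_le_sum_of_subset_of_nonneg Finset.subset_union_left fun _ _ _ => abs_nonneg _

lemma card_box (y : ι → ℤ) (M : ℕ) : (box y M).card = M ^ Fintype.card ι := by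
  simp [box]

/-- Lower corner of the dyadic cube of side `2 ^ j` containing `x`. -/
def corner (j : ℕ) (x : ι → ℤ) : ι → ℤ := fun i => 2 ^ j * (x i / 2 ^ j)

lemma mem_box_corner {j : ℕ} {x z : ι → ℤ} : z ∈ box (corner j x) (2 ^ j) ↔
    ∀ i, z i / 2 ^ j = x i / 2 ^ j := by
  rw [mem_box]
  refine forall_congr' fun i => ?_
  have h : (0 : ℤ) < 2 ^ j := by positivity
  rw [Int.ediv_eq_iff_of_pos h, corner]
  push_cast
  constructor <;> rintro ⟨h1, h2⟩ <;> constructor <;> nlinarith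

lemma self_mem_box_corner (j : ℕ) (x : ι → ℤ) : x ∈ box (corner j x) (2 ^ j) :=
  mem_box_corner.2 fun _ => rfl

lemma corner_eq_of_mem {j j' : ℕ} {x z : ι → ℤ} (h : z ∈ box (corner j x) (2 ^ j)) (hj : j ≤ j') :
    corner j' z = corner j' x := by
  rw [mem_box_corner] at h
  obtain ⟨d, rfl⟩ := Nat.exists_eq_add_of_le hj
  ext i
  simp only [corner, pow_add]
  rw [← Int.ediv_ediv_of_nonneg (by positivity), ← Int.ediv_ediv_of_nonneg (by positivity), h i]

lemma box_corner_subset_succ (j : ℕ) (x : ι → ℤ) :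
    box (corner j x) (2 ^ j) ⊆ box (corner (j + 1) x) (2 ^ (j + 1)) := fun z hz => by
  rw [← corner_eq_of_mem hz j.le_succ]
  exact self_mem_box_corner _ _

/-- Selection of Calderón–Zygmund cubes. -/
lemma exists_calderonZygmund_cubes [Nonempty ι] {f : (ι → ℤ) → ℝ} {F : Finset (ι → ℤ)}
    (hF : ∀ x ∉ F, f x = 0) {t : ℝ} (ht : 0 < t) :
    ∃ 𝒬 : Finset ((ι → ℤ) × ℕ), (∀ p ∈ 𝒬, 0 < p.2) ∧
      (∀ p ∈ 𝒬, ∀ p' ∈ 𝒬, ∀ x, x ∈ box p.1 p.2 → x ∈ box p'.1 p'.2 → p = p') ∧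
      (∀ p ∈ 𝒬, t * p.2 ^ Fintype.card ι ≤ ∑ x ∈ box p.1 p.2, |f x|) ∧
      (∀ p ∈ 𝒬, ∑ x ∈ box p.1 p.2, |f x| ≤ 2 ^ Fintype.card ι * t * p.2 ^ Fintype.card ι) ∧
      (∀ x, (∀ p ∈ 𝒬, x ∉ box p.1 p.2) → |f x| ≤ t) := by
  classical
  set N := Fintype.card ι with hN
  have hN0 : N ≠ 0 := Fintype.card_ne_zero
  set Bad : (ι → ℤ) → ℕ → Prop := fun x j =>
    t * (2 ^ j : ℕ) ^ N < ∑ z ∈ box (corner j x) (2 ^ j), |f z| with hBad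
  have hsum := sum_abs_le_of_support hF
  obtain ⟨m, hm⟩ := pow_unbounded_of_one_lt ((∑ x ∈ F, |f x|) / t) one_lt_two
  have hle : ∀ {x j}, Bad x j → j ≤ m := by
    intro x j hj
    by_contra! hmj
    have h1 : t * (2 ^ j : ℕ) ^ N < ∑ x ∈ F, |f x| := hj.trans_le (hsum _)
    rw [div_lt_iff₀ ht] at hm
    have h2 : (2 : ℝ) ^ m ≤ ((2 ^ j : ℕ) : ℝ) ^ N := by
      push_cast
      rw [← pow_mul]
      refine pow_le_pow_right₀ one_le_two (hmj.le.trans (Nat.le_mul_of_pos_right _ ?_))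
      exact Nat.pos_of_ne_zero hN0
    nlinarith
  set J : (ι → ℤ) → ℕ := fun x => Nat.findGreatest (Bad x) m
  have hJ : ∀ {x j}, Bad x j → Bad x (J x) := fun {x j} h => Nat.findGreatest_spec (hle h) h
  have hJle : ∀ {x j}, Bad x j → j ≤ J x := fun {x j} h => Nat.le_findGreatest (hle h) h
  have hiff : ∀ {x z j j'}, z ∈ box (corner j x) (2 ^ j) → j ≤ j' → (Bad z j' ↔ Bad x j') := by
    intro x z j j' hz hj
    simp only [hBad, corner_eq_of_mem hz hj]
  have hJeq : ∀ {x z}, Bad x (J x) → z ∈ box (corner (J x) x) (2 ^ J x) →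
      Bad z (J z) ∧ J z = J x := by
    intro x z hx hz
    have h1 : Bad z (J x) := (hiff hz le_rfl).2 hx
    have h2 := hJle h1
    exact ⟨hJ h1, le_antisymm (hJle ((hiff hz h2).1 (hJ h1))) h2⟩
  refine ⟨(F.filter fun z => Bad z (J z)).image fun z => (corner (J z) z, 2 ^ J z), ?_, ?_, ?_, ?_,
    ?_⟩
  · simp only [Finset.mem_image, Finset.mem_filter]
    rintro p ⟨z, -, rfl⟩
    positivity
  · simp only [Finset.mem_image, Finset.mem_filter]
    rintro p ⟨z, ⟨-, hz⟩, rfl⟩ p' ⟨z', ⟨-, hz'⟩, rfl⟩ x hx hx'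
    have h1 := (hJeq hz hx).2
    have h2 := (hJeq hz' hx').2
    have h3 : J z = J z' := h1.symm.trans h2
    have h4 := corner_eq_of_mem hx le_rfl
    have h5 := corner_eq_of_mem hx' le_rfl
    rw [← h4, ← h5, h3]
  · simp only [Finset.mem_image, Finset.mem_filter]
    rintro p ⟨z, ⟨-, hz⟩, rfl⟩
    exact hz.le
  · simp only [Finset.mem_image, Finset.mem_filter]
    rintro p ⟨z, ⟨-, hz⟩, rfl⟩
    have h1 : ¬ Bad z (J z + 1) := fun h => by have := hJle h; omega
    rw [hBad] at h1
    simp only [not_lt] at h1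
    refine (Finset.sum_le_sum_of_subset_of_nonneg (box_corner_subset_succ (J z) z)
      fun _ _ _ => abs_nonneg _).trans (h1.trans ?_)
    push_cast
    rw [pow_succ, mul_pow]
    linarith
  · intro x hx
    by_contra! h
    have h0 : Bad x 0 := by
      have : box (corner 0 x) (2 ^ 0) = {x} := by
        ext z
        rw [mem_box_corner, Finset.mem_singleton]
        simp [funext_iff]
      simp only [hBad, this, Finset.sum_singleton]
      simpa using h
    have hxF : x ∈ F := by
      by_contra hxF
      rw [hF x hxF, abs_zero] at h
      linarith
    exact hx _ (Finset.mem_image_of_mem _ (Finset.mem_filter.2 ⟨hxF, hJ h0⟩))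
      (self_mem_box_corner _ _)

/-- Weak type `(1,1)` bound for operators on `ℓ²` satisfying Hörmander's condition. -/
lemma weak_type_of_hormander [Nonempty ι] {T : Ell2 ι →L[ℝ] Ell2 ι} {B H : ℝ} {D : ℕ}
    (hH0 : 0 ≤ H) (hB : ∀ f, ‖T f‖ ≤ B * ‖f‖)
    (hH : ∀ (y : ι → ℤ) (M : ℕ) (b : Ell2 ι), 0 < M → (∀ x ∉ box y M, b x = 0) →
      ∑ x ∈ box y M, b x = 0 → ∀ X : Finset (ι → ℤ), (∀ x ∈ X, D * M < dist x y) →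
      ∑ x ∈ X, |T b x| ≤ H * ∑ x ∈ box y M, |b x|)
    {f : Ell2 ι} {F : Finset (ι → ℤ)} (hF : ∀ x ∉ F, f x = 0) {t : ℝ} (ht : 0 < t)
    {X : Finset (ι → ℤ)} (hX : ∀ x ∈ X, t < |T f x|) :
    t * X.card ≤ ((2 * D + 1) ^ Fintype.card ι + 4 * B ^ 2 * 2 ^ Fintype.card ι + 4 * H) *
      ∑ x ∈ F, |f x| := by
  classical
  set N := Fintype.card ι with hN
  obtain ⟨𝒬, hpos, hdisj, hlow, hup, hout⟩ := exists_calderonZygmund_cubes hF ht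
  set I := ∑ x ∈ F, |f x| with hI
  have hI0 : 0 ≤ I := Finset.sum_nonneg fun _ _ => abs_nonneg _
  have hsum : ∀ s : Finset (ι → ℤ), ∑ x ∈ s, |f x| ≤ I := sum_abs_le_of_support hF
  set Q : (ι → ℤ) × ℕ → Finset (ι → ℤ) := fun p => box p.1 p.2 with hQ
  have hpd : (𝒬 : Set ((ι → ℤ) × ℕ)).PairwiseDisjoint Q := by
    intro p hp p' hp' hne
    rw [Function.onFun, Finset.disjoint_left]
    exact fun x hx hx' => hne (hdisj p hp p' hp' x hx hx')
  set Ω := 𝒬.biUnion Q with hΩ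
  have hΩsum : ∀ h : (ι → ℤ) → ℝ, ∑ x ∈ Ω, h x = ∑ p ∈ 𝒬, ∑ x ∈ Q p, h x :=
    fun h => Finset.sum_biUnion hpd
  have hQI : ∑ p ∈ 𝒬, ∑ x ∈ Q p, |f x| ≤ I := by rw [← hΩsum]; exact hsum Ω
  set av : (ι → ℤ) × ℕ → ℝ := fun p => (∑ x ∈ Q p, f x) / (p.2 : ℝ) ^ N with hav
  have hMpos : ∀ p ∈ 𝒬, (0 : ℝ) < (p.2 : ℝ) ^ N := fun p hp => by
    have : (0 : ℝ) < p.2 := by exact_mod_cast hpos p hp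
    positivity
  have havM : ∀ p ∈ 𝒬, ∑ x ∈ Q p, |av p| ≤ ∑ x ∈ Q p, |f x| := fun p hp => by
    rw [Finset.sum_const, card_box, nsmul_eq_mul, hav, abs_div, abs_of_pos (hMpos p hp)]
    push_cast
    rw [mul_div_cancel₀ _ (hMpos p hp).ne']
    exact Finset.abs_sum_le_sum_abs _ _
  have havt : ∀ p ∈ 𝒬, |av p| ≤ 2 ^ N * t := fun p hp => by
    rw [hav, abs_div, abs_of_pos (hMpos p hp), div_le_iff₀ (hMpos p hp)]
    exact (Finset.abs_sum_le_sum_abs _ _).trans (hup p hp)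
  set bf : (ι → ℤ) × ℕ → (ι → ℤ) → ℝ := fun p x => if x ∈ Q p then f x - av p else 0 with hbf
  have hbfin : ∀ p, (bf p).support.Finite := fun p => (Q p).finite_toSet.subset fun x hx => by
    by_contra h
    exact hx (if_neg h)
  set b : (ι → ℤ) × ℕ → Ell2 ι := fun p => ofSummable (bf p) (summable_sq_of_finite (hbfin p))
    with hb
  have hb_out : ∀ p, ∀ x ∉ Q p, b p x = 0 := fun p x hx => if_neg hx
  have hb_in : ∀ p, ∀ x ∈ Q p, b p x = f x - av p := fun p x hx => if_pos hx
  have hb_sum : ∀ p ∈ 𝒬, ∑ x ∈ Q p, b p x = 0 := fun p hp => by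
    rw [Finset.sum_congr rfl (hb_in p), Finset.sum_sub_distrib, Finset.sum_const, card_box,
      nsmul_eq_mul, hav]
    push_cast
    rw [mul_div_cancel₀ _ (hMpos p hp).ne', sub_self]
  have hb_abs : ∀ p ∈ 𝒬, ∑ x ∈ Q p, |b p x| ≤ 2 * ∑ x ∈ Q p, |f x| := fun p hp => by
    rw [Finset.sum_congr rfl fun x hx => by rw [hb_in p x hx], two_mul]
    refine (Finset.sum_le_sum fun x _ => abs_sub (f x) (av p)).trans ?_
    rw [Finset.sum_add_distrib]
    exact add_le_add le_rfl (havM p hp)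
  set g := f - ∑ p ∈ 𝒬, b p with hg
  have hgx : ∀ x, g x = f x - ∑ p ∈ 𝒬, b p x := fun x => by
    rw [hg, ← coe_sum]; rfl
  have hg_in : ∀ p ∈ 𝒬, ∀ x ∈ Q p, g x = av p := fun p hp x hx => by
    rw [hgx, Finset.sum_eq_single_of_mem p hp fun p' hp' hne => hb_out p' x fun hx' =>
      hne (hdisj p' hp' p hp x hx' hx), hb_in p x hx]
    ring
  have hg_out : ∀ x ∉ Ω, g x = f x := fun x hx => by
    rw [hgx, Finset.sum_eq_zero fun p hp => hb_out p x fun h =>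
      hx (Finset.mem_biUnion.2 ⟨p, hp, h⟩), sub_zero]
  have hg_t : ∀ x, |g x| ≤ 2 ^ N * t := fun x => by
    by_cases hx : x ∈ Ω
    · obtain ⟨p, hp, hxp⟩ := Finset.mem_biUnion.1 hx
      rw [hg_in p hp x hxp]
      exact havt p hp
    · rw [hg_out x hx]
      refine (hout x fun p hp h => hx (Finset.mem_biUnion.2 ⟨p, hp, h⟩)).trans ?_
      exact le_mul_of_one_le_left ht.le (one_le_pow₀ one_le_two)
  have hg_supp : ∀ x ∉ (F \ Ω) ∪ Ω, g x = 0 := fun x hx => by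
    simp only [Finset.mem_union, Finset.mem_sdiff, not_or, not_and, not_not] at hx
    rw [hg_out x hx.2, hF x fun h => hx.2 (hx.1 h)]
  have hg_sum : ∑ x ∈ (F \ Ω) ∪ Ω, |g x| ≤ I := by
    rw [Finset.sum_union Finset.sdiff_disjoint, hΩsum]
    refine le_trans ?_ (hsum ((F \ Ω) ∪ Ω))
    rw [Finset.sum_union Finset.sdiff_disjoint, hΩsum]
    refine add_le_add (Finset.sum_le_sum fun x hx => ?_) (Finset.sum_le_sum fun p hp => ?_)
    · rw [hg_out x (Finset.mem_sdiff.1 hx).2]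
    · rw [Finset.sum_congr rfl fun x hx => by rw [hg_in p hp x hx]]
      exact havM p hp
  have hg_norm : ‖g‖ ^ 2 ≤ 2 ^ N * t * I := by
    rw [← real_inner_self_eq_norm_sq, inner_eq_sum hg_supp]
    refine le_trans (Finset.sum_le_sum fun x _ => ?_) (le_trans (Finset.mul_sum _ _ _).symm.le
      (mul_le_mul_of_nonneg_left hg_sum (by positivity)))
    rw [← abs_mul_abs_self]
    gcongr
    exact hg_t x
  have hfg : f = g + ∑ p ∈ 𝒬, b p := by rw [hg, sub_add_cancel]
  set Ω' := 𝒬.biUnion fun p => cube p.1 (D * p.2 : ℕ) with hΩ'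
  have hcard1 : t * Ω'.card ≤ (2 * D + 1) ^ N * I := by
    have h1 : (Ω'.card : ℝ) ≤ ∑ p ∈ 𝒬, (2 * D + 1) ^ N * (p.2 : ℝ) ^ N := by
      refine (Nat.cast_le.2 Finset.card_biUnion_le).trans ?_
      rw [Nat.cast_sum]
      refine Finset.sum_le_sum fun p hp => ?_
      refine (Nat.cast_le.2 (card_cube_le p.1 (D * p.2))).trans ?_
      push_cast
      rw [← mul_pow]
      have : (1 : ℝ) ≤ p.2 := by exact_mod_cast hpos p hp
      gcongr
      nlinarith
    refine (mul_le_mul_of_nonneg_left h1 ht.le).trans ?_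
    rw [← Finset.mul_sum, mul_left_comm, Finset.mul_sum]
    gcongr
    exact (Finset.sum_le_sum hlow).trans hQI
  set X₁ := X.filter fun x => t / 2 < |T g x|
  have hcard2 : t * X₁.card ≤ 4 * B ^ 2 * 2 ^ N * I := by
    have h1 : X₁.card * (t / 2) ^ 2 ≤ ‖T g‖ ^ 2 := by
      refine le_trans ?_ (sum_sq_le_norm_sq (T g) X₁)
      rw [← nsmul_eq_mul]
      refine Finset.card_nsmul_le_sum _ _ _ fun x hx => ?_
      rw [← sq_abs (T g x)]
      have := (Finset.mem_filter.1 hx).2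
      gcongr
    have h2 : ‖T g‖ ^ 2 ≤ B ^ 2 * (2 ^ N * t * I) := by
      calc ‖T g‖ ^ 2 ≤ (B * ‖g‖) ^ 2 := by gcongr; exact hB g
        _ = B ^ 2 * ‖g‖ ^ 2 := mul_pow _ _ _
        _ ≤ _ := by gcongr
    have h3 := h1.trans h2
    refine le_of_mul_le_mul_right (a := t / 4) ?_ (by positivity)
    nlinarith
  set X₂ := X.filter fun x => x ∉ Ω' ∧ t / 2 < |∑ p ∈ 𝒬, T (b p) x|
  have hcard3 : t * X₂.card ≤ 4 * H * I := by
    have h1 : X₂.card * (t / 2) ≤ ∑ x ∈ X₂, |∑ p ∈ 𝒬, T (b p) x| := by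
      rw [← nsmul_eq_mul]
      exact Finset.card_nsmul_le_sum _ _ _ fun x hx => (Finset.mem_filter.1 hx).2.2.le
    have h2 : ∑ x ∈ X₂, |∑ p ∈ 𝒬, T (b p) x| ≤ ∑ p ∈ 𝒬, ∑ x ∈ X₂, |T (b p) x| := by
      rw [Finset.sum_comm]
      exact Finset.sum_le_sum fun x _ => Finset.abs_sum_le_sum_abs _ _
    have h3 : ∑ p ∈ 𝒬, ∑ x ∈ X₂, |T (b p) x| ≤ ∑ p ∈ 𝒬, H * (2 * ∑ x ∈ Q p, |f x|) := by
      refine Finset.sum_le_sum fun p hp => ?_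
      refine (hH p.1 p.2 (b p) (hpos p hp) (hb_out p) (hb_sum p hp) X₂ fun x hx => ?_).trans ?_
      · have h4 := (Finset.mem_filter.1 hx).2.1
        by_contra! h5
        refine h4 (Finset.mem_biUnion.2 ⟨p, hp, ?_⟩)
        rw [mem_cube]
        push_cast
        exact h5
      · gcongr
        exact hb_abs p hp
    have h4 : ∑ p ∈ 𝒬, H * (2 * ∑ x ∈ Q p, |f x|) ≤ H * (2 * I) := by
      rw [← Finset.mul_sum, ← Finset.mul_sum]
      gcongr
    linarith [h1.trans (h2.trans (h3.trans h4))]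
  have hXsub : X ⊆ Ω' ∪ (X₁ ∪ X₂) := by
    intro x hx
    by_contra h
    simp only [Finset.mem_union, not_or] at h
    obtain ⟨h1, h2, h3⟩ := h
    have h4 : |T g x| ≤ t / 2 := by
      by_contra! h4
      exact h2 (Finset.mem_filter.2 ⟨hx, h4⟩)
    have h5 : |∑ p ∈ 𝒬, T (b p) x| ≤ t / 2 := by
      by_contra! h5
      exact h3 (Finset.mem_filter.2 ⟨hx, h1, h5⟩)
    have h6 : T f x = T g x + ∑ p ∈ 𝒬, T (b p) x := by
      conv_lhs => rw [hfg, map_add, map_sum, coe_add, coe_sum]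
    have h7 := hX x hx
    rw [h6] at h7
    linarith [abs_add_le (T g x) (∑ p ∈ 𝒬, T (b p) x)]
  have hXcard : (X.card : ℝ) ≤ Ω'.card + (X₁.card + X₂.card) := by
    have := (Finset.card_le_card hXsub).trans
      ((Finset.card_union_le _ _).trans (Nat.add_le_add_left (Finset.card_union_le _ _) _))
    exact_mod_cast this
  calc t * X.card ≤ t * (Ω'.card + (X₁.card + X₂.card)) := by gcongr
    _ ≤ _ := by linarith

/-- The constant in the discrete weak type estimate. -/
noncomputable def weakConst (lam K : ℝ) (N : ℕ) : ℝ :=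
  (2 * dilation N + 1) ^ N + 4 * lam⁻¹ ^ 2 * 2 ^ N + 4 * (4 * shellConst lam K N (dilation N))

/-- Weak type estimate for second differences of lattice functions in terms of a divergence form
operator whose coefficients depend on a single variable. -/
lemma weak_type_secondDiff {A : ℤ → Matrix ι ι ℝ} {lam K : ℝ} (hA : UniformlyElliptic A lam K)
    (ℓ : ι) (i : ι) {k : ι} (hk : k ≠ ℓ) {u : (ι → ℤ) → ℝ} (hu : u.support.Finite) {t : ℝ}
    (ht : 0 < t) {X : Finset (ι → ℤ)} (hX : ∀ x ∈ X, t < |fdiff i (fdiff k u) x|)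
    {F : Finset (ι → ℤ)}
    (hF : ∀ x ∉ F, u x = 0 ∧ ∀ i j, fdiff j u x = 0 ∧ fdiff j u (x - Pi.single i 1) = 0) :
    t * X.card ≤ weakConst lam K (Fintype.card ι) *
      ∑ x ∈ F, |∑ i, (∑ j, A (x ℓ) i j * fdiff j u x -
        ∑ j, A ((x - Pi.single i 1 : ι → ℤ) ℓ) i j * fdiff j u (x - Pi.single i 1))| := by
  have : Nonempty ι := ⟨ℓ⟩
  set N := Fintype.card ι
  set U : Ell2 ι := ofSummable u (summable_sq_of_finite hu) with hU
  set L : (ι → ℤ) → ℝ := fun x => ∑ i, (∑ j, A (x ℓ) i j * fdiff j u x -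
        ∑ j, A ((x - Pi.single i 1 : ι → ℤ) ℓ) i j * fdiff j u (x - Pi.single i 1)) with hL
  have hop : ∀ ε x, ellOp hA ℓ ε U x = ε * u x - L x := fun ε x => by
    rw [ellOp_apply, hL, sub_eq_add_neg, ← Finset.sum_neg_distrib]
    congr 1
    refine Finset.sum_congr rfl fun i _ => ?_
    rw [neg_sub]
    rfl
  have hC : 0 ≤ weakConst lam K N := by
    unfold weakConst shellConst
    positivity
  have hmain : ∀ ε : ℝ, 0 < ε → t * X.card ≤ weakConst lam K N *
      (∑ x ∈ F, |L x| + ε * ∑ x ∈ F, |u x|) := by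
    intro ε hε
    have h := weak_type_of_hormander (T := secondDiffOp hA ℓ ε i k) (B := lam⁻¹)
      (H := 4 * shellConst lam K N (dilation N)) (D := dilation N)
      (by unfold shellConst; positivity) (norm_secondDiffOp_le hA ℓ ε hε i hk)
      (fun y M b hM hb hb0 X hX => sum_far_le hA ℓ hε i hk hM hb hb0 hX)
      (f := ellOp hA ℓ ε U) (F := F) (fun x hx => by
        have hL0 : L x = 0 := by
          rw [hL]
          refine Finset.sum_eq_zero fun i _ => ?_
          rw [Finset.sum_eq_zero fun j _ => by rw [((hF x hx).2 i j).1, mul_zero],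
            Finset.sum_eq_zero fun j _ => by rw [((hF x hx).2 i j).2, mul_zero], sub_zero]
        rw [hop, (hF x hx).1, hL0, mul_zero, sub_zero]) ht (X := X) (fun x hx => by
        rw [secondDiffOp_ellOp hA ℓ ε hε]
        exact hX x hx)
    refine h.trans (mul_le_mul_of_nonneg_left ?_ hC)
    rw [Finset.mul_sum, ← Finset.sum_add_distrib]
    refine Finset.sum_le_sum fun x _ => ?_
    rw [hop]
    refine (abs_sub _ _).trans ?_
    rw [abs_mul, abs_of_pos hε, add_comm]
  have hlim : Filter.Tendsto (fun ε : ℝ => weakConst lam K N *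
      (∑ x ∈ F, |L x| + ε * ∑ x ∈ F, |u x|)) (nhdsWithin 0 (Ioi 0))
      (nhds (weakConst lam K N * (∑ x ∈ F, |L x| + 0 * ∑ x ∈ F, |u x|))) := by
    refine Filter.Tendsto.mono_left ?_ nhdsWithin_le_nhds
    exact Continuous.tendsto (by fun_prop) 0
  rw [zero_mul, add_zero] at hlim
  exact ge_of_tendsto hlim (eventually_nhdsWithin_of_forall hmain)

end Lattice

namespace DirichletWeakType

open Filter
open scoped ENNReal Topology

variable {n : ℕ}

/-- The partial derivative `D_i u`. -/
noncomputable def pd (i : Fin n) (u : EuclideanSpace ℝ (Fin n) → ℝ)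
    (x : EuclideanSpace ℝ (Fin n)) : ℝ :=
  fderiv ℝ u x (EuclideanSpace.single i 1)

/-- Forward difference with step `h` in the direction `i`. -/
noncomputable def delta (h : ℝ) (i : Fin n) (u : EuclideanSpace ℝ (Fin n) → ℝ)
    (x : EuclideanSpace ℝ (Fin n)) : ℝ :=
  u (x + EuclideanSpace.single i h) - u x

lemma D2_eq_pd (u : EuclideanSpace ℝ (Fin n) → ℝ) (x : EuclideanSpace ℝ (Fin n)) (i j : Fin n) :
    D2 u x i j = pd i (pd j u) x := rfl

lemma contDiff_pd {m k : WithTop ℕ∞} (i : Fin n) {u : EuclideanSpace ℝ (Fin n) → ℝ}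
    (hu : ContDiff ℝ k u) (hmk : m + 1 ≤ k) : ContDiff ℝ m (pd i u) :=
  (hu.fderiv_right hmk).clm_apply contDiff_const

lemma continuous_D2 {u : EuclideanSpace ℝ (Fin n) → ℝ} (hu : ContDiff ℝ 2 u) (i j : Fin n) :
    Continuous fun x => D2 u x i j :=
  (contDiff_pd (m := 0) i (contDiff_pd (m := 1) j hu (by norm_num)) (by norm_num)).continuous

lemma delta_comm (h : ℝ) (i j : Fin n) (u : EuclideanSpace ℝ (Fin n) → ℝ) :
    delta h i (delta h j u) = delta h j (delta h i u) := by
  ext x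
  simp only [delta]
  rw [add_right_comm]
  ring

lemma smul_single (i : Fin n) (s : ℝ) :
    s • (EuclideanSpace.single i 1 : EuclideanSpace ℝ (Fin n)) = EuclideanSpace.single i s := by
  ext j
  by_cases h : j = i <;> simp [h]

lemma hasDerivAt_line {u : EuclideanSpace ℝ (Fin n) → ℝ} {x : EuclideanSpace ℝ (Fin n)} {s : ℝ}
    (i : Fin n) (hu : DifferentiableAt ℝ u (x + EuclideanSpace.single i s)) :
    HasDerivAt (fun s : ℝ => u (x + EuclideanSpace.single i s))
      (pd i u (x + EuclideanSpace.single i s)) s := by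
  have h1 : HasDerivAt (fun s : ℝ => x + (EuclideanSpace.single i s :
      EuclideanSpace ℝ (Fin n))) (EuclideanSpace.single i 1) s := by
    rw [show (fun s : ℝ => x + (EuclideanSpace.single i s : EuclideanSpace ℝ (Fin n))) =
      fun s : ℝ => x + s • (EuclideanSpace.single i 1 : EuclideanSpace ℝ (Fin n)) from
      funext fun s => by rw [smul_single]]
    simpa using ((hasDerivAt_id s).smul_const
      (EuclideanSpace.single i 1 : EuclideanSpace ℝ (Fin n))).const_add x
  exact hu.hasFDerivAt.comp_hasDerivAt s h1

lemma exists_delta_eq {u : EuclideanSpace ℝ (Fin n) → ℝ} (hu : Differentiable ℝ u) {h : ℝ}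
    (hh : 0 < h) (i : Fin n) (x : EuclideanSpace ℝ (Fin n)) :
    ∃ θ ∈ Ioo 0 h, delta h i u x = h * pd i u (x + EuclideanSpace.single i θ) := by
  obtain ⟨θ, hθ, he⟩ := exists_hasDerivAt_eq_slope
    (fun s : ℝ => u (x + EuclideanSpace.single i s))
    (fun s => pd i u (x + EuclideanSpace.single i s)) hh
    (fun s _ => (hasDerivAt_line i (hu _)).continuousAt.continuousWithinAt)
    (fun s _ => hasDerivAt_line i (hu _))
  refine ⟨θ, hθ, ?_⟩
  rw [he, delta]
  simp only [sub_zero]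
  rw [mul_div_cancel₀ _ hh.ne']
  congr 2
  rw [← smul_single, zero_smul, add_zero]

lemma pd_delta {u : EuclideanSpace ℝ (Fin n) → ℝ} (hu : Differentiable ℝ u) (h : ℝ)
    (i k : Fin n) : pd i (delta h k u) = delta h k (pd i u) := by
  ext x
  unfold pd delta
  have h1 : DifferentiableAt ℝ (fun x => u (x + EuclideanSpace.single k h)) x :=
    (hu.comp (differentiable_id.add_const _)) x
  rw [fderiv_fun_sub h1 (hu x), fderiv_comp_add_right]
  rfl

lemma exists_delta_delta_eq {u : EuclideanSpace ℝ (Fin n) → ℝ} (hu : ContDiff ℝ 2 u) {h : ℝ}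
    (hh : 0 < h) (i k : Fin n) (x : EuclideanSpace ℝ (Fin n)) :
    ∃ y, dist y x ≤ 2 * h ∧ delta h i (delta h k u) x = h ^ 2 * D2 u y i k := by
  have hd := hu.differentiable (by norm_num)
  rw [delta_comm]
  obtain ⟨θ, hθ, he⟩ := exists_delta_eq (u := delta h i u) ((hd.comp (differentiable_id.add_const _)).sub hd) hh k x
  rw [pd_delta hd] at he
  obtain ⟨θ', hθ', he'⟩ := exists_delta_eq ((contDiff_pd (m := 1) k hu
    (by norm_num)).differentiable (by norm_num)) hh i (x + EuclideanSpace.single k θ)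
  refine ⟨x + EuclideanSpace.single k θ + EuclideanSpace.single i θ', ?_, ?_⟩
  swap
  · rw [he, he', D2_eq_pd, sq, mul_assoc]
  · rw [dist_eq_norm, add_assoc, add_sub_cancel_left]
    refine (norm_add_le _ _).trans ?_
    rw [PiLp.norm_single, PiLp.norm_single, Real.norm_eq_abs,
      Real.norm_eq_abs, abs_of_pos hθ.1, abs_of_pos hθ'.1]
    linarith [hθ.2, hθ'.2]

/-- The point `h k` of the lattice of mesh `h`. -/
noncomputable def latticePoint (h : ℝ) (k : Fin n → ℤ) : EuclideanSpace ℝ (Fin n) :=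
  WithLp.toLp 2 fun i => h * k i

/-- The half-open cell `[0, h)ⁿ`. -/
def cell (n : ℕ) (h : ℝ) : Set (EuclideanSpace ℝ (Fin n)) := {x | ∀ i, 0 ≤ x i ∧ x i < h}

lemma measurableSet_cell (h : ℝ) : MeasurableSet (cell n h) := by
  simp only [cell, ofPred_forall]
  refine MeasurableSet.iInter fun i => ?_
  have hi : Measurable fun x : EuclideanSpace ℝ (Fin n) => x i := by fun_prop
  exact (measurableSet_le measurable_const hi).inter (measurableSet_lt hi measurable_const)

lemma sub_latticePoint_mem_cell {h : ℝ} (hh : 0 < h) (z : EuclideanSpace ℝ (Fin n))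
    (k : Fin n → ℤ) : z - latticePoint h k ∈ cell n h ↔ k = fun i => ⌊z i / h⌋ := by
  rw [funext_iff]
  refine forall_congr' fun i => ?_
  rw [eq_comm, Int.floor_eq_iff, le_div_iff₀ hh, div_lt_iff₀ hh]
  simp only [latticePoint, PiLp.sub_apply]
  constructor <;> rintro ⟨h1, h2⟩ <;> constructor <;> linarith

lemma setLIntegral_cell_tsum {h : ℝ} (hh : 0 < h) {f : EuclideanSpace ℝ (Fin n) → ℝ≥0∞}
    (hf : Measurable f) :
    ∫⁻ y in cell n h, ∑' k, f (y + latticePoint h k) = ∫⁻ y, f y := by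
  rw [lintegral_tsum fun k => Measurable.aemeasurable (by fun_prop)]
  have h1 : ∀ k, ∫⁻ y in cell n h, f (y + latticePoint h k) =
      ∫⁻ z, (cell n h).indicator 1 (z - latticePoint h k) * f z := fun k => by
    rw [← lintegral_indicator (measurableSet_cell h),
      ← lintegral_add_right_eq_self (fun z => (cell n h).indicator 1 (z - latticePoint h k) * f z)
        (latticePoint h k)]
    refine lintegral_congr fun y => ?_
    rw [add_sub_cancel_right]
    by_cases hy : y ∈ cell n h <;> simp [hy]
  simp_rw [h1]
  rw [← lintegral_tsum fun k => Measurable.aemeasurable ?_]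
  · refine lintegral_congr fun z => ?_
    rw [tsum_eq_single (fun i => ⌊z i / h⌋)]
    · rw [indicator_of_mem ((sub_latticePoint_mem_cell hh z _).2 rfl), Pi.one_apply, one_mul]
    · intro k hk
      rw [indicator_of_notMem fun hm => hk ((sub_latticePoint_mem_cell hh z k).1 hm), zero_mul]
  · exact ((measurable_one.indicator (measurableSet_cell h)).comp
      (measurable_id.sub_const _)).mul hf

lemma latticePoint_add_single (h : ℝ) (k : Fin n → ℤ) (i : Fin n) :
    latticePoint h (k + Pi.single i 1) = latticePoint h k + EuclideanSpace.single i h := by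
  ext j
  by_cases hj : j = i
  · subst hj; simp [latticePoint, mul_add]
  · simp [latticePoint, hj]

lemma latticePoint_sub_single (h : ℝ) (k : Fin n → ℤ) (i : Fin n) :
    latticePoint h (k - Pi.single i 1) = latticePoint h k - EuclideanSpace.single i h := by
  rw [eq_sub_iff_add_eq, ← latticePoint_add_single, sub_add_cancel]

lemma fdiff_comp_latticePoint (w : EuclideanSpace ℝ (Fin n) → ℝ) (y : EuclideanSpace ℝ (Fin n))
    (h : ℝ) (j : Fin n) :
    Lattice.fdiff j (fun k => w (y + latticePoint h k)) =
      fun k => delta h j w (y + latticePoint h k) := by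
  ext k
  simp only [Lattice.fdiff, delta, latticePoint_add_single, add_assoc]

/-- The difference operator `b^{ij}(x^ℓ) D_i^{-h} D_j^h`, multiplied by `h²`. -/
noncomputable def diffOp (b : ℝ → Matrix (Fin n) (Fin n) ℝ) (ℓ : Fin n) (h : ℝ)
    (w : EuclideanSpace ℝ (Fin n) → ℝ) (z : EuclideanSpace ℝ (Fin n)) : ℝ :=
  ∑ i, ∑ j, b (z ℓ) i j * delta h i (delta h j w) (z - EuclideanSpace.single i h)

lemma finite_support_comp_latticePoint {w : EuclideanSpace ℝ (Fin n) → ℝ}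
    (hw : HasCompactSupport w) (y : EuclideanSpace ℝ (Fin n)) {h : ℝ} (hh : 0 < h) :
    (Function.support fun k => w (y + latticePoint h k)).Finite := by
  obtain ⟨R, hR⟩ := hw.isCompact.isBounded.subset_closedBall 0
  refine (Lattice.cube (0 : Fin n → ℤ) ((R + ‖y‖) / h)).finite_toSet.subset fun k hk => ?_
  have h1 : ‖y + latticePoint h k‖ ≤ R := by
    simpa using hR (subset_tsupport _ hk)
  have h2 : ‖latticePoint h k‖ ≤ R + ‖y‖ := by
    have := norm_sub_le (y + latticePoint h k) y
    rw [add_sub_cancel_left] at this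
    linarith
  have h0 : 0 ≤ R + ‖y‖ := (norm_nonneg _).trans h2
  rw [SetLike.mem_coe, Lattice.mem_cube, dist_pi_le_iff (by positivity)]
  intro i
  rw [le_div_iff₀ hh]
  refine le_trans (le_of_eq ?_) ((PiLp.norm_apply_le (latticePoint h k) i).trans h2)
  simp [latticePoint, Int.norm_eq_abs, abs_of_pos hh, mul_comm]

lemma measurable_delta {w : EuclideanSpace ℝ (Fin n) → ℝ} (hw : Measurable w) (h : ℝ) (i : Fin n) :
    Measurable (delta h i w) := by
  unfold delta
  fun_prop

lemma measurable_diffOp {b : ℝ → Matrix (Fin n) (Fin n) ℝ} (hb : ∀ i j, Measurable fun s => b s i j)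
    (ℓ : Fin n) (h : ℝ) {w : EuclideanSpace ℝ (Fin n) → ℝ} (hw : Measurable w) :
    Measurable (diffOp b ℓ h w) := by
  unfold diffOp
  refine Finset.measurable_fun_sum _ fun i _ => Finset.measurable_fun_sum _ fun j _ => ?_
  refine ((hb i j).comp (by fun_prop)).mul ?_
  exact (measurable_delta (measurable_delta hw h j) h i).comp (by fun_prop)

/-- The lattice weak type estimate on the translate by `y` of the lattice of mesh `h`. -/
lemma tsum_indicator_le {b : ℝ → Matrix (Fin n) (Fin n) ℝ} {lam K : ℝ} {ℓ : Fin n}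
    (hlam : 0 < lam)
    (hb : ∀ s (ξ : Fin n → ℝ), lam * ∑ i, ξ i ^ 2 ≤ ∑ i, ∑ j, b s i j * ξ j * ξ i)
    (hK : ∀ s i j, |b s i j| ≤ K) (hconst : ∀ s s' j, b s ℓ j = b s' ℓ j)
    {w : EuclideanSpace ℝ (Fin n) → ℝ} (hw : HasCompactSupport w)
    {h : ℝ} (hh : 0 < h) (i : Fin n) {k : Fin n} (hk : k ≠ ℓ) {t : ℝ} (ht : 0 < t)
    (y : EuclideanSpace ℝ (Fin n)) :
    ∑' m, {z | t < |delta h i (delta h k w) z|}.indicator (fun _ => ENNReal.ofReal t)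
        (y + latticePoint h m) ≤
      ∑' m, ENNReal.ofReal (Lattice.weakConst lam K n) *
        ENNReal.ofReal |diffOp b ℓ h w (y + latticePoint h m)| := by
  classical
  set u : (Fin n → ℤ) → ℝ := fun m => w (y + latticePoint h m) with hu
  have hsupp : u.support.Finite := finite_support_comp_latticePoint hw y hh
  set A : ℤ → Matrix (Fin n) (Fin n) ℝ := fun m => b (y ℓ + h * m) with hA
  have hAe : Lattice.UniformlyElliptic A lam K := ⟨hlam, fun s => hb _, fun s => hK _⟩
  have hop : ∀ m : Fin n → ℤ, ∑ i, (∑ j, A (m ℓ) i j * Lattice.fdiff j u m -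
        ∑ j, A ((m - Pi.single i 1 : Fin n → ℤ) ℓ) i j * Lattice.fdiff j u (m - Pi.single i 1)) =
      diffOp b ℓ h w (y + latticePoint h m) := fun m => by
    refine Finset.sum_congr rfl fun i _ => ?_
    rw [← Finset.sum_sub_distrib]
    refine Finset.sum_congr rfl fun j _ => ?_
    have h1 : A ((m - Pi.single i 1 : Fin n → ℤ) ℓ) i j = A (m ℓ) i j := by
      by_cases hi : i = ℓ
      · subst hi; exact hconst _ _ _
      · simp [Pi.single_eq_of_ne (Ne.symm hi)]
    rw [h1, hu, fdiff_comp_latticePoint]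
    beta_reduce
    rw [latticePoint_sub_single, ← mul_sub]
    simp only [hA, delta, latticePoint, PiLp.add_apply]
    congr 1
    simp only [← add_sub_assoc, sub_add_cancel]
  set S : Set (Fin n → ℤ) := u.support ∪ ⋃ j, (Function.support (Lattice.fdiff j u) ∪
    ⋃ i, Function.support fun x => Lattice.fdiff j u (x - Pi.single i 1)) with hS
  have hfin : ∀ j, (Function.support (Lattice.fdiff j u)).Finite := fun j => by
    refine ((hsupp.preimage (f := fun x => x + Pi.single j 1)
      (add_left_injective _).injOn).union hsupp).subset fun x hx => ?_
    by_contra hc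
    simp only [mem_union, mem_preimage, Function.mem_support, not_or, not_not] at hc
    exact hx (by rw [Lattice.fdiff, hc.1, hc.2, sub_zero])
  have hSfin : S.Finite := hsupp.union (finite_iUnion fun j => (hfin j).union
    (finite_iUnion fun i => (hfin j).preimage (f := fun x => x - Pi.single i 1)
      (sub_left_injective).injOn))
  rw [ENNReal.tsum_eq_iSup_sum]
  refine iSup_le fun X => ?_
  have hX := Lattice.weak_type_secondDiff hAe ℓ i hk hsupp ht
    (X := X.filter fun m => t < |delta h i (delta h k w) (y + latticePoint h m)|)
    (F := hSfin.toFinset) (fun x hx => by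
      rw [hu, fdiff_comp_latticePoint, fdiff_comp_latticePoint]
      exact (Finset.mem_filter.1 hx).2) (fun x hx => by
      simp only [hS, Finite.mem_toFinset, mem_union, mem_iUnion, Function.mem_support,
        not_or, not_exists, not_not] at hx
      exact ⟨hx.1, fun i j => ⟨(hx.2 j).1, (hx.2 j).2 i⟩⟩)
  rw [Fintype.card_fin] at hX
  simp only [hop] at hX
  have hC : 0 ≤ Lattice.weakConst lam K n := by
    have hK0 : 0 ≤ K := (abs_nonneg _).trans (hK 0 ℓ ℓ)
    unfold Lattice.weakConst Lattice.shellConst Lattice.dilation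
    positivity
  calc ∑ m ∈ X, {z | t < |delta h i (delta h k w) z|}.indicator (fun _ => ENNReal.ofReal t)
        (y + latticePoint h m)
      = ENNReal.ofReal (t * (X.filter fun m =>
          t < |delta h i (delta h k w) (y + latticePoint h m)|).card) := by
        simp only [indicator_apply, mem_ofPred_eq]
        rw [← Finset.sum_filter, Finset.sum_const, nsmul_eq_mul, mul_comm,
          ENNReal.ofReal_mul ht.le, ENNReal.ofReal_natCast]
    _ ≤ ENNReal.ofReal (Lattice.weakConst lam K n *
          ∑ x ∈ hSfin.toFinset, |diffOp b ℓ h w (y + latticePoint h x)|) :=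
        ENNReal.ofReal_le_ofReal hX
    _ = ∑ x ∈ hSfin.toFinset, ENNReal.ofReal (Lattice.weakConst lam K n) *
          ENNReal.ofReal |diffOp b ℓ h w (y + latticePoint h x)| := by
        rw [ENNReal.ofReal_mul hC, ENNReal.ofReal_sum_of_nonneg fun _ _ => abs_nonneg _,
          Finset.mul_sum]
    _ ≤ _ := ENNReal.sum_le_tsum _

lemma weak_type_delta {b : ℝ → Matrix (Fin n) (Fin n) ℝ} {lam K : ℝ} {ℓ : Fin n}
    (hbm : ∀ i j, Measurable fun s => b s i j) (hlam : 0 < lam)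
    (hb : ∀ s (ξ : Fin n → ℝ), lam * ∑ i, ξ i ^ 2 ≤ ∑ i, ∑ j, b s i j * ξ j * ξ i)
    (hK : ∀ s i j, |b s i j| ≤ K) (hconst : ∀ s s' j, b s ℓ j = b s' ℓ j)
    {w : EuclideanSpace ℝ (Fin n) → ℝ} (hwm : Measurable w) (hw : HasCompactSupport w)
    {h : ℝ} (hh : 0 < h) (i : Fin n) {k : Fin n} (hk : k ≠ ℓ) {t : ℝ} (ht : 0 < t) :
    ENNReal.ofReal t * volume {z | t < |delta h i (delta h k w) z|} ≤
      ENNReal.ofReal (Lattice.weakConst lam K n) *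
        ∫⁻ z, ENNReal.ofReal |diffOp b ℓ h w z| := by
  have hS : MeasurableSet {z | t < |delta h i (delta h k w) z|} :=
    measurableSet_lt measurable_const
      (measurable_delta (measurable_delta hwm h k) h i).norm
  have hL : Measurable fun z => ENNReal.ofReal |diffOp b ℓ h w z| :=
    (measurable_diffOp hbm ℓ h hwm).norm.ennreal_ofReal
  rw [← lintegral_const_mul _ hL, ← setLIntegral_cell_tsum hh (hL.const_mul _),
    ← lintegral_indicator_const hS, ← setLIntegral_cell_tsum hh (measurable_const.indicator hS)]
  exact lintegral_mono fun y => tsum_indicator_le hlam hb hK hconst hw hh i hk ht y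

lemma tsupport_pd_subset (i : Fin n) (u : EuclideanSpace ℝ (Fin n) → ℝ) :
    tsupport (pd i u) ⊆ tsupport u := by
  refine (closure_mono fun x hx => ?_).trans (tsupport_fderiv_subset ℝ)
  simp only [Function.mem_support, pd] at hx ⊢
  intro h
  exact hx (by rw [h]; rfl)

lemma D2_eq_zero_of_notMem {u : EuclideanSpace ℝ (Fin n) → ℝ} {x : EuclideanSpace ℝ (Fin n)}
    (hx : x ∉ tsupport u) (i j : Fin n) : D2 u x i j = 0 := by
  by_contra h
  exact hx (tsupport_pd_subset j u (tsupport_pd_subset i _ (subset_tsupport _ h)))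

lemma exists_forall_abs_D2_le {u : EuclideanSpace ℝ (Fin n) → ℝ} (hu : ContDiff ℝ 2 u)
    (hc : HasCompactSupport u) : ∃ M, 0 ≤ M ∧ ∀ x i j, |D2 u x i j| ≤ M := by
  have h : ∀ i j, ∃ M, ∀ x, ‖D2 u x i j‖ ≤ M := fun i j =>
    (continuous_D2 hu i j).bounded_above_of_compact_support
      (hc.mono' fun x hx => by_contra fun h => hx (D2_eq_zero_of_notMem h i j))
  choose M hM using h
  refine ⟨∑ i, ∑ j, |M i j|, by positivity, fun x i j => (hM i j x).trans ?_⟩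
  refine (le_abs_self _).trans ?_
  refine (Finset.single_le_sum (f := fun j => |M i j|) (fun _ _ => abs_nonneg _)
    (Finset.mem_univ j)).trans ?_
  exact Finset.single_le_sum (f := fun i => ∑ j, |M i j|)
    (fun _ _ => Finset.sum_nonneg fun _ _ => abs_nonneg _) (Finset.mem_univ i)

lemma tendsto_delta_delta {w : EuclideanSpace ℝ (Fin n) → ℝ} (hw : ContDiff ℝ 2 w) {h : ℕ → ℝ}
    (hpos : ∀ m, 0 < h m) (hlim : Tendsto h atTop (𝓝 0)) {z : EuclideanSpace ℝ (Fin n)}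
    {z' : ℕ → EuclideanSpace ℝ (Fin n)} (hz : Tendsto z' atTop (𝓝 z)) (i j : Fin n) :
    Tendsto (fun m => (h m ^ 2)⁻¹ * delta (h m) i (delta (h m) j w) (z' m)) atTop
      (𝓝 (D2 w z i j)) := by
  choose y hy1 hy2 using fun m => exists_delta_delta_eq hw (hpos m) i j (z' m)
  have hy : Tendsto y atTop (𝓝 z) := by
    refine tendsto_of_tendsto_of_dist hz ?_
    refine squeeze_zero (g := fun m => 2 * h m) (fun _ => dist_nonneg)
      (fun m => by rw [dist_comm]; exact hy1 m) ?_
    simpa using hlim.const_mul 2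
  have he : ∀ m, (h m ^ 2)⁻¹ * delta (h m) i (delta (h m) j w) (z' m) = D2 w (y m) i j := fun m => by
    rw [hy2, ← mul_assoc, inv_mul_cancel₀ (pow_pos (hpos m) 2).ne', one_mul]
  simp_rw [he]
  exact ((continuous_D2 hw i j).tendsto z).comp hy

lemma delta_const_mul (h c : ℝ) (i : Fin n) (w : EuclideanSpace ℝ (Fin n) → ℝ) :
    delta h i (fun x => c * w x) = fun x => c * delta h i w x := by
  ext x
  simp only [delta]
  ring

/-- Weak type estimate for second derivatives in terms of a nondivergence form operator whose
coefficients depend on a single variable `x^ℓ`, the `ℓ`-th row being constant. -/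
lemma weak_type_D2_of_ne {b : ℝ → Matrix (Fin n) (Fin n) ℝ} {lam K : ℝ} {ℓ : Fin n}
    (hbm : ∀ i j, Measurable fun s => b s i j) (hlam : 0 < lam)
    (hb : ∀ s (ξ : Fin n → ℝ), lam * ∑ i, ξ i ^ 2 ≤ ∑ i, ∑ j, b s i j * ξ j * ξ i)
    (hK : ∀ s i j, |b s i j| ≤ K) (hconst : ∀ s s' j, b s ℓ j = b s' ℓ j)
    {w : EuclideanSpace ℝ (Fin n) → ℝ} (hw : ContDiff ℝ 2 w) (hwc : HasCompactSupport w)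
    (i : Fin n) {k : Fin n} (hk : k ≠ ℓ) {t : ℝ} (ht : 0 < t) :
    ENNReal.ofReal t * volume {z | t < |D2 w z i k|} ≤
      ENNReal.ofReal (Lattice.weakConst lam K n) *
        ∫⁻ z, ENNReal.ofReal |∑ i, ∑ j, b (z ℓ) i j * D2 w z i j| := by
  set h : ℕ → ℝ := fun m => 1 / ((m : ℝ) + 1) with hh
  have hpos : ∀ m, 0 < h m := fun m => by positivity
  have hle : ∀ m, h m ≤ 1 := fun m => by
    rw [hh]
    exact div_le_one_of_le₀ (by linarith [m.cast_nonneg (α := ℝ)]) (by positivity)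
  have hlim : Tendsto h atTop (𝓝 0) := tendsto_one_div_add_atTop_nhds_zero_nat
  have hK0 : 0 ≤ K := (abs_nonneg _).trans (hK 0 ℓ ℓ)
  obtain ⟨M, hM0, hM⟩ := exists_forall_abs_D2_le hw hwc
  obtain ⟨R, hR⟩ := hwc.isCompact.isBounded.subset_closedBall 0
  have hsingle : ∀ z : EuclideanSpace ℝ (Fin n), ∀ i,
      Tendsto (fun m => z - EuclideanSpace.single i (h m)) atTop (𝓝 z) := fun z i => by
    have h1 : Tendsto (fun m => z - h m • (EuclideanSpace.single i 1 :
        EuclideanSpace ℝ (Fin n))) atTop (𝓝 (z - (0 : ℝ) • EuclideanSpace.single i 1)) :=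
      (hlim.smul_const _).const_sub z
    simpa only [smul_single, zero_smul, sub_zero] using h1
  have hop : ∀ m z, diffOp b ℓ (h m) (fun x => (h m ^ 2)⁻¹ * w x) z = ∑ i, ∑ j, b (z ℓ) i j *
      ((h m ^ 2)⁻¹ * delta (h m) i (delta (h m) j w) (z - EuclideanSpace.single i (h m))) :=
    fun m z => by simp only [diffOp, delta_const_mul]
  have hweak : ∀ m, ENNReal.ofReal t *
      volume {z | t < |(h m ^ 2)⁻¹ * delta (h m) i (delta (h m) k w) z|} ≤
      ENNReal.ofReal (Lattice.weakConst lam K n) *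
        ∫⁻ z, ENNReal.ofReal |diffOp b ℓ (h m) (fun x => (h m ^ 2)⁻¹ * w x) z| := fun m => by
    have h1 := weak_type_delta hbm hlam hb hK hconst
      (w := fun x => (h m ^ 2)⁻¹ * w x) (hw.continuous.measurable.const_mul _)
      (hwc.mul_left) (hpos m) i hk ht
    simpa only [delta_const_mul] using h1
  have hInt : Tendsto (fun m => ∫⁻ z, ENNReal.ofReal
      |diffOp b ℓ (h m) (fun x => (h m ^ 2)⁻¹ * w x) z|) atTop
      (𝓝 (∫⁻ z, ENNReal.ofReal |∑ i, ∑ j, b (z ℓ) i j * D2 w z i j|)) := by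
    refine tendsto_lintegral_of_dominated_convergence
      ((closedBall 0 (R + 3)).indicator fun _ => ENNReal.ofReal (∑ _i : Fin n, ∑ _j : Fin n, K * M))
      (fun m => ?_) (fun m => ae_of_all _ fun z => ?_) ?_ (ae_of_all _ fun z => ?_)
    · exact (measurable_diffOp hbm ℓ _ (hw.continuous.measurable.const_mul _)).norm.ennreal_ofReal
    · choose y hy1 hy2 using fun i j => exists_delta_delta_eq hw (hpos m) i j
        (z - EuclideanSpace.single i (h m))
      have he : ∀ i j, (h m ^ 2)⁻¹ * delta (h m) i (delta (h m) j w)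
          (z - EuclideanSpace.single i (h m)) = D2 w (y i j) i j := fun i j => by
        rw [hy2, ← mul_assoc, inv_mul_cancel₀ (pow_pos (hpos m) 2).ne', one_mul]
      simp only [hop, he]
      by_cases hz : z ∈ closedBall 0 (R + 3)
      · rw [indicator_of_mem hz]
        refine ENNReal.ofReal_le_ofReal ((Finset.abs_sum_le_sum_abs _ _).trans
          (Finset.sum_le_sum fun i _ => (Finset.abs_sum_le_sum_abs _ _).trans
          (Finset.sum_le_sum fun j _ => ?_)))
        rw [abs_mul]
        exact mul_le_mul (hK _ _ _) (hM _ _ _) (abs_nonneg _) hK0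
      · rw [indicator_of_notMem hz, Finset.sum_eq_zero, abs_zero, ENNReal.ofReal_zero]
        refine fun i _ => Finset.sum_eq_zero fun j _ => ?_
        rw [D2_eq_zero_of_notMem, mul_zero]
        refine fun hy => hz ?_
        have h1 := hR hy
        rw [mem_closedBall] at h1 ⊢
        have h2 : dist z (z - EuclideanSpace.single i (h m)) ≤ 1 := by
          rw [dist_eq_norm, sub_sub_cancel, PiLp.norm_single, Real.norm_eq_abs,
            abs_of_pos (hpos m)]
          exact hle m
        have h3 := hy1 i j
        have h4 := dist_triangle4 z (z - EuclideanSpace.single i (h m)) (y i j) 0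
        rw [dist_comm (y i j)] at h3
        linarith [hle m]
    · rw [lintegral_indicator_const measurableSet_closedBall]
      exact ENNReal.mul_ne_top ENNReal.ofReal_ne_top measure_closedBall_lt_top.ne
    · refine (ENNReal.continuous_ofReal.tendsto _).comp (Tendsto.abs ?_)
      simp only [hop]
      exact tendsto_finsetSum _ fun i _ => tendsto_finsetSum _ fun j _ =>
        (tendsto_delta_delta hw hpos hlim (hsingle z i) i j).const_mul _
  set S : ℕ → Set (EuclideanSpace ℝ (Fin n)) := fun m =>
    {z | t < |(h m ^ 2)⁻¹ * delta (h m) i (delta (h m) k w) z|} with hS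
  have hsub : {z | t < |D2 w z i k|} ⊆ ⋃ N, ⋂ m ≥ N, S m := fun z hz => by
    have h1 := (tendsto_delta_delta hw hpos hlim (tendsto_const_nhds (x := z)) i k).abs
    obtain ⟨N, hN⟩ := eventually_atTop.1 (h1.eventually (lt_mem_nhds hz))
    exact mem_iUnion.2 ⟨N, mem_iInter₂.2 hN⟩
  have hmono : Monotone fun N => ⋂ m ≥ N, S m := fun N N' hN =>
    biInter_subset_biInter_left fun m hm => le_trans hN hm
  refine (mul_le_mul_right (measure_mono hsub) _).trans ?_
  rw [hmono.measure_iUnion, ENNReal.mul_iSup]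
  refine iSup_le fun N => ge_of_tendsto
    (ENNReal.Tendsto.const_mul hInt (Or.inr ENNReal.ofReal_ne_top)) ?_
  filter_upwards [eventually_ge_atTop N] with m hm
  exact (mul_le_mul_right (measure_mono (biInter_subset_of_mem hm)) _).trans (hweak m)

lemma D2_eq_fderiv_fderiv {u : EuclideanSpace ℝ (Fin n) → ℝ} {x : EuclideanSpace ℝ (Fin n)}
    (hu : ContDiffAt ℝ 2 u x) (i j : Fin n) :
    D2 u x i j = fderiv ℝ (fderiv ℝ u) x (EuclideanSpace.single i 1)
      (EuclideanSpace.single j 1) := by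
  have h : DifferentiableAt ℝ (fderiv ℝ u) x :=
    (hu.fderiv_right (m := 1) (by norm_num)).differentiableAt (by norm_num)
  rw [D2, fderiv_clm_apply h (differentiableAt_const _)]
  simp

lemma D2_comm {u : EuclideanSpace ℝ (Fin n) → ℝ} {x : EuclideanSpace ℝ (Fin n)}
    (hu : ContDiffAt ℝ 2 u x) (i j : Fin n) : D2 u x i j = D2 u x j i := by
  rw [D2_eq_fderiv_fderiv hu, D2_eq_fderiv_fderiv hu]
  exact hu.isSymmSndFDerivAt (by simp) _ _

namespace Elliptic

variable {δ Λ : ℝ} {a : Matrix (Fin n) (Fin n) ℝ}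

lemma le_diag (h : IsElliptic n δ Λ a) (ℓ : Fin n) : δ ≤ a ℓ ℓ := by
  have h1 := h.2.1 (Pi.single ℓ 1)
  simpa [Pi.single_apply] using h1

lemma diag_le (h : IsElliptic n δ Λ a) (ℓ : Fin n) : a ℓ ℓ ≤ Λ :=
  (le_abs_self _).trans (h.2.2 ℓ ℓ)

lemma apply_comm (h : IsElliptic n δ Λ a) (i j : Fin n) : a i j = a j i :=
  congrFun (congrFun h.1 j) i

end Elliptic

/-- The coefficients `a / a^{ℓℓ}` modified by an antisymmetric matrix so that the `ℓ`-th row is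
constant. -/
noncomputable def normalize (ℓ : Fin n) (a : Matrix (Fin n) (Fin n) ℝ) :
    Matrix (Fin n) (Fin n) ℝ := fun i j =>
  a i j / a ℓ ℓ + (if j = ℓ then if i = ℓ then 0 else a i ℓ / a ℓ ℓ else 0) -
    (if i = ℓ then if j = ℓ then 0 else a j ℓ / a ℓ ℓ else 0)

lemma sum_normalize_mul (ℓ : Fin n) (a : Matrix (Fin n) (Fin n) ℝ) {X : Fin n → Fin n → ℝ}
    (hX : ∀ i j, X i j = X j i) :
    ∑ i, ∑ j, normalize ℓ a i j * X i j = (∑ i, ∑ j, a i j * X i j) / a ℓ ℓ := by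
  simp only [normalize, sub_mul, add_mul, Finset.sum_sub_distrib, Finset.sum_add_distrib]
  have h1 : ∑ i, ∑ j, (if j = ℓ then if i = ℓ then 0 else a i ℓ / a ℓ ℓ else 0) * X i j =
      ∑ i, ∑ j, (if i = ℓ then if j = ℓ then 0 else a j ℓ / a ℓ ℓ else 0) * X i j := by
    rw [Finset.sum_comm]
    simp only [hX]
  rw [h1, add_sub_cancel_right, Finset.sum_div]
  refine Finset.sum_congr rfl fun i _ => ?_
  rw [Finset.sum_div]
  exact Finset.sum_congr rfl fun j _ => by ring

lemma normalize_row {δ Λ : ℝ} (hδ : 0 < δ) {a : Matrix (Fin n) (Fin n) ℝ}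
    (h : IsElliptic n δ Λ a) (ℓ j : Fin n) : normalize ℓ a ℓ j = if j = ℓ then 1 else 0 := by
  have h0 : a ℓ ℓ ≠ 0 := (hδ.trans_le (Elliptic.le_diag h ℓ)).ne'
  by_cases hj : j = ℓ
  · subst hj
    simp [normalize, h0]
  · simp [normalize, hj, Elliptic.apply_comm h ℓ j]

lemma abs_normalize_le {δ Λ : ℝ} (hδ : 0 < δ) {a : Matrix (Fin n) (Fin n) ℝ}
    (h : IsElliptic n δ Λ a) (ℓ i j : Fin n) : |normalize ℓ a i j| ≤ 3 * (Λ / δ) := by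
  have h1 : ∀ i j, |a i j / a ℓ ℓ| ≤ Λ / δ := fun i j => by
    have h2 := Elliptic.le_diag h ℓ
    rw [abs_div, abs_of_pos (hδ.trans_le h2)]
    exact div_le_div₀ ((abs_nonneg _).trans (h.2.2 i j)) (h.2.2 i j) hδ h2
  have h3 : 0 ≤ Λ / δ := (abs_nonneg _).trans (h1 i j)
  have h2 := h1 i j
  have h4 := h1 i ℓ
  have h5 := h1 j ℓ
  rw [abs_le] at *
  unfold normalize
  split_ifs <;> constructor <;> linarith

lemma measurable_normalize {abar : ℝ → Matrix (Fin n) (Fin n) ℝ}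
    (ha : ∀ i j, Measurable fun s => abar s i j) (ℓ i j : Fin n) :
    Measurable fun s => normalize ℓ (abar s) i j := by
  have h : ∀ i j, Measurable fun s => abar s i j / abar s ℓ ℓ := fun i j => (ha i j).div (ha ℓ ℓ)
  unfold normalize
  refine ((h i j).add ?_).sub ?_ <;> split_ifs <;> first | exact measurable_const | exact h _ _

lemma coercive_normalize {δ Λ : ℝ} (hδ : 0 < δ) {a : Matrix (Fin n) (Fin n) ℝ}
    (h : IsElliptic n δ Λ a) (ℓ : Fin n) (ξ : Fin n → ℝ) :
    δ / Λ * ∑ i, ξ i ^ 2 ≤ ∑ i, ∑ j, normalize ℓ a i j * ξ j * ξ i := by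
  have h1 := Elliptic.le_diag h ℓ
  have h2 := Elliptic.diag_le h ℓ
  have h0 := hδ.trans_le h1
  simp_rw [mul_assoc]
  rw [sum_normalize_mul ℓ a (X := fun i j => ξ j * ξ i) fun i j => mul_comm _ _,
    le_div_iff₀ h0]
  calc (δ / Λ * ∑ i, ξ i ^ 2) * a ℓ ℓ ≤ (δ / Λ * ∑ i, ξ i ^ 2) * Λ := by
        have := h0.le.trans h2
        gcongr
    _ = δ * ∑ i, ξ i ^ 2 := by
        field_simp [(h0.trans_le h2).ne']
    _ ≤ ∑ i, ∑ j, a i j * ξ i * ξ j := h.2.1 ξ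
    _ = _ := Finset.sum_congr rfl fun i _ => Finset.sum_congr rfl fun j _ => by ring

lemma sum_abs_le_of_forall_ne {δ Λ : ℝ} (hδ : 0 < δ) (hΛ : 0 < Λ) {a : Matrix (Fin n) (Fin n) ℝ}
    (h : IsElliptic n δ Λ a) (ℓ : Fin n) {D : Fin n → Fin n → ℝ} {s : ℝ} (hs : 0 ≤ s)
    (hD : ∀ i j, (i ≠ ℓ ∨ j ≠ ℓ) → |D i j| ≤ s) :
    ∑ i, ∑ j, |D i j| ≤ |∑ i, ∑ j, a i j * D i j| / δ + (1 + Λ / δ) * (n ^ 2 * s) := by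
  set Y : Fin n → Fin n → ℝ := fun i j => if i = ℓ ∧ j = ℓ then 0 else D i j with hY
  have hdec : ∀ i j, D i j = Y i j + if i = ℓ then if j = ℓ then D ℓ ℓ else 0 else 0 := by
    intro i j
    by_cases hi : i = ℓ <;> by_cases hj : j = ℓ <;> simp [hY, hi, hj]
  have hYs : ∀ i j, |Y i j| ≤ s := fun i j => by
    by_cases hij : i = ℓ ∧ j = ℓ
    · simp [hY, hij, hs]
    · simp only [hY, if_neg hij]
      exact hD i j (by tauto)
  have h1 : ∑ i, ∑ j, |Y i j| ≤ n ^ 2 * s := by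
    refine (Finset.sum_le_sum fun i _ => Finset.sum_le_sum fun j _ => hYs i j).trans_eq ?_
    simp [sq, mul_assoc]
  have h2 : ∑ i, ∑ j, a i j * D i j = ∑ i, ∑ j, a i j * Y i j + a ℓ ℓ * D ℓ ℓ := by
    have h3 : ∀ i j, a i j * D i j =
        a i j * Y i j + if i = ℓ then if j = ℓ then a ℓ ℓ * D ℓ ℓ else 0 else 0 := fun i j => by
      refine (congrArg (a i j * ·) (hdec i j)).trans ?_
      rw [mul_add]
      split_ifs with hi hj
      · rw [hi, hj]
      · rw [mul_zero]
      · rw [mul_zero]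
    rw [Finset.sum_congr rfl fun i _ => Finset.sum_congr rfl fun j _ => h3 i j]
    simp only [Finset.sum_add_distrib, Finset.sum_ite_eq', Finset.mem_univ, if_true,
      Finset.sum_ite_irrel, Finset.sum_const_zero]
  have h3 : |∑ i, ∑ j, a i j * Y i j| ≤ Λ * ∑ i, ∑ j, |Y i j| := by
    simp_rw [Finset.mul_sum]
    refine (Finset.abs_sum_le_sum_abs _ _).trans (Finset.sum_le_sum fun i _ =>
      (Finset.abs_sum_le_sum_abs _ _).trans (Finset.sum_le_sum fun j _ => ?_))
    rw [abs_mul]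
    exact mul_le_mul_of_nonneg_right (h.2.2 i j) (abs_nonneg _)
  have h4 : ∑ i, ∑ j, |D i j| ≤ ∑ i, ∑ j, |Y i j| + |D ℓ ℓ| := by
    calc ∑ i, ∑ j, |D i j| ≤ ∑ i, ∑ j, (|Y i j| + if i = ℓ then if j = ℓ then |D ℓ ℓ| else 0 else 0) := by
          refine Finset.sum_le_sum fun i _ => Finset.sum_le_sum fun j _ => ?_
          refine (congrArg abs (hdec i j)).le.trans ((abs_add_le _ _).trans_eq ?_)
          congr 1
          split_ifs <;> simp
      _ = _ := by simp [Finset.sum_add_distrib]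
  have h5 : δ * |D ℓ ℓ| ≤ |∑ i, ∑ j, a i j * D i j| + Λ * ∑ i, ∑ j, |Y i j| := by
    have h6 := Elliptic.le_diag h ℓ
    calc δ * |D ℓ ℓ| ≤ a ℓ ℓ * |D ℓ ℓ| := by gcongr
      _ = |a ℓ ℓ * D ℓ ℓ| := by rw [abs_mul, abs_of_pos (hδ.trans_le h6)]
      _ ≤ |∑ i, ∑ j, a i j * D i j| + |∑ i, ∑ j, a i j * Y i j| := by
          rw [← sub_eq_iff_eq_add'.2 h2]
          exact abs_sub _ _
      _ ≤ _ := by gcongr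
  have h6 : |D ℓ ℓ| ≤ |∑ i, ∑ j, a i j * D i j| / δ + Λ / δ * ∑ i, ∑ j, |Y i j| := by
    rw [div_mul_eq_mul_div, ← add_div, le_div_iff₀ hδ]
    linarith
  have h7 : (1 + Λ / δ) * ∑ i, ∑ j, |Y i j| ≤ (1 + Λ / δ) * (n ^ 2 * s) := by gcongr
  linarith

/-- Constant in the weak type estimate for the whole Hessian. -/
noncomputable def hessConst (n : ℕ) (δ Λ : ℝ) : ℝ :=
  2 / δ + ∑ _i : Fin n, ∑ _j : Fin n,
    2 * (1 + Λ / δ) * n ^ 2 * (Lattice.weakConst (δ / Λ) (3 * (Λ / δ)) n / δ)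

lemma weak_type_hessian {abar : ℝ → Matrix (Fin n) (Fin n) ℝ} {δ Λ : ℝ} (hδ : 0 < δ) (hΛ : 0 < Λ)
    (ham : ∀ i j, Measurable fun s => abar s i j) (ha : ∀ s, IsElliptic n δ Λ (abar s))
    (ℓ : Fin n)
    {w : EuclideanSpace ℝ (Fin n) → ℝ} (hw : ContDiff ℝ 2 w) (hwc : HasCompactSupport w)
    {t : ℝ} (ht : 0 < t) :
    ENNReal.ofReal t * volume {z | t < √(∑ i, ∑ j, D2 w z i j ^ 2)} ≤
      ENNReal.ofReal (hessConst n δ Λ) *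
        ∫⁻ z, ENNReal.ofReal |∑ i, ∑ j, abar (z ℓ) i j * D2 w z i j| := by
  set g : EuclideanSpace ℝ (Fin n) → ℝ := fun z => ∑ i, ∑ j, abar (z ℓ) i j * D2 w z i j with hg
  have hgm : Measurable g := Finset.measurable_fun_sum _ fun i _ => Finset.measurable_fun_sum _
    fun j _ => ((ham i j).comp (by fun_prop)).mul (continuous_D2 hw i j).measurable
  set I := ∫⁻ z, ENNReal.ofReal |g z| with hI
  set C := Lattice.weakConst (δ / Λ) (3 * (Λ / δ)) n with hC
  have hlam : 0 < δ / Λ := by positivity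
  have hC0 : 0 ≤ C := by
    rw [hC]
    unfold Lattice.weakConst Lattice.shellConst Lattice.dilation
    positivity
  have hn : (1 : ℝ) ≤ n := by
    exact_mod_cast Fin.pos ℓ
  have hsym : ∀ z i j, D2 w z i j = D2 w z j i := fun z i j => D2_comm hw.contDiffAt i j
  have hgI : ∫⁻ z, ENNReal.ofReal |∑ i, ∑ j, normalize ℓ (abar (z ℓ)) i j * D2 w z i j| ≤
      ENNReal.ofReal δ⁻¹ * I := by
    have hgm' : Measurable fun z => ENNReal.ofReal |g z| := hgm.norm.ennreal_ofReal
    rw [← lintegral_const_mul _ hgm']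
    refine lintegral_mono fun z => ?_
    have h1 := Elliptic.le_diag (ha (z ℓ)) ℓ
    rw [sum_normalize_mul ℓ _ (hsym z), ← ENNReal.ofReal_mul (by positivity), abs_div,
      abs_of_pos (hδ.trans_le h1), div_eq_inv_mul]
    refine ENNReal.ofReal_le_ofReal ?_
    gcongr
  have hne : ∀ i k, k ≠ ℓ → ∀ s, 0 < s → ENNReal.ofReal s * volume {z | s < |D2 w z i k|} ≤
      ENNReal.ofReal (C / δ) * I := fun i k hk s hs => by
    refine (weak_type_D2_of_ne (fun i j => measurable_normalize ham ℓ i j) hlam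
      (fun s => coercive_normalize hδ (ha s) ℓ) (fun s => abs_normalize_le hδ (ha s) ℓ)
      (fun s s' j => by rw [normalize_row hδ (ha s), normalize_row hδ (ha s')]) hw hwc i hk hs).trans
      ?_
    refine (mul_le_mul_right hgI _).trans_eq ?_
    rw [← mul_assoc, ← ENNReal.ofReal_mul hC0, div_eq_mul_inv]
  have hne' : ∀ i k, (i ≠ ℓ ∨ k ≠ ℓ) → ∀ s, 0 < s →
      ENNReal.ofReal s * volume {z | s < |D2 w z i k|} ≤ ENNReal.ofReal (C / δ) * I :=
    fun i k h s hs => by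
    rcases h with h | h
    · simp_rw [hsym _ i k]
      exact hne k i h s hs
    · exact hne i k h s hs
  set m := 2 * (1 + Λ / δ) * n ^ 2 with hm
  have hm0 : 0 < m := by positivity
  set S : Fin n → Fin n → Set (EuclideanSpace ℝ (Fin n)) := fun i k =>
    {z | (i ≠ ℓ ∨ k ≠ ℓ) ∧ t / m < |D2 w z i k|} with hS
  have hSm : ∀ i k, ENNReal.ofReal t * volume (S i k) ≤ ENNReal.ofReal (m * (C / δ)) * I :=
    fun i k => by
    by_cases h : i ≠ ℓ ∨ k ≠ ℓ
    · have h1 := mul_le_mul_right (hne' i k h (t / m) (by positivity)) (ENNReal.ofReal m)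
      rw [← mul_assoc, ← mul_assoc, ← ENNReal.ofReal_mul hm0.le, ← ENNReal.ofReal_mul hm0.le,
        mul_div_cancel₀ _ hm0.ne'] at h1
      exact (mul_le_mul_right (measure_mono fun z hz => hz.2) _).trans h1
    · rw [show S i k = ∅ from eq_empty_of_forall_notMem fun z hz => h hz.1, measure_empty, mul_zero]
      exact zero_le
  have hsub : {z | t < √(∑ i, ∑ j, D2 w z i j ^ 2)} ⊆ {z | t ≤ 2 / δ * |g z|} ∪
      ⋃ i, ⋃ k, S i k := fun z hz => by
    by_contra hcon
    simp only [hS, mem_union, mem_iUnion, mem_ofPred_eq, not_or, not_exists, not_le, not_and,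
      not_lt] at hcon hz
    obtain ⟨hc1, hc2⟩ := hcon
    have hsqrt : √(∑ i, ∑ j, D2 w z i j ^ 2) ≤ ∑ i, ∑ j, |D2 w z i j| := by
      refine Real.sqrt_le_iff.2 ⟨by positivity, ?_⟩
      simp only [← Fintype.sum_prod_type']
      simp only [← sq_abs (D2 _ _ _ _)]
      exact Finset.sum_sq_le_sq_sum_of_nonneg fun _ _ => abs_nonneg _
    have h1 := sum_abs_le_of_forall_ne hδ hΛ (ha (z ℓ)) ℓ (D := fun i j => D2 w z i j)
      (s := t / m) (by positivity) hc2
    have h2 : (1 + Λ / δ) * (n ^ 2 * (t / m)) = t / 2 := by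
      rw [hm]
      field_simp
    have h3 : |∑ i, ∑ j, abar (z ℓ) i j * D2 w z i j| / δ < t / 2 := by
      have h4 : 2 / δ * |g z| = 2 * (|g z| / δ) := by ring
      rw [h4] at hc1
      change |g z| / δ < t / 2
      linarith
    linarith
  have hA : ENNReal.ofReal t * volume {z | t ≤ 2 / δ * |g z|} ≤ ENNReal.ofReal (2 / δ) * I := by
    have hgm' : Measurable fun z => ENNReal.ofReal |g z| := hgm.norm.ennreal_ofReal
    rw [hI, ← lintegral_const_mul _ hgm']
    refine le_trans (le_of_eq ?_) (mul_meas_ge_le_lintegral (hgm'.const_mul _) (ENNReal.ofReal t))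
    congr 2
    ext z
    rw [mem_ofPred_eq, mem_ofPred_eq, ← ENNReal.ofReal_mul (by positivity),
      ENNReal.ofReal_le_ofReal_iff (by positivity)]
  refine (mul_le_mul_right ((measure_mono hsub).trans ((measure_union_le _ _).trans
    (add_le_add_right ((measure_iUnion_fintype_le _ _).trans (Finset.sum_le_sum fun i _ =>
      measure_iUnion_fintype_le _ _)) _))) _).trans ?_
  rw [hessConst, mul_add, ENNReal.ofReal_add (by positivity) (by positivity), add_mul,
    Finset.mul_sum, ENNReal.ofReal_sum_of_nonneg fun _ _ => by positivity, Finset.sum_mul]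
  refine add_le_add hA (Finset.sum_le_sum fun i _ => ?_)
  rw [Finset.mul_sum, ENNReal.ofReal_sum_of_nonneg fun _ _ => by positivity, Finset.sum_mul]
  exact Finset.sum_le_sum fun k _ => hSm i k

lemma pd_mul {u w : EuclideanSpace ℝ (Fin n) → ℝ} {x : EuclideanSpace ℝ (Fin n)}
    (hu : DifferentiableAt ℝ u x) (hw : DifferentiableAt ℝ w x) (i : Fin n) :
    pd i (fun y => u y * w y) x = u x * pd i w x + w x * pd i u x := by
  rw [pd, fderiv_fun_mul hu hw]
  rfl

lemma pd_comp {φ : ℝ → ℝ} {φ' : ℝ} {u : EuclideanSpace ℝ (Fin n) → ℝ}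
    {x : EuclideanSpace ℝ (Fin n)} (hφ : HasDerivAt φ φ' (u x)) (hu : DifferentiableAt ℝ u x)
    (i : Fin n) : pd i (fun y => φ (u y)) x = φ' * pd i u x := by
  have h := (hφ.comp_hasFDerivAt x hu.hasFDerivAt).fderiv
  rw [pd, show (fun y => φ (u y)) = φ ∘ u from rfl, h]
  rfl

lemma hasCompactSupport_pd {u : EuclideanSpace ℝ (Fin n) → ℝ} (hu : HasCompactSupport u)
    (i : Fin n) : HasCompactSupport (pd i u) :=
  hu.mono' (subset_closure.trans (tsupport_pd_subset i u))

/-- Measurable bounded uniformly coercive coefficients `b(s)`, with constant `ℓ`-th row. -/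
structure IsNormalized (b : ℝ → Matrix (Fin n) (Fin n) ℝ) (ℓ : Fin n) (lam K : ℝ) : Prop where
  measurable : ∀ i j, Measurable fun s => b s i j
  abs_le : ∀ s i j, |b s i j| ≤ K
  row : ∀ s j, b s ℓ j = if j = ℓ then 1 else 0
  coercive : ∀ s (ξ : Fin n → ℝ), lam * ∑ i, ξ i ^ 2 ≤ ∑ i, ∑ j, b s i j * ξ j * ξ i

/-- The operator `a^{ij}(x^ℓ) D_{ij}`. -/
noncomputable def ellOp (a : ℝ → Matrix (Fin n) (Fin n) ℝ) (ℓ : Fin n)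
    (u : EuclideanSpace ℝ (Fin n) → ℝ) (x : EuclideanSpace ℝ (Fin n)) : ℝ :=
  ∑ i, ∑ j, a (x ℓ) i j * D2 u x i j

/-- The squared length of the gradient. -/
noncomputable def gradSq (u : EuclideanSpace ℝ (Fin n) → ℝ) (x : EuclideanSpace ℝ (Fin n)) : ℝ :=
  ∑ i, pd i u x ^ 2

lemma gradSq_nonneg (u : EuclideanSpace ℝ (Fin n) → ℝ) (x : EuclideanSpace ℝ (Fin n)) :
    0 ≤ gradSq u x := Finset.sum_nonneg fun _ _ => sq_nonneg _

lemma continuous_gradSq {u : EuclideanSpace ℝ (Fin n) → ℝ} (hu : ContDiff ℝ 1 u) :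
    Continuous (gradSq u) :=
  continuous_finsetSum _ fun i _ =>
    (contDiff_pd (m := 0) i hu (by norm_num)).continuous.pow 2

lemma measurable_coeff {c : ℝ → ℝ} (hc : Measurable c) (ℓ : Fin n) :
    Measurable fun x : EuclideanSpace ℝ (Fin n) => c (x ℓ) :=
  hc.comp (by fun_prop : Continuous fun x : EuclideanSpace ℝ (Fin n) => x ℓ).measurable

lemma integrable_coeff_mul {c : ℝ → ℝ} {K : ℝ} (hc : Measurable c) (hK : ∀ s, |c s| ≤ K)
    (ℓ : Fin n) {g : EuclideanSpace ℝ (Fin n) → ℝ} (hg : Integrable g) :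
    Integrable fun x : EuclideanSpace ℝ (Fin n) => c (x ℓ) * g x :=
  hg.bdd_mul (measurable_coeff hc ℓ).aestronglyMeasurable
    (Eventually.of_forall fun x => hK (x ℓ))

lemma integral_coeff_mul_pd {c : ℝ → ℝ} {K : ℝ} (hc : Measurable c) (hK : ∀ s, |c s| ≤ K)
    {i ℓ : Fin n} (hi : i ≠ ℓ ∨ ∃ k, ∀ s, c s = k) {G : EuclideanSpace ℝ (Fin n) → ℝ}
    (hG : ContDiff ℝ 1 G) (hGc : HasCompactSupport G) :
    ∫ x, c (x ℓ) * pd i G x = 0 := by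
  have hGi : Integrable G := hG.continuous.integrable_of_hasCompactSupport hGc
  have hpi : Integrable (pd i G) := (contDiff_pd (m := 0) i hG
    (by norm_num)).continuous.integrable_of_hasCompactSupport (hasCompactSupport_pd hGc i)
  have h := integral_bilinear_hasLineDerivAt_right_eq_neg_left_of_integrable
    (μ := (volume : Measure (EuclideanSpace ℝ (Fin n))))
    (f := fun x : EuclideanSpace ℝ (Fin n) => c (x ℓ)) (f' := fun _ => 0)
    (g := G) (g' := pd i G) (v := EuclideanSpace.single i 1)
    (B := ContinuousLinearMap.mul ℝ ℝ) (by simp)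
    (by simpa using integrable_coeff_mul hc hK ℓ hpi)
    (by simpa using integrable_coeff_mul hc hK ℓ hGi)
    (fun x _ => by
      unfold HasLineDerivAt
      have : (fun t : ℝ => c ((x + t • (EuclideanSpace.single i 1 :
          EuclideanSpace ℝ (Fin n))) ℓ)) = fun _ => c (x ℓ) := by
        ext t
        rcases hi with hi | ⟨k, hk⟩
        · simp [hi.symm]
        · simp [hk]
      rw [this]
      exact hasDerivAt_const _ _)
    (fun x _ => (hG.differentiable (by norm_num) x).hasFDerivAt.hasLineDerivAt _)
  simpa using h

namespace IsNormalized

variable {b : ℝ → Matrix (Fin n) (Fin n) ℝ} {ℓ : Fin n} {lam K : ℝ}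

lemma integrable_ellOp_mul (hb : IsNormalized b ℓ lam K) {u φ : EuclideanSpace ℝ (Fin n) → ℝ}
    (hu : ContDiff ℝ 2 u) (hφ : Continuous φ) (hφc : HasCompactSupport φ) :
    Integrable fun x => φ x * ellOp b ℓ u x := by
  unfold ellOp
  simp only [Finset.mul_sum]
  refine integrable_finsetSum _ fun i _ => integrable_finsetSum _ fun j _ => ?_
  have h := integrable_coeff_mul (hb.measurable i j) (fun s => hb.abs_le s i j) ℓ
    ((hφ.mul (continuous_D2 hu i j)).integrable_of_hasCompactSupport hφc.mul_right)
  exact h.congr (Eventually.of_forall fun x => by simp only [Pi.mul_apply]; ring)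

/-- Testing the equation: the operator with normalized coefficients is in divergence form. -/
lemma integral_mul_ellOp (hb : IsNormalized b ℓ lam K) {u φ : EuclideanSpace ℝ (Fin n) → ℝ}
    (hu : ContDiff ℝ 2 u) (hφ : ContDiff ℝ 1 φ) (hφc : HasCompactSupport φ) :
    ∫ x, φ x * ellOp b ℓ u x = -∫ x, ∑ i, ∑ j, b (x ℓ) i j * (pd i φ x * pd j u x) := by
  have hInt : ∀ i j, Integrable fun x => b (x ℓ) i j * (φ x * D2 u x i j) := fun i j =>
    integrable_coeff_mul (hb.measurable i j) (fun s => hb.abs_le s i j) ℓ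
      ((hφ.continuous.mul (continuous_D2 hu i j)).integrable_of_hasCompactSupport hφc.mul_right)
  have hpc : ∀ j, ContDiff ℝ 1 (pd j u) := fun j => contDiff_pd j hu (by norm_num)
  have hInt' : ∀ i j, Integrable fun x => b (x ℓ) i j * (pd i φ x * pd j u x) := fun i j =>
    integrable_coeff_mul (hb.measurable i j) (fun s => hb.abs_le s i j) ℓ
      (((contDiff_pd (m := 0) i hφ (by norm_num)).continuous.mul
        (hpc j).continuous).integrable_of_hasCompactSupport (hasCompactSupport_pd hφc i).mul_right)
  have h0 : ∀ i j, ∫ x, b (x ℓ) i j * (φ x * D2 u x i j) =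
      -∫ x, b (x ℓ) i j * (pd i φ x * pd j u x) := fun i j => by
    have h := integral_coeff_mul_pd (i := i) (hb.measurable i j) (fun s => hb.abs_le s i j)
      (ℓ := ℓ) (by
        by_cases hi : i = ℓ
        · subst hi
          exact Or.inr ⟨_, fun s => hb.row s j⟩
        · exact Or.inl hi) (hφ.mul (hpc j)) (G := fun x => φ x * pd j u x) hφc.mul_right
    have h1 : ∀ x, b (x ℓ) i j * pd i (fun x => φ x * pd j u x) x =
        b (x ℓ) i j * (φ x * D2 u x i j) + b (x ℓ) i j * (pd i φ x * pd j u x) := fun x => by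
      rw [pd_mul (hφ.differentiable (by norm_num) x) ((hpc j).differentiable (by norm_num) x),
        ← D2_eq_pd]
      ring
    simp only [h1] at h
    rw [integral_add (hInt i j) (hInt' i j)] at h
    linarith
  have h2 : ∀ x, φ x * ellOp b ℓ u x = ∑ i, ∑ j, b (x ℓ) i j * (φ x * D2 u x i j) := fun x => by
    simp only [ellOp, Finset.mul_sum]
    exact Finset.sum_congr rfl fun i _ => Finset.sum_congr rfl fun j _ => by ring
  simp only [h2]
  rw [integral_finsetSum _ fun i _ => integrable_finsetSum _ fun j _ => hInt i j,
    integral_finsetSum _ fun i _ => integrable_finsetSum _ fun j _ => hInt' i j,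
    ← Finset.sum_neg_distrib]
  refine Finset.sum_congr rfl fun i _ => ?_
  rw [integral_finsetSum _ fun j _ => hInt i j, integral_finsetSum _ fun j _ => hInt' i j,
    ← Finset.sum_neg_distrib]
  exact Finset.sum_congr rfl fun j _ => h0 i j

/-- Caccioppoli's inequality for nonnegative subsolutions. -/
lemma integral_sq_mul_gradSq_le (hb : IsNormalized b ℓ lam K) (hlam : 0 < lam) (hK : 0 < K)
    {u ζ : EuclideanSpace ℝ (Fin n) → ℝ} (hu : ContDiff ℝ 2 u) (hζ : ContDiff ℝ 1 ζ)
    (hζc : HasCompactSupport ζ) (hsub : ∀ᵐ x, 0 ≤ ζ x ^ 2 * (u x * ellOp b ℓ u x)) :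
    ∫ x, ζ x ^ 2 * gradSq u x ≤ (2 * n * K / lam) ^ 2 * ∫ x, u x ^ 2 * gradSq ζ x := by
  have hu1 : ContDiff ℝ 1 u := hu.of_le (by norm_num)
  have hcp : ∀ {w : EuclideanSpace ℝ (Fin n) → ℝ} (_ : ContDiff ℝ 1 w) i, Continuous (pd i w) :=
    fun hw i => (contDiff_pd (m := 0) i hw (by norm_num)).continuous
  have hζ2c : HasCompactSupport fun x => ζ x ^ 2 := by
    have h : HasCompactSupport fun x => ζ x * ζ x := hζc.mul_right
    simpa only [sq] using h
  have hgc : HasCompactSupport (gradSq ζ) := by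
    refine HasCompactSupport.intro hζc.isCompact fun x hx => ?_
    refine Finset.sum_eq_zero fun i _ => ?_
    rw [image_eq_zero_of_notMem_tsupport (fun h => hx (tsupport_pd_subset i ζ h)), zero_pow two_ne_zero]
  have hA : Integrable fun x => ζ x ^ 2 * gradSq u x :=
    ((hζ.continuous.pow 2).mul (continuous_gradSq hu1)).integrable_of_hasCompactSupport
      hζ2c.mul_right
  have hB : Integrable fun x => u x ^ 2 * gradSq ζ x :=
    ((hu.continuous.pow 2).mul (continuous_gradSq hζ)).integrable_of_hasCompactSupport
      hgc.mul_left
  have h := hb.integral_mul_ellOp hu (φ := fun x => ζ x ^ 2 * u x) ((hζ.pow 2).mul hu1)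
    hζ2c.mul_right
  have hpos : 0 ≤ ∫ x, ζ x ^ 2 * u x * ellOp b ℓ u x := by
    refine integral_nonneg_of_ae ?_
    filter_upwards [hsub] with x hx
    simpa only [Pi.zero_apply, mul_assoc] using hx
  have hpt : ∀ x, lam / 2 * (ζ x ^ 2 * gradSq u x) - 2 * (n * K) ^ 2 / lam * (u x ^ 2 * gradSq ζ x)
      ≤ ∑ i, ∑ j, b (x ℓ) i j * (pd i (fun y => ζ y ^ 2 * u y) x * pd j u x) := fun x => by
    have hd1 := hζ.differentiable (by norm_num) x
    have hd2 := hu1.differentiable (by norm_num) x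
    have hpd : ∀ i, pd i (fun y => ζ y ^ 2 * u y) x =
        ζ x ^ 2 * pd i u x + 2 * ζ x * u x * pd i ζ x := fun i => by
      rw [pd_mul (u := fun y => ζ y ^ 2) (hd1.pow 2) hd2]
      have : pd i (fun y => ζ y ^ 2) x = 2 * ζ x * pd i ζ x := by
        simp only [sq]
        rw [pd_mul hd1 hd1]
        ring
      rw [this]
      ring
    have hco := mul_le_mul_of_nonneg_left (hb.coercive (x ℓ) fun i => pd i u x) (sq_nonneg (ζ x))
    have hsplit : ∑ i, ∑ j, b (x ℓ) i j * (pd i (fun y => ζ y ^ 2 * u y) x * pd j u x) =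
        ζ x ^ 2 * (∑ i, ∑ j, b (x ℓ) i j * pd j u x * pd i u x) +
        ∑ i, ∑ j, b (x ℓ) i j * (2 * ζ x * u x * pd i ζ x * pd j u x) := by
      rw [Finset.mul_sum, ← Finset.sum_add_distrib]
      refine Finset.sum_congr rfl fun i _ => ?_
      rw [Finset.mul_sum, ← Finset.sum_add_distrib]
      exact Finset.sum_congr rfl fun j _ => by rw [hpd]; ring
    have hterm : ∀ i j, -(lam / (2 * n) * (ζ x ^ 2 * pd j u x ^ 2) +
        2 * n * K ^ 2 / lam * (u x ^ 2 * pd i ζ x ^ 2)) ≤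
        b (x ℓ) i j * (2 * ζ x * u x * pd i ζ x * pd j u x) := fun i j => by
      have hn : (0 : ℝ) < n := by exact_mod_cast i.pos
      have hy : ∀ p q : ℝ, K * |2 * p * q| ≤ lam / (2 * n) * p ^ 2 + 2 * n * K ^ 2 / lam * q ^ 2 :=
        fun p q => by
          have h1 : 0 ≤ (lam * |p| - 2 * n * K * |q|) ^ 2 := sq_nonneg _
          have e : lam / (2 * n) * p ^ 2 + 2 * n * K ^ 2 / lam * q ^ 2 - K * |2 * p * q| =
              (lam * |p| - 2 * n * K * |q|) ^ 2 / (2 * n * lam) := by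
            rw [abs_mul, abs_mul, abs_two, ← sq_abs p, ← sq_abs q]
            field_simp
            ring
          have : 0 ≤ (lam * |p| - 2 * n * K * |q|) ^ 2 / (2 * n * lam) := by positivity
          linarith
      have h1 := hy (ζ x * pd j u x) (u x * pd i ζ x)
      have h2 : |b (x ℓ) i j * (2 * ζ x * u x * pd i ζ x * pd j u x)| ≤
          K * |2 * (ζ x * pd j u x) * (u x * pd i ζ x)| := by
        rw [abs_mul]
        refine (mul_le_mul_of_nonneg_right (hb.abs_le _ i j) (abs_nonneg _)).trans (le_of_eq ?_)
        congr 2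
        ring
      have h3 := (_root_.abs_le.1 h2).1
      rw [mul_pow, mul_pow] at h1
      linarith
    have hsum := Finset.sum_le_sum fun i (_ : i ∈ Finset.univ) => Finset.sum_le_sum
      fun j (_ : j ∈ Finset.univ) => hterm i j
    have hs : ∑ i : Fin n, ∑ j : Fin n, -(lam / (2 * n) * (ζ x ^ 2 * pd j u x ^ 2) +
        2 * n * K ^ 2 / lam * (u x ^ 2 * pd i ζ x ^ 2)) =
        -(lam / 2 * (ζ x ^ 2 * gradSq u x)) - 2 * (n * K) ^ 2 / lam * (u x ^ 2 * gradSq ζ x) := by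
      rcases Nat.eq_zero_or_pos n with hn | hn
      · subst hn
        simp [gradSq]
      have hn : (0 : ℝ) < n := by exact_mod_cast hn
      simp only [Finset.sum_neg_distrib, Finset.sum_add_distrib, ← Finset.mul_sum,
        Finset.sum_const, Finset.card_univ, Fintype.card_fin, nsmul_eq_mul, gradSq]
      field_simp
      ring
    rw [hs] at hsum
    rw [hsplit]
    have hg : ζ x ^ 2 * (lam * ∑ i, pd i u x ^ 2) = lam * (ζ x ^ 2 * gradSq u x) := by
      rw [gradSq]; ring
    rw [hg] at hco
    linarith
  have hInt : Integrable fun x => ∑ i, ∑ j, b (x ℓ) i j *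
      (pd i (fun y => ζ y ^ 2 * u y) x * pd j u x) :=
    integrable_finsetSum _ fun i _ => integrable_finsetSum _ fun j _ =>
      integrable_coeff_mul (hb.measurable i j) (fun s => hb.abs_le s i j) ℓ
      (((hcp ((hζ.pow 2).mul hu1) i).mul (hcp hu1 j)).integrable_of_hasCompactSupport
        (hasCompactSupport_pd hζ2c.mul_right i).mul_right)
  have hmono := integral_mono ((hA.const_mul (lam / 2)).sub
    (hB.const_mul (2 * (n * K) ^ 2 / lam))) hInt hpt
  rw [integral_sub' (hA.const_mul _) (hB.const_mul _), integral_const_mul, integral_const_mul]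
    at hmono
  have h5 : lam / 2 * ∫ x, ζ x ^ 2 * gradSq u x ≤
      2 * (n * K) ^ 2 / lam * ∫ x, u x ^ 2 * gradSq ζ x := by linarith
  have h6 := mul_le_mul_of_nonneg_left h5 (by positivity : 0 ≤ 2 / lam)
  have e1 : 2 / lam * (lam / 2 * ∫ x, ζ x ^ 2 * gradSq u x) = ∫ x, ζ x ^ 2 * gradSq u x := by
    field_simp
  have e2 : 2 / lam * (2 * (n * K) ^ 2 / lam * ∫ x, u x ^ 2 * gradSq ζ x) =
      (2 * n * K / lam) ^ 2 * ∫ x, u x ^ 2 * gradSq ζ x := by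
    field_simp
  linarith

lemma ellOp_eq_zero_of_notMem {a : ℝ → Matrix (Fin n) (Fin n) ℝ} {u : EuclideanSpace ℝ (Fin n) → ℝ}
    {x : EuclideanSpace ℝ (Fin n)} (hx : x ∉ tsupport u) : ellOp a ℓ u x = 0 :=
  Finset.sum_eq_zero fun i _ => Finset.sum_eq_zero fun j _ => by
    rw [D2_eq_zero_of_notMem hx, mul_zero]

/-- An `L¹` bound for nonnegative almost subsolutions with compact support. -/
lemma integral_le_of_neg_le_ellOp (hb : IsNormalized b ℓ lam K)
    {u g : EuclideanSpace ℝ (Fin n) → ℝ} (hu : ContDiff ℝ 2 u)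
    (hsupp : tsupport u ⊆ closedBall 0 1) (hg : ∀ x, 0 ≤ g x) (hgi : Integrable g)
    (hsub : ∀ᵐ x, -g x ≤ ellOp b ℓ u x) : ∫ x, u x ≤ ∫ x, g x := by
  have huc : HasCompactSupport u :=
    (isCompact_closedBall _ _).of_isClosed_subset (isClosed_tsupport u) hsupp
  have hu1 : ContDiff ℝ 1 u := hu.of_le (by norm_num)
  let χ : ContDiffBump (0 : EuclideanSpace ℝ (Fin n)) := ⟨2, 3, by norm_num, by norm_num⟩
  let ψ : EuclideanSpace ℝ (Fin n) → ℝ := fun x => 1 - x ℓ ^ 2 / 2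
  have hcoord : ContDiff ℝ 1 fun x : EuclideanSpace ℝ (Fin n) => x ℓ := by fun_prop
  have hψ : ContDiff ℝ 1 ψ := contDiff_const.sub ((hcoord.pow 2).div_const 2)
  have hφc : HasCompactSupport fun x => χ x * ψ x := χ.hasCompactSupport.mul_right
  have hφ : ContDiff ℝ 1 fun x => χ x * ψ x := χ.contDiff.mul hψ
  have hpdx : ∀ (x : EuclideanSpace ℝ (Fin n)) i,
      pd i (fun y : EuclideanSpace ℝ (Fin n) => y ℓ) x = if i = ℓ then 1 else 0 := fun x i => by
    have : HasFDerivAt (fun y : EuclideanSpace ℝ (Fin n) => y ℓ)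
        (EuclideanSpace.proj ℓ : EuclideanSpace ℝ (Fin n) →L[ℝ] ℝ) x :=
      (EuclideanSpace.proj ℓ : EuclideanSpace ℝ (Fin n) →L[ℝ] ℝ).hasFDerivAt
    rw [pd, this.fderiv]
    by_cases h : i = ℓ
    · simp [h]
    · simp [h, Ne.symm h]
  have hpdφ : ∀ x ∈ tsupport u, ∀ i, pd i (fun x => χ x * ψ x) x =
      if i = ℓ then -x ℓ else 0 := fun x hx i => by
    have hev : (fun x => χ x * ψ x) =ᶠ[𝓝 x] fun x => 1 - x ℓ * x ℓ / 2 := by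
      have hball : ball (0 : EuclideanSpace ℝ (Fin n)) 2 ∈ 𝓝 x :=
        isOpen_ball.mem_nhds (closedBall_subset_ball (by norm_num) (hsupp hx))
      filter_upwards [hball] with y hy
      simp only [ψ]
      rw [χ.one_of_mem_closedBall (ball_subset_closedBall hy), one_mul, sq]
    have hder : HasDerivAt (fun s : ℝ => 1 - s * s / 2) (-x ℓ) (x ℓ) := by
      have h := (((hasDerivAt_id (x ℓ)).mul (hasDerivAt_id (x ℓ))).div_const 2).const_sub 1
      convert! h using 1
      simp
    have h := pd_comp (u := fun y : EuclideanSpace ℝ (Fin n) => y ℓ) hder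
      (hcoord.differentiable (by norm_num) x) i
    rw [pd] at h
    rw [pd, hev.fderiv_eq, h, hpdx]
    split_ifs <;> simp
  have h := hb.integral_mul_ellOp hu hφ hφc
  have h1 : ∀ x, ∑ i, ∑ j, b (x ℓ) i j * (pd i (fun x => χ x * ψ x) x * pd j u x) =
      -(x ℓ * pd ℓ u x) := fun x => by
    by_cases hx : x ∈ tsupport u
    · simp only [hpdφ x hx]
      rw [Finset.sum_eq_single ℓ]
      · rw [Finset.sum_eq_single ℓ]
        · simp [hb.row]
        · intro j _ hj
          simp [hb.row, hj]
        · simp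
      · intro i _ hi
        simp [hi]
      · simp
    · have : ∀ j, pd j u x = 0 := fun j =>
        image_eq_zero_of_notMem_tsupport fun h => hx (tsupport_pd_subset j u h)
      simp [this]
  simp only [h1] at h
  have h2 : ∫ x : EuclideanSpace ℝ (Fin n), x ℓ * pd ℓ u x = -∫ x, u x := by
    have h3 := integral_coeff_mul_pd (c := fun _ => 1) (K := 1) measurable_const (by simp)
      (i := ℓ) (ℓ := ℓ) (Or.inr ⟨1, fun _ => rfl⟩) (hcoord.mul hu1)
      (G := fun x => x ℓ * u x) huc.mul_left
    have h4 : ∀ x : EuclideanSpace ℝ (Fin n), pd ℓ (fun x => x ℓ * u x) x =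
        x ℓ * pd ℓ u x + u x := fun x => by
      rw [pd_mul (hcoord.differentiable (by norm_num) x) (hu1.differentiable (by norm_num) x),
        hpdx]
      simp
    simp only [h4, one_mul] at h3
    have hI : Integrable fun x : EuclideanSpace ℝ (Fin n) => x ℓ * pd ℓ u x :=
      (hcoord.continuous.mul (contDiff_pd (m := 0) ℓ hu1
      (by norm_num)).continuous).integrable_of_hasCompactSupport
      (hasCompactSupport_pd huc ℓ).mul_left
    rw [integral_add hI (hu.continuous.integrable_of_hasCompactSupport huc)] at h3
    linarith
  rw [integral_neg, h2, neg_neg] at h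
  have h5 : ∫ x, -g x ≤ ∫ x, χ x * ψ x * ellOp b ℓ u x := by
    refine integral_mono_ae hgi.neg (hb.integrable_ellOp_mul hu hφ.continuous hφc) ?_
    filter_upwards [hsub] with x hx
    by_cases hxs : x ∈ tsupport u
    · have hx1 : ‖x‖ ≤ 1 := by simpa using hsupp hxs
      have hx2 : x ℓ ^ 2 ≤ 1 := by
        have := (PiLp.norm_apply_le x ℓ).trans hx1
        rw [Real.norm_eq_abs] at this
        exact (sq_le_one_iff_abs_le_one _).2 this
      have hχ : χ x = 1 := χ.one_of_mem_closedBall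
        (closedBall_subset_closedBall (by norm_num) (hsupp hxs))
      simp only [ψ, hχ, one_mul]
      nlinarith [hg x, sq_nonneg (x ℓ), mul_nonneg (hg x) (sq_nonneg (x ℓ))]
    · rw [ellOp_eq_zero_of_notMem hxs, mul_zero]
      exact neg_nonpos.2 (hg x)
  rw [integral_neg, h] at h5
  linarith

end IsNormalized

lemma norm_fderiv_le (u : EuclideanSpace ℝ (Fin n) → ℝ) (x : EuclideanSpace ℝ (Fin n)) :
    ‖fderiv ℝ u x‖ ≤ √(gradSq u x) := by
  refine ContinuousLinearMap.opNorm_le_bound _ (Real.sqrt_nonneg _) fun v => ?_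
  have h : fderiv ℝ u x v = ∑ i, v i * pd i u x := by
    conv_lhs => rw [← (EuclideanSpace.basisFun (Fin n) ℝ).sum_repr v]
    simp [map_sum, pd]
  rw [Real.norm_eq_abs, h, EuclideanSpace.norm_eq, ← Real.sqrt_mul (gradSq_nonneg u x)]
  refine Real.abs_le_sqrt ?_
  have := Finset.sum_mul_sq_le_sq_mul_sq Finset.univ (fun i => v i) fun i => pd i u x
  simp only [Real.norm_eq_abs, sq_abs]
  rw [mul_comm (gradSq u x)]
  exact this

lemma exists_forall_abs_deriv_smoothTransition_le :
    ∃ M : ℝ, 0 < M ∧ ∀ s, |deriv Real.smoothTransition s| ≤ M := by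
  have hc : Continuous (deriv Real.smoothTransition) :=
    (Real.smoothTransition.contDiff (n := 1)).continuous_deriv (by norm_num)
  obtain ⟨M, hM⟩ := isCompact_Icc.exists_bound_of_continuousOn (hc.continuousOn (s := Icc (0 : ℝ) 1))
  refine ⟨max M 1, by positivity, fun s => ?_⟩
  by_cases hs : s ∈ Icc (0 : ℝ) 1
  · exact (hM s hs).trans (le_max_left _ _)
  · have h0 : deriv Real.smoothTransition s = 0 := by
      rw [mem_Icc, not_and_or, not_le, not_le] at hs
      rcases hs with hs | hs
      · have : Real.smoothTransition =ᶠ[𝓝 s] fun _ => 0 := by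
          filter_upwards [Iio_mem_nhds hs] with y hy
          exact Real.smoothTransition.zero_of_nonpos (le_of_lt hy)
        rw [this.deriv_eq, deriv_const]
      · have : Real.smoothTransition =ᶠ[𝓝 s] fun _ => 1 := by
          filter_upwards [Ioi_mem_nhds hs] with y hy
          exact Real.smoothTransition.one_of_one_le (le_of_lt hy)
        rw [this.deriv_eq, deriv_const]
    rw [h0, abs_zero]
    positivity

/-- Cutoff functions between concentric balls. -/
lemma exists_cutoff (n : ℕ) : ∃ M : ℝ, 0 < M ∧ ∀ (x₁ : EuclideanSpace ℝ (Fin n)) (s r : ℝ),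
    0 < s → s < r → ∃ ζ : EuclideanSpace ℝ (Fin n) → ℝ, ContDiff ℝ 2 ζ ∧
      (∀ x, 0 ≤ ζ x ∧ ζ x ≤ 1) ∧ (∀ x ∈ closedBall x₁ s, ζ x = 1) ∧
      tsupport ζ ⊆ closedBall x₁ r ∧ ∀ x, gradSq ζ x ≤ (M / (r - s)) ^ 2 := by
  obtain ⟨M, hM, hMs⟩ := exists_forall_abs_deriv_smoothTransition_le
  refine ⟨2 * M, by positivity, fun x₁ s r hs hsr => ?_⟩
  have hd : 0 < r ^ 2 - s ^ 2 := by nlinarith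
  let q : EuclideanSpace ℝ (Fin n) → ℝ := fun x => (r ^ 2 - ‖x - x₁‖ ^ 2) / (r ^ 2 - s ^ 2)
  have hq : ContDiff ℝ 2 q :=
    (contDiff_const.sub ((contDiff_id.sub contDiff_const).norm_sq ℝ)).div_const _
  have hts : tsupport (fun x => Real.smoothTransition (q x)) ⊆ closedBall x₁ r := by
    refine closure_minimal (fun x hx => ?_) isClosed_closedBall
    by_contra hcon
    rw [mem_closedBall, dist_eq_norm, not_le] at hcon
    refine hx (Real.smoothTransition.zero_of_nonpos (div_nonpos_of_nonpos_of_nonneg ?_ hd.le))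
    nlinarith [norm_nonneg (x - x₁)]
  refine ⟨fun x => Real.smoothTransition (q x), Real.smoothTransition.contDiff.comp hq,
    fun x => ⟨Real.smoothTransition.nonneg _, Real.smoothTransition.le_one _⟩, fun x hx => ?_,
    hts, fun x => ?_⟩
  · refine Real.smoothTransition.one_of_one_le ((one_le_div hd).2 ?_)
    rw [mem_closedBall, dist_eq_norm] at hx
    nlinarith [norm_nonneg (x - x₁)]
  · by_cases hx : x ∈ closedBall x₁ r
    · rw [mem_closedBall, dist_eq_norm] at hx
      have hpq : ∀ i, pd i q x = -(2 * (x - x₁) i) / (r ^ 2 - s ^ 2) := fun i => by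
        have h1 : HasFDerivAt (fun x => ‖x - x₁‖ ^ 2) _ x :=
          ((hasFDerivAt_id x).sub_const x₁).norm_sq
        have h2 := (h1.const_sub (r ^ 2)).mul_const (r ^ 2 - s ^ 2)⁻¹
        have h3 : q = fun x => (r ^ 2 - ‖x - x₁‖ ^ 2) * (r ^ 2 - s ^ 2)⁻¹ := by
          ext x
          simp [q, div_eq_mul_inv]
        rw [pd, h3, h2.fderiv]
        simp [EuclideanSpace.inner_single_right]
        ring
      have hpd : ∀ i, pd i (fun x => Real.smoothTransition (q x)) x =
          deriv Real.smoothTransition (q x) * pd i q x := fun i =>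
        pd_comp ((Real.smoothTransition.contDiff (n := 1)).differentiable (by norm_num)
          _).hasDerivAt (hq.differentiable (by norm_num) x) i
      have hsum : ∑ i, (x - x₁) i ^ 2 = ‖x - x₁‖ ^ 2 := by
        rw [EuclideanSpace.norm_eq, Real.sq_sqrt (Finset.sum_nonneg fun _ _ => sq_nonneg _)]
        simp
      have : gradSq (fun x => Real.smoothTransition (q x)) x =
          (deriv Real.smoothTransition (q x)) ^ 2 * (2 * ‖x - x₁‖ / (r ^ 2 - s ^ 2)) ^ 2 := by
        simp only [gradSq, hpd, hpq, mul_pow, ← Finset.mul_sum, div_pow, neg_sq,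
          ← Finset.sum_div, hsum]
      rw [this, ← mul_pow]
      refine sq_le_sq.2 ?_
      have hr : 0 < r - s := sub_pos.2 hsr
      have hr' : 0 < r + s := by linarith
      rw [abs_mul, abs_of_nonneg (by positivity : 0 ≤ 2 * ‖x - x₁‖ / (r ^ 2 - s ^ 2)),
        abs_of_pos (by positivity : 0 < 2 * M / (r - s))]
      have h1 : 2 * ‖x - x₁‖ / (r ^ 2 - s ^ 2) ≤ 2 / (r - s) := by
        rw [div_le_div_iff₀ hd hr]
        nlinarith
      calc _ ≤ M * (2 / (r - s)) := mul_le_mul (hMs _) h1 (by positivity) hM.le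
        _ = _ := by ring
    · have : gradSq (fun x => Real.smoothTransition (q x)) x = 0 :=
        Finset.sum_eq_zero fun i _ => by
          rw [image_eq_zero_of_notMem_tsupport fun h => hx (hts (tsupport_pd_subset i _ h)),
            zero_pow two_ne_zero]
      rw [this]
      positivity

lemma gradSq_sq_mul_sq_le {ζ w : EuclideanSpace ℝ (Fin n) → ℝ} {x : EuclideanSpace ℝ (Fin n)}
    (hζ : DifferentiableAt ℝ ζ x) (hw : DifferentiableAt ℝ w x) {T : ℝ} (hT : 0 < T) :
    √(gradSq (fun y => ζ y * w y * (ζ y * w y)) x) ≤ 2 * T * (ζ x * w x) ^ 2 +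
      (ζ x ^ 2 * gradSq w x + w x ^ 2 * gradSq ζ x) / T := by
  have hpd : ∀ i, pd i (fun y => ζ y * w y * (ζ y * w y)) x =
      2 * (ζ x * w x) * (ζ x * pd i w x + w x * pd i ζ x) := fun i => by
    rw [pd_mul (u := fun y => ζ y * w y) (w := fun y => ζ y * w y) (hζ.mul hw) (hζ.mul hw),
      pd_mul hζ hw]
    ring
  have hQ : gradSq (fun y => ζ y * w y * (ζ y * w y)) x ≤ 8 * (ζ x * w x) ^ 2 *
      (ζ x ^ 2 * gradSq w x + w x ^ 2 * gradSq ζ x) := by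
    simp only [gradSq, hpd, Finset.mul_sum, ← Finset.sum_add_distrib]
    refine Finset.sum_le_sum fun i _ => ?_
    have h := mul_le_mul_of_nonneg_left (add_sq_le (a := ζ x * pd i w x) (b := w x * pd i ζ x))
      (by positivity : 0 ≤ 4 * (ζ x * w x) ^ 2)
    calc _ = 4 * (ζ x * w x) ^ 2 * (ζ x * pd i w x + w x * pd i ζ x) ^ 2 := by ring
      _ ≤ _ := h
      _ = _ := by ring
  have hQ0 : 0 ≤ ζ x ^ 2 * gradSq w x + w x ^ 2 * gradSq ζ x := by
    have := gradSq_nonneg w x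
    have := gradSq_nonneg ζ x
    positivity
  refine Real.sqrt_le_iff.2 ⟨by positivity, hQ.trans ?_⟩
  set P := (ζ x * w x) ^ 2
  set Q := ζ x ^ 2 * gradSq w x + w x ^ 2 * gradSq ζ x
  have e : (2 * T * P + Q / T) ^ 2 - 8 * P * Q = (2 * T * P - Q / T) ^ 2 := by
    field_simp
    ring
  nlinarith [sq_nonneg (2 * T * P - Q / T)]

lemma gradSq_eq_zero_of_notMem {u : EuclideanSpace ℝ (Fin n) → ℝ} {x : EuclideanSpace ℝ (Fin n)}
    (hx : x ∉ tsupport u) : gradSq u x = 0 :=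
  Finset.sum_eq_zero fun i _ => by
    rw [image_eq_zero_of_notMem_tsupport fun h => hx (tsupport_pd_subset i u h),
      zero_pow two_ne_zero]

lemma holderConjugate_natCast (hn : 2 ≤ n) :
    Real.HolderConjugate (n : ℝ) (n / (n - 1 : ℝ)) := by
  have h : (2 : ℝ) ≤ n := by exact_mod_cast hn
  exact Real.HolderConjugate.conjExponent (by linarith)

/-- The reverse Sobolev inequality for nonnegative subsolutions. -/
lemma exists_integral_rpow_le (hn : 2 ≤ n) (lam K : ℝ) (hlam : 0 < lam) (hK : 0 < K) :
    ∃ S : ℝ, 0 < S ∧ ∀ (b : ℝ → Matrix (Fin n) (Fin n) ℝ) (ℓ : Fin n), IsNormalized b ℓ lam K →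
      ∀ w ζ : EuclideanSpace ℝ (Fin n) → ℝ, ContDiff ℝ 2 w → ContDiff ℝ 1 ζ →
      ∀ (B B' : Set (EuclideanSpace ℝ (Fin n))) (T : ℝ), IsCompact B → tsupport ζ ⊆ B →
      MeasurableSet B' → (∀ x, 0 ≤ ζ x ∧ ζ x ≤ 1) → (∀ x ∈ B', ζ x = 1) → 0 < T →
      (∀ x, gradSq ζ x ≤ T ^ 2) → (∀ᵐ x, x ∈ B → 0 ≤ w x * ellOp b ℓ w x) →
      ∫ x in B', (w x ^ 2) ^ (n / (n - 1 : ℝ)) ≤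
        (S * (T * ∫ x in B, w x ^ 2)) ^ (n / (n - 1 : ℝ)) := by
  have hconj := holderConjugate_natCast hn
  set κ : ℝ := n / (n - 1 : ℝ) with hκ
  have hκ0 : 0 < κ := hconj.symm.pos
  set G : ℝ := ((lintegralPowLePowLIntegralFDerivConst
    (volume : Measure (EuclideanSpace ℝ (Fin n))) κ : NNReal) : ℝ) with hG
  have hG0 : 0 ≤ G := NNReal.coe_nonneg _
  refine ⟨(G + 1) ^ κ⁻¹ * (3 + (2 * n * K / lam) ^ 2), by positivity, ?_⟩
  intro b ℓ hb w ζ hw hζ B B' T hB hζB hB' hζ01 hζ1 hT hgr hsub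
  have hw1 : ContDiff ℝ 1 w := hw.of_le (by norm_num)
  have hζc : HasCompactSupport ζ := hB.of_isClosed_subset (isClosed_tsupport ζ) hζB
  have hζ0 : ∀ x, x ∉ B → ζ x = 0 := fun x hx =>
    image_eq_zero_of_notMem_tsupport fun h => hx (hζB h)
  let z : EuclideanSpace ℝ (Fin n) → ℝ := fun y => ζ y * w y * (ζ y * w y)
  have hz : ContDiff ℝ 1 z := (hζ.mul hw1).mul (hζ.mul hw1)
  have hz0 : ∀ x, 0 ≤ z x := fun x => mul_self_nonneg _
  have hzc : HasCompactSupport z := by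
    refine HasCompactSupport.intro hζc.isCompact fun x hx => ?_
    simp [z, image_eq_zero_of_notMem_tsupport hx]
  have hgns := lintegral_pow_le_pow_lintegral_fderiv
    (volume : Measure (EuclideanSpace ℝ (Fin n))) hz hzc (p := κ) (by simpa using hconj)
  have hcac := hb.integral_sq_mul_gradSq_le hlam hK hw hζ hζc (by
    filter_upwards [hsub] with x hx
    by_cases hxB : x ∈ B
    · exact mul_nonneg (sq_nonneg _) (hx hxB)
    · simp [hζ0 x hxB])
  set M := (2 * n * K / lam) ^ 2
  have hM0 : 0 ≤ M := sq_nonneg _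
  have hIB : IntegrableOn (fun x => w x ^ 2) B :=
    (hw.continuous.pow 2).continuousOn.integrableOn_compact hB
  have hI0 : 0 ≤ ∫ x in B, w x ^ 2 := integral_nonneg fun _ => sq_nonneg _
  have hi1 : Integrable fun x => (ζ x * w x) ^ 2 := by
    have : (fun x => (ζ x * w x) ^ 2) = z := by ext x; simp only [z]; ring
    rw [this]
    exact hz.continuous.integrable_of_hasCompactSupport hzc
  have hζ2c : HasCompactSupport fun x => ζ x ^ 2 := by
    have h : HasCompactSupport fun x => ζ x * ζ x := hζc.mul_right
    simpa only [sq] using h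
  have hi2 : Integrable fun x => ζ x ^ 2 * gradSq w x :=
    ((hζ.continuous.pow 2).mul (continuous_gradSq hw1)).integrable_of_hasCompactSupport
      hζ2c.mul_right
  have hi3 : Integrable fun x => w x ^ 2 * gradSq ζ x :=
    ((hw.continuous.pow 2).mul (continuous_gradSq hζ)).integrable_of_hasCompactSupport
      (HasCompactSupport.intro hζc.isCompact fun x hx => by
        rw [Pi.mul_apply, gradSq_eq_zero_of_notMem hx, mul_zero])
  have hi23 : Integrable fun x => ζ x ^ 2 * gradSq w x + w x ^ 2 * gradSq ζ x := hi2.add hi3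
  have hb1 : ∫ x, (ζ x * w x) ^ 2 ≤ ∫ x in B, w x ^ 2 := by
    rw [← integral_indicator hB.measurableSet]
    refine integral_mono hi1 (hIB.integrable_indicator hB.measurableSet) fun x => ?_
    by_cases hx : x ∈ B
    · rw [indicator_of_mem hx, mul_pow]
      exact mul_le_of_le_one_left (sq_nonneg _) (pow_le_one₀ (hζ01 x).1 (hζ01 x).2)
    · simp [hx, hζ0 x hx]
  have hb2 : ∫ x, w x ^ 2 * gradSq ζ x ≤ T ^ 2 * ∫ x in B, w x ^ 2 := by
    rw [← integral_indicator hB.measurableSet, ← integral_const_mul]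
    refine integral_mono hi3 ((hIB.integrable_indicator hB.measurableSet).const_mul _) fun x => ?_
    by_cases hx : x ∈ B
    · simp only [indicator_of_mem hx]
      rw [mul_comm (T ^ 2)]
      exact mul_le_mul_of_nonneg_left (hgr x) (sq_nonneg _)
    · simp [hx, gradSq_eq_zero_of_notMem fun h => hx (hζB h)]
  have hfd : ∫⁻ x, ‖fderiv ℝ z x‖ₑ ≤ ENNReal.ofReal ((3 + M) * (T * ∫ x in B, w x ^ 2)) := by
    have hpt : ∀ x, ‖fderiv ℝ z x‖ ≤ 2 * T * (ζ x * w x) ^ 2 +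
        (ζ x ^ 2 * gradSq w x + w x ^ 2 * gradSq ζ x) / T := fun x =>
      (norm_fderiv_le z x).trans (gradSq_sq_mul_sq_le (hζ.differentiable (by norm_num) x)
        (hw1.differentiable (by norm_num) x) hT)
    have hInt : Integrable fun x => 2 * T * (ζ x * w x) ^ 2 +
        (ζ x ^ 2 * gradSq w x + w x ^ 2 * gradSq ζ x) / T :=
      (hi1.const_mul _).add (hi23.div_const _)
    calc ∫⁻ x, ‖fderiv ℝ z x‖ₑ ≤ ∫⁻ x, ENNReal.ofReal (2 * T * (ζ x * w x) ^ 2 +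
        (ζ x ^ 2 * gradSq w x + w x ^ 2 * gradSq ζ x) / T) := lintegral_mono fun x => by
          rw [← ofReal_norm]
          exact ENNReal.ofReal_le_ofReal (hpt x)
      _ = ENNReal.ofReal (∫ x, 2 * T * (ζ x * w x) ^ 2 +
        (ζ x ^ 2 * gradSq w x + w x ^ 2 * gradSq ζ x) / T) :=
          (ofReal_integral_eq_lintegral_ofReal hInt
            (Eventually.of_forall fun x => (norm_nonneg _).trans (hpt x))).symm
      _ ≤ _ := by
          refine ENNReal.ofReal_le_ofReal ?_
          rw [integral_add (hi1.const_mul _) (hi23.div_const _), integral_const_mul,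
            integral_div, integral_add hi2 hi3]
          have h1 := mul_le_mul_of_nonneg_left hb2 (by positivity : 0 ≤ M + 1)
          have h2 := mul_le_mul_of_nonneg_left hb1 (by positivity : 0 ≤ 2 * T)
          have h3 : (∫ x, ζ x ^ 2 * gradSq w x) + ∫ x, w x ^ 2 * gradSq ζ x ≤
            (M + 1) * (T ^ 2 * ∫ x in B, w x ^ 2) := by linarith
          have h4 := div_le_div_of_nonneg_right h3 hT.le
          have h5 : (M + 1) * (T ^ 2 * ∫ x in B, w x ^ 2) / T =
            (M + 1) * (T * ∫ x in B, w x ^ 2) := by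
            field_simp
          rw [h5] at h4
          linarith
  have hlow : ENNReal.ofReal (∫ x in B', (w x ^ 2) ^ κ) ≤ ∫⁻ x, ‖z x‖ₑ ^ κ := by
    by_cases hintB : IntegrableOn (fun x => (w x ^ 2) ^ κ) B'
    swap
    · rw [integral_undef hintB]
      simp
    rw [ofReal_integral_eq_lintegral_ofReal hintB
      (Eventually.of_forall fun x => Real.rpow_nonneg (sq_nonneg _) _)]
    refine le_trans (setLIntegral_mono' hB' fun x hx => ?_) (setLIntegral_le_lintegral _ _)
    have : z x = w x ^ 2 := by
      simp only [z, hζ1 x hx]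
      ring
    rw [← ofReal_norm, this, Real.norm_of_nonneg (sq_nonneg _),
      ENNReal.ofReal_rpow_of_nonneg (sq_nonneg _) hκ0.le]
  have hfin := hlow.trans (hgns.trans (mul_le_mul_right (ENNReal.rpow_le_rpow hfd hκ0.le) _))
  have hnn : 0 ≤ (3 + M) * (T * ∫ x in B, w x ^ 2) := by positivity
  rw [ENNReal.ofReal_rpow_of_nonneg hnn hκ0.le, ← ENNReal.ofReal_coe_nnreal,
    ← ENNReal.ofReal_mul (NNReal.coe_nonneg _), ENNReal.ofReal_le_ofReal_iff (by positivity)]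
    at hfin
  refine hfin.trans ?_
  rw [mul_assoc ((G + 1) ^ κ⁻¹), Real.mul_rpow (by positivity) hnn, ← Real.rpow_mul (by positivity),
    inv_mul_cancel₀ hκ0.ne', Real.rpow_one]
  refine mul_le_mul_of_nonneg_right ?_ (by positivity)
  rw [← hG]
  linarith

lemma D2_comp {φ φ₁ : ℝ → ℝ} {φ₂ : ℝ} {u : EuclideanSpace ℝ (Fin n) → ℝ}
    {x : EuclideanSpace ℝ (Fin n)} (hφ : ∀ᶠ s in 𝓝 (u x), HasDerivAt φ (φ₁ s) s)
    (hφ₁ : HasDerivAt φ₁ φ₂ (u x)) (hu : ContDiff ℝ 2 u) (i j : Fin n) :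
    D2 (fun y => φ (u y)) x i j = φ₁ (u x) * D2 u x i j + φ₂ * (pd i u x * pd j u x) := by
  have hd : Differentiable ℝ u := hu.differentiable (by norm_num)
  have hpd : Differentiable ℝ (pd j u) :=
    (contDiff_pd (m := 1) j hu (by norm_num)).differentiable (by norm_num)
  have hev : pd j (fun y => φ (u y)) =ᶠ[𝓝 x] fun y => φ₁ (u y) * pd j u y := by
    filter_upwards [hu.continuous.continuousAt.eventually hφ] with y hy
    exact pd_comp hy (hd y) j
  rw [D2_eq_pd, pd, hev.fderiv_eq]
  have h := pd_mul (u := fun y => φ₁ (u y)) (w := pd j u)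
    (hφ₁.comp_hasFDerivAt x (hd x).hasFDerivAt).differentiableAt (hpd x) i
  rw [pd_comp hφ₁ (hd x)] at h
  rw [pd] at h
  rw [h, D2_eq_pd]
  ring

lemma ellOp_comp (a : ℝ → Matrix (Fin n) (Fin n) ℝ) (ℓ : Fin n) {φ φ₁ : ℝ → ℝ} {φ₂ : ℝ}
    {u : EuclideanSpace ℝ (Fin n) → ℝ}
    {x : EuclideanSpace ℝ (Fin n)} (hφ : ∀ᶠ s in 𝓝 (u x), HasDerivAt φ (φ₁ s) s)
    (hφ₁ : HasDerivAt φ₁ φ₂ (u x)) (hu : ContDiff ℝ 2 u) :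
    ellOp a ℓ (fun y => φ (u y)) x = φ₁ (u x) * ellOp a ℓ u x +
      φ₂ * ∑ i, ∑ j, a (x ℓ) i j * (pd i u x * pd j u x) := by
  simp only [ellOp, D2_comp hφ hφ₁ hu, Finset.mul_sum, ← Finset.sum_add_distrib]
  exact Finset.sum_congr rfl fun i _ => Finset.sum_congr rfl fun j _ => by ring

lemma IsNormalized.quadForm_nonneg {b : ℝ → Matrix (Fin n) (Fin n) ℝ} {ℓ : Fin n} {lam K : ℝ}
    (hb : IsNormalized b ℓ lam K) (hlam : 0 ≤ lam) (s : ℝ) (ξ : Fin n → ℝ) :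
    0 ≤ ∑ i, ∑ j, b s i j * (ξ i * ξ j) := by
  have h := hb.coercive s ξ
  have h0 : 0 ≤ lam * ∑ i, ξ i ^ 2 := mul_nonneg hlam (Finset.sum_nonneg fun _ _ => sq_nonneg _)
  refine (h0.trans h).trans (le_of_eq ?_)
  exact Finset.sum_congr rfl fun i _ => Finset.sum_congr rfl fun j _ => by ring

/-- Powers of positive subsolutions are subsolutions. -/
lemma IsNormalized.ellOp_rpow_nonneg {b : ℝ → Matrix (Fin n) (Fin n) ℝ} {ℓ : Fin n} {lam K : ℝ}
    (hb : IsNormalized b ℓ lam K) (hlam : 0 ≤ lam) {u : EuclideanSpace ℝ (Fin n) → ℝ}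
    (hu : ContDiff ℝ 2 u) {x : EuclideanSpace ℝ (Fin n)} (hx : 0 < u x) {q : ℝ} (hq : 1 ≤ q)
    (h : 0 ≤ ellOp b ℓ u x) : 0 ≤ ellOp b ℓ (fun y => u y ^ q) x := by
  rw [ellOp_comp b ℓ (φ := fun s => s ^ q) (φ₁ := fun s => q * s ^ (q - 1))
    (φ₂ := q * ((q - 1) * u x ^ (q - 1 - 1)))
    (by
      filter_upwards [Ioi_mem_nhds hx] with s hs
      exact Real.hasDerivAt_rpow_const (Or.inl (ne_of_gt hs)))
    ((Real.hasDerivAt_rpow_const (Or.inl hx.ne')).const_mul q) hu]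
  have h1 := hb.quadForm_nonneg hlam (x ℓ) fun i => pd i u x
  have h2 : 0 ≤ q - 1 := sub_nonneg.2 hq
  positivity

lemma rpow_pow_sub_one (hn : 2 ≤ n) {y : ℝ} (hy : 0 ≤ y) :
    (y ^ (n - 1)) ^ (n / (n - 1 : ℝ)) = y ^ n := by
  have h : (2 : ℝ) ≤ n := by exact_mod_cast hn
  have h' : (n : ℝ) - 1 ≠ 0 := by linarith
  rw [← Real.rpow_natCast y (n - 1), ← Real.rpow_mul hy, Nat.cast_sub (by omega), Nat.cast_one,
    mul_div_cancel₀ _ h', Real.rpow_natCast]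

/-- The nonlinear recursion in Moser's iteration. -/
lemma le_of_moser_recursion (hn : 2 ≤ n) {I : ℕ → ℝ} {D : ℝ} (hD : 0 < D) (hI : ∀ j, 0 ≤ I j)
    (h : ∀ j, I (j + 1) ≤ (D * 2 ^ j * I j) ^ (n / (n - 1 : ℝ))) (j : ℕ) :
    I j ≤ (I 0 * (2 ^ (n - 1) * D) ^ n) ^ ((n / (n - 1 : ℝ)) ^ j) *
      ((2 ^ (n - 1) * D) ^ n)⁻¹ * ((2 ^ n)⁻¹) ^ j := by
  obtain ⟨m, rfl⟩ : ∃ m, n = m + 1 := ⟨n - 1, by omega⟩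
  have hκ : (0 : ℝ) < ((m + 1 : ℕ) : ℝ) / (((m + 1 : ℕ) : ℝ) - 1) :=
    (holderConjugate_natCast hn).symm.pos
  have hrp := fun {y : ℝ} (hy : 0 ≤ y) => rpow_pow_sub_one hn hy
  set κ : ℝ := ((m + 1 : ℕ) : ℝ) / (((m + 1 : ℕ) : ℝ) - 1)
  simp only [Nat.add_sub_cancel] at hrp ⊢
  set a : ℝ := ((2 ^ m * D) ^ (m + 1))⁻¹ with ha
  set α : ℝ := I 0 * (2 ^ m * D) ^ (m + 1) with hα
  have hα0 : 0 ≤ α := mul_nonneg (hI 0) (by positivity)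
  have ha0 : 0 < a := by positivity
  induction j with
  | zero =>
    simp only [pow_zero, Real.rpow_one, mul_one]
    rw [hα, ha, mul_inv_cancel_right₀ (by positivity)]
  | succ j ih =>
    refine (h j).trans ?_
    have hpos : 0 ≤ D * 2 ^ j * I j := mul_nonneg (by positivity) (hI j)
    have h1 : D * 2 ^ j * I j ≤ α ^ (κ ^ j) * ((((2 ^ (m + 1) * D) ^ m)⁻¹) * (((2 ^ m)⁻¹) ^ j)) := by
      refine (mul_le_mul_of_nonneg_left ih (by positivity)).trans (le_of_eq ?_)
      have e1 : D * a = ((2 ^ (m + 1) * D) ^ m)⁻¹ := by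
        rw [ha, mul_pow, mul_pow, ← pow_mul, ← pow_mul, mul_comm m (m + 1), pow_succ D]
        field_simp
      have e2 : (2 : ℝ) ^ j * ((2 ^ (m + 1))⁻¹) ^ j = ((2 ^ m)⁻¹) ^ j := by
        rw [← mul_pow]
        congr 1
        rw [pow_succ]
        field_simp
      rw [← e1, ← e2]
      ring
    refine (Real.rpow_le_rpow hpos h1 hκ.le).trans (le_of_eq ?_)
    have hαp : 0 ≤ α ^ (κ ^ j) := Real.rpow_nonneg hα0 _
    have e3 : ((2 ^ (m + 1) * D) ^ m)⁻¹ * ((2 ^ m)⁻¹) ^ j = ((2 ^ (m + 1) * D * 2 ^ j) ^ m)⁻¹ := by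
      rw [mul_pow _ (2 ^ j), mul_inv, ← pow_mul 2 j, mul_comm j m, pow_mul, inv_pow]
    have e4 : ((2 ^ (m + 1) * D * 2 ^ j) ^ (m + 1))⁻¹ = a * (2 ^ (m + 1))⁻¹ ^ (j + 1) := by
      rw [ha, inv_pow, ← mul_inv, ← pow_mul, mul_comm (m + 1) (j + 1), pow_mul, ← mul_pow]
      ring
    rw [Real.mul_rpow hαp (by rw [e3]; positivity), ← Real.rpow_mul hα0, ← pow_succ, e3,
      Real.inv_rpow (by positivity), hrp (by positivity), e4, mul_assoc]

/-- The local `L²` to `L∞` bound for positive subsolutions. -/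
lemma exists_sq_le_of_pos (hn : 2 ≤ n) (lam K : ℝ) (hlam : 0 < lam) (hK : 0 < K) :
    ∃ C : ℝ, 0 < C ∧ ∀ (b : ℝ → Matrix (Fin n) (Fin n) ℝ) (ℓ : Fin n), IsNormalized b ℓ lam K →
      ∀ u : EuclideanSpace ℝ (Fin n) → ℝ, ContDiff ℝ 2 u → (∀ x, 0 < u x) →
      ∀ (x₁ : EuclideanSpace ℝ (Fin n)) (R : ℝ), 0 < R →
      (∀ᵐ x, x ∈ closedBall x₁ R → 0 ≤ ellOp b ℓ u x) →
      u x₁ ^ 2 ≤ C / R ^ n * ∫ x in closedBall x₁ R, u x ^ 2 := by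
  obtain ⟨S, hS, hSob⟩ := exists_integral_rpow_le hn lam K hlam hK
  obtain ⟨M, hM, hcut⟩ := exists_cutoff n
  refine ⟨(2 ^ (n - 1) * (S * (4 * M))) ^ n, by positivity, ?_⟩
  intro b ℓ hb u hu hu0 x₁ R hR hsub
  have hn2 : (2 : ℝ) ≤ n := by exact_mod_cast hn
  have hκ1 : (1 : ℝ) ≤ n / (n - 1 : ℝ) := by
    rw [le_div_iff₀ (by linarith)]
    linarith
  set κ : ℝ := n / (n - 1 : ℝ) with hκ
  let ρ : ℕ → ℝ := fun j => R / 2 * (1 + (1 / 2) ^ j)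
  let I : ℕ → ℝ := fun j => ∫ x in closedBall x₁ (ρ j), (u x ^ (κ ^ j)) ^ 2
  have hρ : ∀ j, ρ j - ρ (j + 1) = R / 4 * (1 / 2) ^ j := fun j => by
    simp only [ρ, pow_succ]
    ring
  have hρR : ∀ j, ρ j ≤ R := fun j => by
    have : (1 / 2 : ℝ) ^ j ≤ 1 := pow_le_one₀ (by norm_num) (by norm_num)
    simp only [ρ]
    nlinarith
  have hρh : ∀ j, R / 2 < ρ j := fun j => by
    have : 0 < R / 2 * (1 / 2 : ℝ) ^ j := by positivity
    simp only [ρ]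
    linarith
  have hw : ∀ j, ContDiff ℝ 2 fun x => u x ^ (κ ^ j) := fun j =>
    hu.rpow_const_of_ne fun x => (hu0 x).ne'
  have hI : ∀ j, 0 ≤ I j := fun j => integral_nonneg fun _ => sq_nonneg _
  have hrec : ∀ j, I (j + 1) ≤ (S * (4 * M) / R * 2 ^ j * I j) ^ κ := fun j => by
    have hlt : ρ (j + 1) < ρ j := by
      have : 0 < R / 4 * (1 / 2 : ℝ) ^ j := by positivity
      linarith [hρ j]
    obtain ⟨ζ, hζ, hζ01, hζ1, hζs, hζg⟩ := hcut x₁ (ρ (j + 1)) (ρ j)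
      (by linarith [hρh (j + 1)]) hlt
    have h := hSob b ℓ hb _ ζ (hw j) (hζ.of_le (by norm_num)) (closedBall x₁ (ρ j))
      (closedBall x₁ (ρ (j + 1))) (M / (ρ j - ρ (j + 1))) (isCompact_closedBall _ _) hζs
      isClosed_closedBall.measurableSet hζ01 hζ1 (div_pos hM (sub_pos.2 hlt)) hζg (by
        filter_upwards [hsub] with x hx hxB
        exact mul_nonneg (Real.rpow_nonneg (hu0 x).le _) (hb.ellOp_rpow_nonneg hlam.le hu (hu0 x)
          (one_le_pow₀ hκ1) (hx (closedBall_subset_closedBall (hρR j) hxB))))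
    have e1 : ∀ x, ((u x ^ (κ ^ j)) ^ 2) ^ κ = (u x ^ (κ ^ (j + 1))) ^ 2 := fun x => by
      rw [pow_succ κ, Real.rpow_mul (hu0 x).le,
        Real.rpow_pow_comm (Real.rpow_nonneg (hu0 x).le _)]
    simp only [e1] at h
    refine h.trans (le_of_eq ?_)
    congr 1
    rw [hρ]
    simp only [I, one_div, inv_pow]
    field_simp
  have hD : 0 < S * (4 * M) / R := by positivity
  have hmos := le_of_moser_recursion hn hD hI hrec
  set a : ℝ := ((2 ^ (n - 1) * (S * (4 * M) / R)) ^ n)⁻¹ with ha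
  set α : ℝ := I 0 * (2 ^ (n - 1) * (S * (4 * M) / R)) ^ n with hα
  have hα0 : 0 ≤ α := mul_nonneg (hI 0) (by positivity)
  have hαe : (2 ^ (n - 1) * (S * (4 * M))) ^ n / R ^ n * ∫ x in closedBall x₁ R, u x ^ 2 = α := by
    have h0 : I 0 = ∫ x in closedBall x₁ R, u x ^ 2 := by
      simp only [I, ρ, pow_zero, Real.rpow_one]
      norm_num
    rw [hα, h0, ← div_pow]
    ring
  rw [hαe]
  by_contra! hcon
  set α' := (α + u x₁ ^ 2) / 2 with hα'
  have hα'0 : 0 < α' := by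
    have := pow_pos (hu0 x₁) 2
    positivity
  have hα'1 : α' < u x₁ ^ 2 := by
    rw [hα']
    linarith
  have hev : ∀ᶠ x in 𝓝 x₁, α' < u x ^ 2 :=
    (hu.continuous.pow 2).continuousAt.eventually (lt_mem_nhds hα'1)
  obtain ⟨ε, hε, hball⟩ := Metric.eventually_nhds_iff_ball.1 hev
  set ε' := min (ε / 2) (R / 2) with hε'
  have hε'0 : 0 < ε' := by positivity
  set ν := volume.real (closedBall x₁ ε') with hν
  have hν0 : 0 < ν := ENNReal.toReal_pos (measure_closedBall_pos _ _ hε'0).ne'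
    measure_closedBall_lt_top.ne
  have hlow : ∀ j, α' ^ (κ ^ j) * ν ≤ I j := fun j => by
    have hInt : ∀ r, IntegrableOn (fun x => (u x ^ (κ ^ j)) ^ 2) (closedBall x₁ r) := fun r =>
      ((hw j).continuous.pow 2).continuousOn.integrableOn_compact (isCompact_closedBall _ _)
    calc α' ^ (κ ^ j) * ν = ∫ x in closedBall x₁ ε', α' ^ (κ ^ j) := by
          rw [setIntegral_const, smul_eq_mul, mul_comm]
      _ ≤ ∫ x in closedBall x₁ ε', (u x ^ (κ ^ j)) ^ 2 := by
          refine setIntegral_mono_on (integrableOn_const measure_closedBall_lt_top.ne) (hInt _)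
            isClosed_closedBall.measurableSet fun x hx => ?_
          have h1 : α' < u x ^ 2 := hball x (closedBall_subset_ball
            ((min_le_left _ _).trans_lt (half_lt_self hε)) hx)
          calc α' ^ (κ ^ j) ≤ (u x ^ 2) ^ (κ ^ j) :=
                Real.rpow_le_rpow hα'0.le h1.le (by positivity)
            _ = (u x ^ (κ ^ j)) ^ 2 := (Real.rpow_pow_comm (hu0 x).le _ _).symm
      _ ≤ I j := setIntegral_mono_set (hInt _) (Eventually.of_forall fun x => sq_nonneg _)
          (closedBall_subset_closedBall ((min_le_right _ _).trans (hρh j).le)).eventuallyLE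
  have hle : ∀ j, ν ≤ a * ((2 ^ n)⁻¹) ^ j := fun j => by
    have h1 := (hlow j).trans (hmos j)
    have h2 : α ^ (κ ^ j) ≤ α' ^ (κ ^ j) :=
      Real.rpow_le_rpow hα0 (by rw [hα']; linarith) (by positivity)
    have h3 : α ^ (κ ^ j) * a * ((2 ^ n)⁻¹) ^ j ≤ α' ^ (κ ^ j) * (a * ((2 ^ n)⁻¹) ^ j) := by
      rw [mul_assoc]
      exact mul_le_mul_of_nonneg_right h2 (by positivity)
    exact le_of_mul_le_mul_left (h1.trans h3) (Real.rpow_pos_of_pos hα'0 _)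
  have hlim : Tendsto (fun j : ℕ => a * ((2 ^ n : ℝ)⁻¹) ^ j) atTop (𝓝 (a * 0)) :=
    (tendsto_pow_atTop_nhds_zero_of_lt_one (by positivity)
      (inv_lt_one_of_one_lt₀ (one_lt_pow₀ one_lt_two (by omega)))).const_mul a
  have := ge_of_tendsto' hlim hle
  linarith

/-- The local `L²` to `L∞` bound for nonnegative subsolutions. -/
lemma exists_sq_le_of_nonneg (hn : 2 ≤ n) (lam K : ℝ) (hlam : 0 < lam) (hK : 0 < K) :
    ∃ C : ℝ, 0 < C ∧ ∀ (b : ℝ → Matrix (Fin n) (Fin n) ℝ) (ℓ : Fin n), IsNormalized b ℓ lam K →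
      ∀ u : EuclideanSpace ℝ (Fin n) → ℝ, ContDiff ℝ 2 u → (∀ x, 0 ≤ u x) →
      ∀ (x₁ : EuclideanSpace ℝ (Fin n)) (R : ℝ), 0 < R →
      (∀ᵐ x, x ∈ closedBall x₁ R → 0 ≤ ellOp b ℓ u x) →
      u x₁ ^ 2 ≤ C / R ^ n * ∫ x in closedBall x₁ R, u x ^ 2 := by
  obtain ⟨C, hC, h⟩ := exists_sq_le_of_pos hn lam K hlam hK
  refine ⟨C, hC, fun b ℓ hb u hu hu0 x₁ R hR hsub => ?_⟩
  have hi : ∀ k : ℕ, IntegrableOn (fun x => u x ^ k) (closedBall x₁ R) := fun k =>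
    (hu.continuous.pow k).continuousOn.integrableOn_compact (isCompact_closedBall _ _)
  have hInt : ∀ ε : ℝ, ∫ x in closedBall x₁ R, (u x + ε) ^ 2 =
      (∫ x in closedBall x₁ R, u x ^ 2) + 2 * ε * (∫ x in closedBall x₁ R, u x) +
        volume.real (closedBall x₁ R) * ε ^ 2 := fun ε => by
    have e : ∀ x, (u x + ε) ^ 2 = u x ^ 2 + 2 * ε * u x + ε ^ 2 := fun x => by ring
    have hi1 : IntegrableOn u (closedBall x₁ R) := by simpa using hi 1
    have hi2 : IntegrableOn (fun x => u x ^ 2 + 2 * ε * u x) (closedBall x₁ R) :=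
      (hi 2).add (hi1.const_mul _)
    simp only [e]
    rw [integral_add hi2 (integrableOn_const measure_closedBall_lt_top.ne),
      integral_add (hi 2) (hi1.const_mul _), integral_const_mul, setIntegral_const, smul_eq_mul]
  have key : ∀ ε > 0, (u x₁ + ε) ^ 2 ≤ C / R ^ n * ((∫ x in closedBall x₁ R, u x ^ 2) +
      2 * ε * (∫ x in closedBall x₁ R, u x) + volume.real (closedBall x₁ R) * ε ^ 2) :=
    fun ε hε => by
      rw [← hInt]
      refine h b ℓ hb (fun x => u x + ε) (hu.add contDiff_const)
        (fun x => add_pos_of_nonneg_of_pos (hu0 x) hε) x₁ R hR ?_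
      filter_upwards [hsub] with x hx hxB
      have := hx hxB
      rwa [ellOp_comp b ℓ (φ := fun s => s + ε) (φ₁ := fun _ => 1) (φ₂ := 0)
        (Eventually.of_forall fun s => (hasDerivAt_id s).add_const ε) (hasDerivAt_const _ _) hu,
        zero_mul, add_zero, one_mul]
  have hl : Tendsto (fun ε : ℝ => (u x₁ + ε) ^ 2) (𝓝[>] 0) (𝓝 ((u x₁ + 0) ^ 2)) :=
    (Continuous.tendsto (by fun_prop) 0).mono_left nhdsWithin_le_nhds
  have hr : Tendsto (fun ε : ℝ => C / R ^ n * ((∫ x in closedBall x₁ R, u x ^ 2) +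
      2 * ε * (∫ x in closedBall x₁ R, u x) + volume.real (closedBall x₁ R) * ε ^ 2)) (𝓝[>] 0)
      (𝓝 (C / R ^ n * ((∫ x in closedBall x₁ R, u x ^ 2) +
      2 * 0 * (∫ x in closedBall x₁ R, u x) + volume.real (closedBall x₁ R) * 0 ^ 2))) :=
    (Continuous.tendsto (by fun_prop) 0).mono_left nhdsWithin_le_nhds
  have := le_of_tendsto_of_tendsto hl hr (eventually_nhdsWithin_of_forall key)
  simpa using this

/-- The local maximum principle: an `L¹` to `L∞` bound for nonnegative subsolutions. -/
lemma exists_le_integral_of_nonneg (hn : 2 ≤ n) (lam K : ℝ) (hlam : 0 < lam) (hK : 0 < K) :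
    ∃ C : ℝ, 0 < C ∧ ∀ (b : ℝ → Matrix (Fin n) (Fin n) ℝ) (ℓ : Fin n), IsNormalized b ℓ lam K →
      ∀ u : EuclideanSpace ℝ (Fin n) → ℝ, ContDiff ℝ 2 u → (∀ x, 0 ≤ u x) →
      ∀ (x₁ : EuclideanSpace ℝ (Fin n)) (R : ℝ), 0 < R →
      (∀ᵐ x, x ∈ closedBall x₁ R → 0 ≤ ellOp b ℓ u x) →
      u x₁ ≤ C / R ^ n * ∫ x in closedBall x₁ R, u x := by
  obtain ⟨C, hC, h⟩ := exists_sq_le_of_nonneg hn lam K hlam hK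
  refine ⟨C * 4 ^ n, by positivity, fun b ℓ hb u hu hu0 x₁ R hR hsub => ?_⟩
  have hcont : Continuous fun x => (R - dist x x₁) ^ n * u x :=
    ((continuous_const.sub (continuous_id.dist continuous_const)).pow n).mul hu.continuous
  obtain ⟨y, hy, hmax⟩ := (isCompact_closedBall x₁ R).exists_isMaxOn
    ⟨x₁, mem_closedBall_self hR.le⟩ hcont.continuousOn
  set k := (R - dist y x₁) ^ n * u y with hk
  set J := ∫ x in closedBall x₁ R, u x with hJ
  have hJ0 : 0 ≤ J := integral_nonneg hu0
  have hmax' : ∀ x ∈ closedBall x₁ R, (R - dist x x₁) ^ n * u x ≤ k := fun x hx => hmax hx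
  have h1 : R ^ n * u x₁ ≤ k := by simpa using hmax' x₁ (mem_closedBall_self hR.le)
  have hk0 : 0 ≤ k := le_trans (mul_nonneg (by positivity) (hu0 _)) h1
  have hkJ : k ≤ C * 4 ^ n * J := by
    rcases hk0.eq_or_lt with h0 | h0
    · rw [← h0]
      positivity
    set d := R - dist y x₁ with hd
    have hd0 : 0 < d := by
      have hdn : 0 ≤ d := sub_nonneg.2 hy
      refine lt_of_le_of_ne hdn fun hd => ?_
      rw [hk, ← hd, zero_pow (by omega), zero_mul] at h0
      exact lt_irrefl _ h0
    have hsubset : closedBall y (d / 2) ⊆ closedBall x₁ R :=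
      closedBall_subset_closedBall' (by rw [hd]; linarith [dist_nonneg (x := y) (y := x₁)])
    have hI1 : ∀ B, IsCompact B → IntegrableOn u B := fun B hB =>
      hu.continuous.continuousOn.integrableOn_compact hB
    have hsq := h b ℓ hb u hu hu0 y (d / 2) (by positivity)
      (by filter_upwards [hsub] with x hx hxB using hx (hsubset hxB))
    have hb1 : ∫ x in closedBall y (d / 2), u x ^ 2 ≤ k / (d / 2) ^ n * J := by
      calc ∫ x in closedBall y (d / 2), u x ^ 2
          ≤ ∫ x in closedBall y (d / 2), k / (d / 2) ^ n * u x := by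
            refine setIntegral_mono_on ((hu.continuous.pow 2).continuousOn.integrableOn_compact
              (isCompact_closedBall _ _)) ((hI1 _ (isCompact_closedBall _ _)).const_mul _)
              isClosed_closedBall.measurableSet fun x hx => ?_
            rw [sq]
            refine mul_le_mul_of_nonneg_right ?_ (hu0 x)
            rw [le_div_iff₀ (by positivity), mul_comm]
            refine le_trans (mul_le_mul_of_nonneg_right (pow_le_pow_left₀ (by positivity) ?_ n)
              (hu0 x)) (hmax' x (hsubset hx))
            have := dist_triangle x y x₁
            rw [mem_closedBall] at hx
            linarith
        _ = k / (d / 2) ^ n * ∫ x in closedBall y (d / 2), u x := integral_const_mul _ _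
        _ ≤ k / (d / 2) ^ n * J := by
            refine mul_le_mul_of_nonneg_left ?_ (by positivity)
            exact setIntegral_mono_set (hI1 _ (isCompact_closedBall _ _))
              (Eventually.of_forall hu0) hsubset.eventuallyLE
    have h2 : k ^ 2 ≤ C * 4 ^ n * J * k := by
      calc k ^ 2 = (d ^ n) ^ 2 * u y ^ 2 := by rw [hk, mul_pow]
        _ ≤ (d ^ n) ^ 2 * (C / (d / 2) ^ n * (k / (d / 2) ^ n * J)) :=
          mul_le_mul_of_nonneg_left (hsq.trans
            (mul_le_mul_of_nonneg_left hb1 (by positivity))) (by positivity)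
        _ = C * 4 ^ n * J * k := by
          rw [show (4 : ℝ) = 2 * 2 by norm_num, mul_pow, div_pow]
          field_simp
    rw [sq] at h2
    exact le_of_mul_le_mul_right h2 h0
  have h3 := h1.trans hkJ
  rw [div_mul_eq_mul_div, le_div_iff₀ (by positivity), mul_comm]
  exact h3

lemma Elliptic.convex_combination {δ Λ : ℝ} (hδ : 0 < δ) {a : Matrix (Fin n) (Fin n) ℝ}
    (h : IsElliptic n δ Λ a) {t : ℝ} (h0 : 0 ≤ t) (h1 : t ≤ 1) :
    IsElliptic n δ Λ (t • a + (δ * (1 - t)) • (1 : Matrix (Fin n) (Fin n) ℝ)) := by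
  refine ⟨by simp [h.1], fun ξ => ?_, fun i j => ?_⟩
  · have hq : ∑ i, ∑ j, (t • a + (δ * (1 - t)) • (1 : Matrix (Fin n) (Fin n) ℝ)) i j * ξ i * ξ j =
        t * (∑ i, ∑ j, a i j * ξ i * ξ j) + δ * (1 - t) * ∑ i, ξ i ^ 2 := by
      simp only [Matrix.add_apply, Matrix.smul_apply, smul_eq_mul, add_mul, Finset.sum_add_distrib,
        Finset.mul_sum, Matrix.one_apply, mul_ite, ite_mul, mul_one, mul_zero, zero_mul,
        Finset.sum_ite_eq, Finset.mem_univ, if_true]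
      congr 1
      · exact Finset.sum_congr rfl fun i _ => Finset.sum_congr rfl fun j _ => by ring
      · exact Finset.sum_congr rfl fun i _ => by ring
    rw [hq]
    nlinarith [mul_le_mul_of_nonneg_left (h.2.1 ξ) h0]
  · have hδΛ : δ ≤ Λ := (Elliptic.le_diag h i).trans (Elliptic.diag_le h i)
    have hone : |(1 : Matrix (Fin n) (Fin n) ℝ) i j| ≤ 1 := by
      rw [Matrix.one_apply]
      split_ifs <;> simp
    have h2 : 0 ≤ δ * (1 - t) := mul_nonneg hδ.le (by linarith)
    simp only [Matrix.add_apply, Matrix.smul_apply, smul_eq_mul]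
    refine (abs_add_le _ _).trans ?_
    rw [abs_mul, abs_mul, abs_of_nonneg h0, abs_of_nonneg h2]
    nlinarith [mul_le_mul_of_nonneg_left (h.2.2 i j) h0, mul_le_mul_of_nonneg_left hone h2]

/-- The trace of the product of a positive and a negative semidefinite matrix is nonpositive. -/
lemma sum_mul_nonpos {a X : Matrix (Fin n) (Fin n) ℝ} (ha : aᵀ = a)
    (ha0 : ∀ ξ : Fin n → ℝ, 0 ≤ ∑ i, ∑ j, a i j * ξ i * ξ j)
    (hX : ∀ ξ : Fin n → ℝ, ∑ i, ∑ j, X i j * ξ i * ξ j ≤ 0) :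
    ∑ i, ∑ j, a i j * X i j ≤ 0 := by
  have hpos : a.PosSemidef := by
    refine .of_dotProduct_mulVec_nonneg (by simpa [IsHermitian] using ha) fun ξ => ?_
    refine (ha0 ξ).trans (le_of_eq ?_)
    simp only [dotProduct, mulVec, Finset.mul_sum, star_trivial]
    exact Finset.sum_congr rfl fun i _ => Finset.sum_congr rfl fun j _ => by ring
  obtain ⟨m, w, rfl⟩ := Matrix.posSemidef_iff_eq_sum_vecMulVec.1 hpos
  have h : ∑ i, ∑ j, (∑ k, vecMulVec (w k) (star (w k))) i j * X i j =
      ∑ k, ∑ i, ∑ j, X i j * w k i * w k j := by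
    simp only [Matrix.sum_apply, vecMulVec_apply, star_trivial, Finset.sum_mul]
    rw [Finset.sum_comm (s := Finset.univ (α := Fin m))]
    refine Finset.sum_congr rfl fun i _ => ?_
    rw [Finset.sum_comm (s := Finset.univ (α := Fin m))]
    exact Finset.sum_congr rfl fun j _ => Finset.sum_congr rfl fun k _ => by ring
  rw [h]
  exact Finset.sum_nonpos fun k _ => hX (w k)

lemma hessian_nonpos_of_isLocalMax {z : EuclideanSpace ℝ (Fin n) → ℝ}
    {p : EuclideanSpace ℝ (Fin n)} (hz : ContDiffAt ℝ 2 z p) (hmax : IsLocalMax z p)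
    (ξ : Fin n → ℝ) : ∑ i, ∑ j, D2 z p i j * ξ i * ξ j ≤ 0 := by
  set v : EuclideanSpace ℝ (Fin n) := ∑ i, ξ i • EuclideanSpace.single i 1 with hv
  have hd : DifferentiableAt ℝ (fderiv ℝ z) p :=
    (hz.fderiv_right (m := 1) (by norm_num)).differentiableAt (by norm_num)
  have hline : ∀ s : ℝ, HasDerivAt (fun s : ℝ => p + s • v) v s := fun s => by
    simpa using ((hasDerivAt_id s).smul_const v).const_add p
  have hcont : Tendsto (fun s : ℝ => p + s • v) (𝓝 0) (𝓝 p) := by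
    have := (hline 0).continuousAt.tendsto
    simpa using this
  have hquad : ∑ i, ∑ j, D2 z p i j * ξ i * ξ j = fderiv ℝ (fderiv ℝ z) p v v := by
    simp only [hv, map_sum, map_smul, _root_.sum_apply, _root_.smul_apply, smul_eq_mul,
      D2_eq_fderiv_fderiv hz, Finset.mul_sum]
    rw [Finset.sum_comm]
    exact Finset.sum_congr rfl fun i _ => Finset.sum_congr rfl fun j _ => by ring
  rw [hquad]
  have hq1 : ∀ᶠ s in 𝓝 (0 : ℝ), HasDerivAt (fun s => z (p + s • v))
      (fderiv ℝ z (p + s • v) v) s := by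
    have h1 : ∀ᶠ y in 𝓝 p, DifferentiableAt ℝ z y := by
      filter_upwards [hz.eventually (by simp)] with y hy
      exact hy.differentiableAt (by norm_num)
    filter_upwards [hcont.eventually h1] with s hs
    exact hs.hasFDerivAt.comp_hasDerivAt s (hline s)
  have hq2 : HasDerivAt (fun s => fderiv ℝ z (p + s • v) v) (fderiv ℝ (fderiv ℝ z) p v v) (0 : ℝ) := by
    have h1 : HasFDerivAt (fderiv ℝ z) (fderiv ℝ (fderiv ℝ z) p) (p + (0 : ℝ) • v) := by
      simpa using hd.hasFDerivAt
    have h2 := h1.comp_hasDerivAt (0 : ℝ) (hline 0)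
    exact ((ContinuousLinearMap.apply ℝ ℝ v).hasFDerivAt.comp_hasDerivAt (0 : ℝ) h2)
  have hderiv : deriv (fun s : ℝ => z (p + s • v)) =ᶠ[𝓝 0] fun s => fderiv ℝ z (p + s • v) v :=
    hq1.mono fun s hs => hs.deriv
  have hmax' : IsLocalMax (fun s : ℝ => z (p + s • v)) 0 := by
    have := hcont.eventually hmax
    simpa [IsLocalMax, IsMaxFilter] using this
  by_contra! hpos
  have hdd : deriv (deriv fun s : ℝ => z (p + s • v)) 0 = fderiv ℝ (fderiv ℝ z) p v v := by
    rw [hderiv.deriv_eq, hq2.deriv]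
  have hmin := isLocalMin_of_deriv_deriv_pos (hdd ▸ hpos) hmax'.deriv_eq_zero
    hq1.self_of_nhds.continuousAt
  have hconst : (fun s : ℝ => z (p + s • v)) =ᶠ[𝓝 0] fun _ => z (p + (0 : ℝ) • v) := by
    filter_upwards [hmax', hmin] with s h1 h2
    exact le_antisymm h1 h2
  have h0 : deriv (deriv fun s : ℝ => z (p + s • v)) 0 = 0 := by
    rw [hconst.deriv.deriv_eq]
    simp
  rw [hdd] at h0
  exact hpos.ne' h0

lemma continuousAt_D2 {z : EuclideanSpace ℝ (Fin n) → ℝ} {p : EuclideanSpace ℝ (Fin n)}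
    (hz : ContDiffAt ℝ 2 z p) (i j : Fin n) : ContinuousAt (fun x => D2 z x i j) p := by
  have h : (fun x => D2 z x i j) =ᶠ[𝓝 p] fun x => fderiv ℝ (fderiv ℝ z) x
      (EuclideanSpace.single i 1) (EuclideanSpace.single j 1) := by
    filter_upwards [hz.eventually (by simp)] with y hy
    exact D2_eq_fderiv_fderiv hy i j
  refine ContinuousAt.congr ?_ h.symm
  have h2 : ContinuousAt (fderiv ℝ (fderiv ℝ z)) p :=
    ((hz.fderiv_right (m := 1) (by norm_num)).fderiv_right (m := 0) (by norm_num)).continuousAt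
  exact (h2.clm_apply continuousAt_const).clm_apply continuousAt_const

/-- A strict subsolution almost everywhere has no interior local maximum. -/
lemma not_isLocalMax_of_lt_sum {δ Λ c : ℝ} (hδ : 0 < δ) (hc : 0 < c)
    {z : EuclideanSpace ℝ (Fin n) → ℝ}
    {p : EuclideanSpace ℝ (Fin n)} (hz : ContDiffAt ℝ 2 z p)
    {A : EuclideanSpace ℝ (Fin n) → Matrix (Fin n) (Fin n) ℝ} (hA : ∀ x, IsElliptic n δ Λ (A x))
    {U : Set (EuclideanSpace ℝ (Fin n))} (hU : U ∈ 𝓝 p)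
    (h : ∀ᵐ x, x ∈ U → c ≤ ∑ i, ∑ j, A x i j * D2 z x i j) : ¬IsLocalMax z p := by
  intro hmax
  have h1 : ∀ x, ∑ i, ∑ j, A x i j * D2 z p i j ≤ 0 := fun x =>
    sum_mul_nonpos (X := D2 z p) (hA x).1
      (fun ξ => (mul_nonneg hδ.le (Finset.sum_nonneg fun _ _ => sq_nonneg _)).trans ((hA x).2.1 ξ))
      (hessian_nonpos_of_isLocalMax hz hmax)
  have h2 : Tendsto (fun x => ∑ i, ∑ j, Λ * |D2 z x i j - D2 z p i j|) (𝓝 p) (𝓝 0) := by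
    have : Tendsto (fun x => ∑ i, ∑ j, Λ * |D2 z x i j - D2 z p i j|) (𝓝 p)
        (𝓝 (∑ i, ∑ j, Λ * |D2 z p i j - D2 z p i j|)) :=
      tendsto_finsetSum _ fun i _ => tendsto_finsetSum _ fun j _ =>
        (((continuousAt_D2 hz i j).tendsto.sub_const _).abs.const_mul Λ)
    simpa using this
  have h3 := inter_mem hU (h2.eventually (gt_mem_nhds hc))
  have h4 : ∃ x, x ∈ U ∩ {x | ∑ i, ∑ j, Λ * |D2 z x i j - D2 z p i j| < c} ∧
      (x ∈ U → c ≤ ∑ i, ∑ j, A x i j * D2 z x i j) := by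
    by_contra! hcon
    have : volume (U ∩ {x | ∑ i, ∑ j, Λ * |D2 z x i j - D2 z p i j| < c}) = 0 := by
      refine measure_mono_null (fun x hx => ?_) (ae_iff.1 h)
      rw [mem_ofPred_eq]
      intro hx'
      obtain ⟨ha, hb⟩ := hcon x hx
      exact absurd (hx' ha) (not_le.2 hb)
    exact (Measure.measure_pos_of_mem_nhds volume h3).ne' this
  obtain ⟨x, ⟨hxU, hx1⟩, hx2⟩ := h4
  have h5 : ∑ i, ∑ j, A x i j * D2 z x i j ≤ ∑ i, ∑ j, A x i j * D2 z p i j +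
      ∑ i, ∑ j, Λ * |D2 z x i j - D2 z p i j| := by
    simp only [← Finset.sum_add_distrib]
    refine Finset.sum_le_sum fun i _ => Finset.sum_le_sum fun j _ => ?_
    have h6 : A x i j * (D2 z x i j - D2 z p i j) ≤ Λ * |D2 z x i j - D2 z p i j| :=
      (le_abs_self _).trans (by
        rw [abs_mul]
        exact mul_le_mul_of_nonneg_right ((hA x).2.2 i j) (abs_nonneg _))
    linarith
  rw [mem_ofPred_eq] at hx1
  linarith [h1 x, hx2 hxU]

lemma differentiableAt_pd {u : EuclideanSpace ℝ (Fin n) → ℝ} {x : EuclideanSpace ℝ (Fin n)}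
    (hu : ContDiffAt ℝ 2 u x) (j : Fin n) : DifferentiableAt ℝ (pd j u) x :=
  ((hu.fderiv_right (m := 1) (by norm_num)).differentiableAt (by norm_num)).clm_apply
    (differentiableAt_const _)

lemma D2_add_const_mul {u w : EuclideanSpace ℝ (Fin n) → ℝ} {x : EuclideanSpace ℝ (Fin n)}
    (hu : ContDiffAt ℝ 2 u x) (hw : ContDiffAt ℝ 2 w x) (c : ℝ) (i j : Fin n) :
    D2 (fun y => u y + c * w y) x i j = D2 u x i j + c * D2 w x i j := by
  have hev : pd j (fun y => u y + c * w y) =ᶠ[𝓝 x] fun y => pd j u y + c * pd j w y := by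
    filter_upwards [hu.eventually (by simp), hw.eventually (by simp)] with y h1 h2
    have h3 := h1.differentiableAt (by norm_num)
    have h4 := h2.differentiableAt (by norm_num)
    rw [pd, fderiv_fun_add h3 (h4.const_mul c), fderiv_const_mul h4]
    rfl
  have h1 := differentiableAt_pd hu j
  have h2 := differentiableAt_pd hw j
  rw [D2_eq_pd, pd, hev.fderiv_eq, fderiv_fun_add h1 (h2.const_mul c), fderiv_const_mul h2]
  rfl

lemma D2_norm_sq (x : EuclideanSpace ℝ (Fin n)) (i j : Fin n) :
    D2 (fun y => ‖y‖ ^ 2) x i j = 2 * (1 : Matrix (Fin n) (Fin n) ℝ) i j := by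
  have h1 : pd j (fun y : EuclideanSpace ℝ (Fin n) => ‖y‖ ^ 2) = fun y => 2 * y j := by
    ext y
    rw [pd, (hasStrictFDerivAt_norm_sq y).hasFDerivAt.fderiv]
    simp [EuclideanSpace.inner_single_right]
  rw [D2_eq_pd, h1, pd]
  have h2 : HasFDerivAt (fun y : EuclideanSpace ℝ (Fin n) => 2 * y j)
      ((2 : ℝ) • (EuclideanSpace.proj j : EuclideanSpace ℝ (Fin n) →L[ℝ] ℝ)) x :=
    (EuclideanSpace.proj j : EuclideanSpace ℝ (Fin n) →L[ℝ] ℝ).hasFDerivAt.const_mul 2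
  rw [h2.fderiv]
  simp [Matrix.one_apply, eq_comm]

lemma le_barrier (hn : 2 ≤ n) {δ Λ ρ m : ℝ} (hδ : 0 < δ) (hρ0 : 0 ≤ ρ) (hρ : ρ < 1) (hm : 0 < m)
    {v : EuclideanSpace ℝ (Fin n) → ℝ} (hv : ContDiffOn ℝ 2 v (closedBall 0 1))
    (hv0 : ∀ x ∈ sphere (0 : EuclideanSpace ℝ (Fin n)) 1, v x = 0)
    {A : EuclideanSpace ℝ (Fin n) → Matrix (Fin n) (Fin n) ℝ} (hA : ∀ x, IsElliptic n δ Λ (A x))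
    (h : ∀ᵐ x, x ∈ ball (0 : EuclideanSpace ℝ (Fin n)) 1 → ρ < ‖x‖ →
      0 ≤ ∑ i, ∑ j, A x i j * D2 v x i j)
    (hm1 : ∀ x, ‖x‖ = ρ → v x ≤ m) {x : EuclideanSpace ℝ (Fin n)} (hx : ρ ≤ ‖x‖) (hx1 : ‖x‖ ≤ 1) :
    v x ≤ m * ((1 - ‖x‖ ^ 2) / (1 - ρ ^ 2)) := by
  have hρ2 : 0 < 1 - ρ ^ 2 := by nlinarith
  set c : ℝ := m / (1 - ρ ^ 2) with hc
  have hc0 : 0 < c := by positivity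
  set z : EuclideanSpace ℝ (Fin n) → ℝ := fun y => v y + c * ‖y‖ ^ 2 with hz
  set S : Set (EuclideanSpace ℝ (Fin n)) := closedBall 0 1 ∩ {y | ρ ≤ ‖y‖} with hS
  have hScomp : IsCompact S :=
    (isCompact_closedBall _ _).inter_right (isClosed_le continuous_const continuous_norm)
  have hzc : ContinuousOn z S :=
    (hv.continuousOn.mono inter_subset_left).add (by fun_prop)
  have hxS : x ∈ S := ⟨by simpa using hx1, hx⟩
  obtain ⟨p, hpS, hp⟩ := hScomp.exists_isMaxOn ⟨x, hxS⟩ hzc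
  have hzp : z p ≤ c := by
    have hp1 : ‖p‖ ≤ 1 := by simpa using hpS.1
    have hp2 : ρ ≤ ‖p‖ := hpS.2
    rcases hp1.eq_or_lt with h1 | h1
    · simp [hz, hv0 p (by simpa using h1), h1]
    rcases hp2.eq_or_lt with h2 | h2
    · have h3 := hm1 p h2.symm
      have h4 : c * (1 - ρ ^ 2) = m := div_mul_cancel₀ _ hρ2.ne'
      simp only [hz, ← h2]
      linarith
    · exfalso
      have hball : ball (0 : EuclideanSpace ℝ (Fin n)) 1 ∩ {y | ρ < ‖y‖} ∈ 𝓝 p :=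
        (isOpen_ball.inter (isOpen_lt continuous_const continuous_norm)).mem_nhds
          ⟨by simpa using h1, h2⟩
      have hCD : ∀ y ∈ ball (0 : EuclideanSpace ℝ (Fin n)) 1, ContDiffAt ℝ 2 v y := fun y hy =>
        hv.contDiffAt (mem_of_superset (isOpen_ball.mem_nhds hy) ball_subset_closedBall)
      have hq : ContDiff ℝ 2 fun y : EuclideanSpace ℝ (Fin n) => ‖y‖ ^ 2 := contDiff_norm_sq ℝ
      refine not_isLocalMax_of_lt_sum (z := z) (c := c * (2 * (n * δ))) hδ (by positivity)
        ((hCD p (by simpa using h1)).add (contDiff_const.mul hq).contDiffAt) hA hball ?_ ?_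
      · filter_upwards [h] with y hy hyU
        have h5 := hy hyU.1 hyU.2
        have h6 : ∑ i, ∑ j, A y i j * D2 z y i j =
            ∑ i, ∑ j, A y i j * D2 v y i j + c * (2 * ∑ i, A y i i) := by
          simp only [hz, D2_add_const_mul (hCD y hyU.1) hq.contDiffAt, D2_norm_sq, mul_add,
            Finset.sum_add_distrib, Matrix.one_apply, mul_ite, mul_one, mul_zero,
            Finset.sum_ite_eq, Finset.mem_univ, if_true, Finset.mul_sum]
          congr 1
          exact Finset.sum_congr rfl fun i _ => by ring
        have h7 : n * δ ≤ ∑ i, A y i i := by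
          have := Finset.sum_le_sum fun i (_ : i ∈ Finset.univ) => Elliptic.le_diag (hA y) i
          simpa using this
        rw [h6]
        have h8 := mul_le_mul_of_nonneg_left h7 hc0.le
        linarith
      · filter_upwards [hball] with y hy
        exact hp ⟨ball_subset_closedBall hy.1, (show ρ < ‖y‖ from hy.2).le⟩
  have h1 : z x ≤ c := (hp hxS).trans hzp
  have h2 : m * ((1 - ‖x‖ ^ 2) / (1 - ρ ^ 2)) = c * (1 - ‖x‖ ^ 2) := by rw [hc]; ring
  rw [h2]
  simp only [hz] at h1
  linarith

/-- Decay towards the outer boundary for solutions in an annulus. -/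
lemma abs_le_barrier (hn : 2 ≤ n) {δ Λ ρ m : ℝ} (hδ : 0 < δ) (hρ0 : 0 ≤ ρ) (hρ : ρ < 1)
    (hm : 0 < m)
    {v : EuclideanSpace ℝ (Fin n) → ℝ} (hv : ContDiffOn ℝ 2 v (closedBall 0 1))
    (hv0 : ∀ x ∈ sphere (0 : EuclideanSpace ℝ (Fin n)) 1, v x = 0)
    {A : EuclideanSpace ℝ (Fin n) → Matrix (Fin n) (Fin n) ℝ} (hA : ∀ x, IsElliptic n δ Λ (A x))
    (h : ∀ᵐ x, x ∈ ball (0 : EuclideanSpace ℝ (Fin n)) 1 → ρ < ‖x‖ →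
      ∑ i, ∑ j, A x i j * D2 v x i j = 0)
    (hm1 : ∀ x, ‖x‖ = ρ → |v x| ≤ m) {x : EuclideanSpace ℝ (Fin n)} (hx : ρ ≤ ‖x‖)
    (hx1 : ‖x‖ ≤ 1) : |v x| ≤ m * ((1 - ‖x‖ ^ 2) / (1 - ρ ^ 2)) := by
  have hD2 : ∀ y i j, D2 (fun y => -v y) y i j = -D2 v y i j := fun y i j => by
    simp [D2, fderiv_fun_neg]
  refine abs_le'.2 ⟨le_barrier hn hδ hρ0 hρ hm hv hv0 hA ?_ (fun y hy => (le_abs_self _).trans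
    (hm1 y hy)) hx hx1, le_barrier (v := fun y => -v y) hn hδ hρ0 hρ hm hv.neg
      (fun y hy => by simp [hv0 y hy]) hA ?_
      (fun y hy => (neg_le_abs _).trans (hm1 y hy)) hx hx1⟩
  · filter_upwards [h] with y hy h1 h2
    rw [hy h1 h2]
  · filter_upwards [h] with y hy h1 h2
    simp [hD2, hy h1 h2]

/-- A convex `C²` function with derivative in `[0, 1]` vanishing on the negative half-line. -/
noncomputable def softPos (s : ℝ) : ℝ := ∫ y in (0 : ℝ)..s, Real.smoothTransition y

lemma hasDerivAt_softPos (s : ℝ) : HasDerivAt softPos (Real.smoothTransition s) s :=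
  intervalIntegral.integral_hasDerivAt_right
    (Real.smoothTransition.continuous.intervalIntegrable _ _)
    (Real.smoothTransition.continuous.stronglyMeasurableAtFilter _ _)
    Real.smoothTransition.continuous.continuousAt

lemma contDiff_softPos : ContDiff ℝ 2 softPos := by
  have h : deriv softPos = Real.smoothTransition := funext fun s => (hasDerivAt_softPos s).deriv
  rw [show (2 : WithTop ℕ∞) = 1 + 1 by norm_num, contDiff_succ_iff_deriv]
  exact ⟨fun s => (hasDerivAt_softPos s).differentiableAt, by simp,
    h ▸ Real.smoothTransition.contDiff (n := 1)⟩

lemma monotone_softPos : Monotone softPos :=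
  monotone_of_deriv_nonneg (fun s => (hasDerivAt_softPos s).differentiableAt) fun s => by
    rw [(hasDerivAt_softPos s).deriv]
    exact Real.smoothTransition.nonneg s

lemma softPos_of_nonpos {s : ℝ} (hs : s ≤ 0) : softPos s = 0 := by
  rw [softPos, intervalIntegral.integral_congr (g := fun _ => 0) fun y hy => ?_]
  · simp
  · rw [uIcc_of_ge hs] at hy
    exact Real.smoothTransition.zero_of_nonpos hy.2

lemma softPos_nonneg (s : ℝ) : 0 ≤ softPos s := by
  rcases le_total s 0 with h | h
  · rw [softPos_of_nonpos h]
  · exact (softPos_of_nonpos le_rfl).symm.le.trans (monotone_softPos h)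

lemma one_le_softPos_two : 1 ≤ softPos 2 := by
  have h : softPos 2 = softPos 1 + ∫ y in (1 : ℝ)..2, Real.smoothTransition y :=
    (intervalIntegral.integral_add_adjacent_intervals
      (Real.smoothTransition.continuous.intervalIntegrable _ _)
      (Real.smoothTransition.continuous.intervalIntegrable _ _)).symm
  rw [h, intervalIntegral.integral_congr (g := fun _ => 1) fun y hy => ?_]
  · have := softPos_nonneg 1
    norm_num
    linarith
  · rw [uIcc_of_le (by norm_num)] at hy
    exact Real.smoothTransition.one_of_one_le hy.1

/-- A convex regularization of `s ↦ (|s| - m)₊`. -/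
lemma exists_convex_truncation (m : ℝ) {σ : ℝ} (hσ : 0 < σ) :
    ∃ Φ Φ₁ Φ₂ : ℝ → ℝ, ContDiff ℝ 2 Φ ∧ (∀ s, HasDerivAt Φ (Φ₁ s) s) ∧
      (∀ s, HasDerivAt Φ₁ (Φ₂ s) s) ∧ (∀ s, |Φ₁ s| ≤ 1) ∧ (∀ s, 0 ≤ Φ₂ s) ∧ (∀ s, 0 ≤ Φ s) ∧
      (∀ s, |s| ≤ m → Φ s = 0) ∧ ∀ s, |s| = m + 2 * σ → σ ≤ Φ s := by
  have ha : ∀ s : ℝ, HasDerivAt (fun s : ℝ => (s - m) / σ) (1 / σ) s := fun s =>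
    ((hasDerivAt_id s).sub_const m).div_const σ
  have hb : ∀ s : ℝ, HasDerivAt (fun s : ℝ => (-s - m) / σ) (-1 / σ) s := fun s =>
    ((hasDerivAt_id s).neg.sub_const m).div_const σ
  have hT : ∀ s, HasDerivAt Real.smoothTransition (deriv Real.smoothTransition s) s := fun s =>
    ((Real.smoothTransition.contDiff (n := 1)).differentiable (by norm_num) s).hasDerivAt
  refine ⟨fun s => σ * (softPos ((s - m) / σ) + softPos ((-s - m) / σ)),
    fun s => Real.smoothTransition ((s - m) / σ) - Real.smoothTransition ((-s - m) / σ),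
    fun s => (deriv Real.smoothTransition ((s - m) / σ) +
      deriv Real.smoothTransition ((-s - m) / σ)) / σ, ?_, fun s => ?_, fun s => ?_, fun s => ?_,
    fun s => ?_, fun s => ?_, fun s hs => ?_, fun s hs => ?_⟩
  · exact contDiff_const.mul ((contDiff_softPos.comp (by fun_prop)).add
      (contDiff_softPos.comp (by fun_prop)))
  · refine ((((hasDerivAt_softPos _).comp s (ha s)).add
      ((hasDerivAt_softPos _).comp s (hb s))).const_mul σ).congr_deriv ?_
    field_simp
    ring
  · refine (((hT _).comp s (ha s)).sub ((hT _).comp s (hb s))).congr_deriv ?_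
    field_simp
    ring
  · refine abs_sub_le_iff.2 ⟨?_, ?_⟩ <;>
      linarith [Real.smoothTransition.nonneg ((s - m) / σ),
        Real.smoothTransition.le_one ((s - m) / σ),
        Real.smoothTransition.nonneg ((-s - m) / σ), Real.smoothTransition.le_one ((-s - m) / σ)]
  · exact div_nonneg (add_nonneg Real.smoothTransition.monotone.deriv_nonneg
      Real.smoothTransition.monotone.deriv_nonneg) hσ.le
  · exact mul_nonneg hσ.le (add_nonneg (softPos_nonneg _) (softPos_nonneg _))
  · have h := _root_.abs_le.1 hs
    dsimp only
    rw [softPos_of_nonpos (div_nonpos_of_nonpos_of_nonneg (by linarith) hσ.le),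
      softPos_of_nonpos (div_nonpos_of_nonpos_of_nonneg (by linarith) hσ.le)]
    simp
  · have h : 1 ≤ softPos ((s - m) / σ) + softPos ((-s - m) / σ) := by
      rcases le_total 0 s with h0 | h0
      · rw [abs_of_nonneg h0] at hs
        have h2 : (s - m) / σ = 2 := by rw [hs]; field_simp; ring
        rw [h2]
        linarith [one_le_softPos_two, softPos_nonneg ((-s - m) / σ)]
      · rw [abs_of_nonpos h0] at hs
        have h2 : (-s - m) / σ = 2 := by rw [hs]; field_simp; ring
        rw [h2]
        linarith [one_le_softPos_two, softPos_nonneg ((s - m) / σ)]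
    calc σ = σ * 1 := (mul_one σ).symm
      _ ≤ _ := mul_le_mul_of_nonneg_left h hσ.le

/-- The maximum on an intermediate sphere is controlled by the outer values and the mass of the
right-hand side. -/
lemma exists_abs_le_add_integral (hn : 2 ≤ n) (lam K : ℝ) (hlam : 0 < lam) (hK : 0 < K) :
    ∃ C : ℝ, 0 < C ∧ ∀ (b : ℝ → Matrix (Fin n) (Fin n) ℝ) (ℓ : Fin n), IsNormalized b ℓ lam K →
      ∀ V : EuclideanSpace ℝ (Fin n) → ℝ, ContDiff ℝ 2 V →
      ∀ (m : ℝ) (g : EuclideanSpace ℝ (Fin n) → ℝ), 0 ≤ m → (∀ x, 0 ≤ g x) → Integrable g →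
        (∀ x, 0.5 < ‖x‖ → g x = 0) → (∀ x, 0.6 ≤ ‖x‖ → |V x| ≤ m) →
        (∀ᵐ x, x ∈ closedBall (0 : EuclideanSpace ℝ (Fin n)) 0.6 → |ellOp b ℓ V x| ≤ g x) →
      ∀ x₁, ‖x₁‖ = 0.55 → |V x₁| ≤ m + C * ∫ x, g x := by
  obtain ⟨C, hC, hCb⟩ := exists_le_integral_of_nonneg hn lam K hlam hK
  refine ⟨2 * (C / 0.04 ^ n), by positivity, fun b ℓ hb V hV m g hm hg hgi hg0 hVm hVg x₁ hx₁ => ?_⟩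
  have hgint : 0 ≤ ∫ x, g x := integral_nonneg hg
  rcases le_or_gt |V x₁| m with hle | hlt
  · have : 0 ≤ 2 * (C / 0.04 ^ n) * ∫ x, g x := by positivity
    linarith
  obtain ⟨Φ, Φ₁, Φ₂, hΦ, hd, hd₁, h1, h2, h0, hz, hσ⟩ := exists_convex_truncation m
    (σ := (|V x₁| - m) / 2) (by linarith)
  set u : EuclideanSpace ℝ (Fin n) → ℝ := fun x => Φ (V x) with hu
  have hu2 : ContDiff ℝ 2 u := hΦ.comp hV
  have hsupp : tsupport u ⊆ closedBall 0 0.6 := by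
    refine closure_minimal (fun x hx => ?_) isClosed_closedBall
    by_contra hx'
    refine hx (hz _ (hVm x ?_))
    simp only [mem_closedBall, dist_zero_right, not_le] at hx'
    exact hx'.le
  have hsub : ∀ᵐ x, -g x ≤ ellOp b ℓ u x := by
    filter_upwards [hVg] with x hx
    by_cases hxb : x ∈ closedBall (0 : EuclideanSpace ℝ (Fin n)) 0.6
    · rw [hu, ellOp_comp b ℓ (Eventually.of_forall hd) (hd₁ _) hV]
      have h3 := mul_nonneg (h2 (V x)) (hb.quadForm_nonneg hlam.le (x ℓ) fun i => pd i V x)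
      have h4 : |Φ₁ (V x) * ellOp b ℓ V x| ≤ g x := by
        rw [abs_mul]
        exact (mul_le_of_le_one_left (abs_nonneg _) (h1 _)).trans (hx hxb)
      linarith [neg_abs_le (Φ₁ (V x) * ellOp b ℓ V x)]
    · rw [IsNormalized.ellOp_eq_zero_of_notMem fun h => hxb (hsupp h)]
      linarith [hg x]
  have hmass := hb.integral_le_of_neg_le_ellOp hu2
    (hsupp.trans (closedBall_subset_closedBall (by norm_num))) hg hgi hsub
  have hloc := hCb b ℓ hb u hu2 (fun x => h0 _) x₁ 0.04 (by norm_num) (by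
    filter_upwards [hsub] with x hx hxb
    have h3 : 0.5 < ‖x‖ := by
      have h4 : ‖x₁‖ ≤ ‖x‖ + ‖x - x₁‖ := by
        have := norm_sub_le x (x - x₁)
        simpa using this
      rw [mem_closedBall, dist_eq_norm] at hxb
      rw [hx₁] at h4
      norm_num at h4 hxb ⊢
      linarith
    simpa [hg0 x h3] using hx)
  have hui : Integrable u := hu2.continuous.integrable_of_hasCompactSupport
    ((isCompact_closedBall _ _).of_isClosed_subset (isClosed_tsupport _) hsupp)
  have h3 : ∫ x in closedBall x₁ 0.04, u x ≤ ∫ x, g x :=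
    (setIntegral_le_integral hui (Eventually.of_forall fun x => h0 _)).trans hmass
  have h4 := hσ (V x₁) (by ring)
  have h5 := mul_le_mul_of_nonneg_left h3 (by positivity : 0 ≤ C / 0.04 ^ n)
  have h6 : (|V x₁| - m) / 2 ≤ C / 0.04 ^ n * ∫ x, g x := h4.trans (hloc.trans h5)
  linarith

lemma D2_congr {u w : EuclideanSpace ℝ (Fin n) → ℝ} {x : EuclideanSpace ℝ (Fin n)}
    (h : u =ᶠ[𝓝 x] w) (i j : Fin n) : D2 u x i j = D2 w x i j := by
  have h1 : pd j u =ᶠ[𝓝 x] pd j w := by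
    filter_upwards [h.fderiv (𝕜 := ℝ)] with y hy
    rw [pd, pd, hy]
  rw [D2_eq_pd, D2_eq_pd, pd, pd, h1.fderiv_eq]

lemma isNormalized_normalize {abar : ℝ → Matrix (Fin n) (Fin n) ℝ} {δ Λ : ℝ} (hδ : 0 < δ)
    (ham : ∀ i j, Measurable fun s => abar s i j) (ha : ∀ s, IsElliptic n δ Λ (abar s))
    (ℓ : Fin n) : IsNormalized (fun s => normalize ℓ (abar s)) ℓ (δ / Λ) (3 * (Λ / δ)) where
  measurable := measurable_normalize ham ℓ
  abs_le s := abs_normalize_le hδ (ha s) ℓ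
  row s := normalize_row hδ (ha s) ℓ
  coercive s := coercive_normalize hδ (ha s) ℓ

lemma ellOp_normalize (abar : ℝ → Matrix (Fin n) (Fin n) ℝ) (ℓ : Fin n)
    {u : EuclideanSpace ℝ (Fin n) → ℝ} (hu : ContDiff ℝ 2 u) (x : EuclideanSpace ℝ (Fin n)) :
    ellOp (fun s => normalize ℓ (abar s)) ℓ u x = ellOp abar ℓ u x / abar (x ℓ) ℓ ℓ :=
  sum_normalize_mul ℓ _ fun i j => D2_comm hu.contDiffAt i j

lemma exists_contDiff_extension {v : EuclideanSpace ℝ (Fin n) → ℝ}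
    (hv : ContDiffOn ℝ 2 v (closedBall 0 1)) :
    ∃ V : EuclideanSpace ℝ (Fin n) → ℝ, ContDiff ℝ 2 V ∧ HasCompactSupport V ∧
      (∀ x, ‖x‖ < 0.7 → V =ᶠ[𝓝 x] v) ∧ (∀ x, |V x| ≤ |v x|) ∧ ∀ x, 1 ≤ ‖x‖ → V x = 0 := by
  obtain ⟨M, -, hM⟩ := exists_cutoff n
  obtain ⟨χ, hχ, hχ01, hχ1, hχs, -⟩ := hM 0 0.7 0.9 (by norm_num) (by norm_num)
  have hχc : HasCompactSupport χ :=
    (isCompact_closedBall _ _).of_isClosed_subset (isClosed_tsupport _) hχs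
  refine ⟨fun x => χ x * v x, contDiff_iff_contDiffAt.2 fun x => ?_, hχc.mul_right, fun x hx => ?_,
    fun x => ?_, fun x hx => ?_⟩
  · by_cases hx : x ∈ ball (0 : EuclideanSpace ℝ (Fin n)) 1
    · exact hχ.contDiffAt.mul
        (hv.contDiffAt (mem_of_superset (isOpen_ball.mem_nhds hx) ball_subset_closedBall))
    · have hxs : x ∉ tsupport χ := fun h => hx <| by
        have := hχs h
        rw [mem_closedBall] at this
        rw [mem_ball]
        exact this.trans_lt (by norm_num)
      have h0 : (fun y => χ y * v y) =ᶠ[𝓝 x] fun _ => 0 := by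
        filter_upwards [notMem_tsupport_iff_eventuallyEq.1 hxs] with y hy
        simp [hy]
      exact contDiffAt_const.congr_of_eventuallyEq h0
  · filter_upwards [isOpen_ball.mem_nhds (mem_ball_zero_iff.2 hx)] with y hy
    rw [hχ1 y (ball_subset_closedBall hy), one_mul]
  · rw [abs_mul, abs_of_nonneg (hχ01 x).1]
    exact mul_le_of_le_one_left (abs_nonneg _) (hχ01 x).2
  · have hxs : x ∉ tsupport χ := fun h => by
      have := hχs h
      rw [mem_closedBall, dist_zero_right] at this
      norm_num at this
      linarith
    simp [image_eq_zero_of_notMem_tsupport hxs]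

/-- A solution of the Dirichlet problem for the modified operator in the unit ball with
right-hand side `f` supported in the ball of radius `1/2`. -/
structure IsUnitSolution (δ Λ : ℝ) (abar : ℝ → Matrix (Fin n) (Fin n) ℝ) (ℓ : Fin n)
    (η f v : EuclideanSpace ℝ (Fin n) → ℝ) : Prop where
  measurable : ∀ i j, Measurable fun s => abar s i j
  elliptic : ∀ s, IsElliptic n δ Λ (abar s)
  cutoff_mem : ∀ x, 0 ≤ η x ∧ η x ≤ 1
  cutoff_eq_one : ∀ x, ‖x‖ < 2 / 3 → η x = 1
  contDiffOn : ContDiffOn ℝ 2 v (closedBall 0 1)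
  boundary : ∀ x, ‖x‖ = 1 → v x = 0
  integrable : Integrable f
  rhs_eq_zero : ∀ x, 1 / 2 ≤ ‖x‖ → f x = 0
  equation : ∀ᵐ x, ‖x‖ < 1 → ∑ i, ∑ j, (η x * abar (x ℓ) i j +
    δ * (1 - η x) * (1 : Matrix (Fin n) (Fin n) ℝ) i j) * D2 v x i j = f x

namespace IsUnitSolution

variable {δ Λ : ℝ} {abar : ℝ → Matrix (Fin n) (Fin n) ℝ} {ℓ : Fin n}
  {η f v : EuclideanSpace ℝ (Fin n) → ℝ}

lemma ellOp_eq (h : IsUnitSolution δ Λ abar ℓ η f v) {V : EuclideanSpace ℝ (Fin n) → ℝ}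
    (hV : ∀ x, ‖x‖ < 0.7 → V =ᶠ[𝓝 x] v) : ∀ᵐ x, ‖x‖ < 2 / 3 → ellOp abar ℓ V x = f x := by
  filter_upwards [h.equation] with x hx hx1
  rw [← hx (hx1.trans (by norm_num)), h.cutoff_eq_one x hx1]
  simp [ellOp, D2_congr (hV x (hx1.trans (by norm_num)))]

lemma ellOp_normalize_abs_le (h : IsUnitSolution δ Λ abar ℓ η f v) (hδ : 0 < δ)
    {V : EuclideanSpace ℝ (Fin n) → ℝ} (hV2 : ContDiff ℝ 2 V)
    (hV : ∀ x, ‖x‖ < 0.7 → V =ᶠ[𝓝 x] v) :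
    ∀ᵐ x, ‖x‖ < 2 / 3 → |ellOp (fun s => normalize ℓ (abar s)) ℓ V x| ≤ |f x| / δ := by
  filter_upwards [h.ellOp_eq hV] with x hx hx1
  have hd := Elliptic.le_diag (h.elliptic (x ℓ)) ℓ
  rw [ellOp_normalize _ _ hV2, hx hx1, abs_div, abs_of_pos (hδ.trans_le hd)]
  exact div_le_div_of_nonneg_left (abs_nonneg _) hδ hd

end IsUnitSolution

/-- Solutions are bounded away from the support of the right-hand side by its `L¹` norm. -/
lemma exists_abs_le_of_isUnitSolution (hn : 2 ≤ n) {δ Λ : ℝ} (hδ : 0 < δ) (hΛ : 0 < Λ) :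
    ∃ C : ℝ, 0 < C ∧ ∀ (abar : ℝ → Matrix (Fin n) (Fin n) ℝ) (ℓ : Fin n)
      (η f v : EuclideanSpace ℝ (Fin n) → ℝ), IsUnitSolution δ Λ abar ℓ η f v →
      ∀ ε : ℝ, 0 < ε → ∃ m : ℝ, 0 < m ∧ m ≤ ε + C * ∫ x, |f x| ∧
        ∀ x, 0.55 ≤ ‖x‖ → ‖x‖ ≤ 1 → |v x| ≤ m := by
  obtain ⟨C, hC, hCb⟩ := exists_abs_le_add_integral hn (δ / Λ) (3 * (Λ / δ)) (by positivity)
    (by positivity)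
  refine ⟨100 * (C / δ), by positivity, fun abar ℓ η f v h ε hε => ?_⟩
  obtain ⟨V, hV2, -, hVv, hVle, hV0⟩ := exists_contDiff_extension h.contDiffOn
  have hne : (sphere (0 : EuclideanSpace ℝ (Fin n)) 0.55).Nonempty :=
    ⟨EuclideanSpace.single ⟨0, by omega⟩ 0.55, by
      rw [mem_sphere, dist_zero_right, PiLp.norm_single, Real.norm_of_nonneg]
      norm_num⟩
  obtain ⟨x₁, hx₁, hmax⟩ := (isCompact_sphere (0 : EuclideanSpace ℝ (Fin n)) 0.55).exists_isMaxOn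
    hne ((h.contDiffOn.continuousOn.abs).mono
      (sphere_subset_closedBall.trans (closedBall_subset_closedBall (by norm_num))))
  rw [mem_sphere, dist_zero_right] at hx₁
  have hI : 0 ≤ ∫ x, |f x| := integral_nonneg fun x => abs_nonneg _
  set m : ℝ := max |v x₁| ε with hm
  have hm0 : 0 < m := lt_max_of_lt_right hε
  have hbar : ∀ x, 0.55 ≤ ‖x‖ → ‖x‖ ≤ 1 → |v x| ≤ m * ((1 - ‖x‖ ^ 2) / (1 - 0.55 ^ 2)) := by
    intro x hx hx1
    refine abs_le_barrier hn hδ (by norm_num) (by norm_num) hm0 h.contDiffOn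
      (fun y hy => h.boundary y (by simpa using hy))
      (fun y => Elliptic.convex_combination hδ (h.elliptic (y ℓ)) (h.cutoff_mem y).1
        (h.cutoff_mem y).2) ?_ (fun y hy => ?_) hx hx1
    · filter_upwards [h.equation] with y hy hy1 hy2
      have h1 := hy (by simpa using hy1)
      rw [h.rhs_eq_zero y (by norm_num at hy2 ⊢; linarith)] at h1
      simpa using h1
    · exact (hmax (show y ∈ sphere _ _ by simpa using hy)).trans (le_max_left _ _)
  have hbar1 : ∀ x, 0.55 ≤ ‖x‖ → ‖x‖ ≤ 1 → |v x| ≤ m := fun x hx hx1 =>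
    (hbar x hx hx1).trans (mul_le_of_le_one_right hm0.le (by
      rw [div_le_one (by norm_num)]
      norm_num at hx ⊢
      nlinarith))
  refine ⟨m, hm0, ?_, hbar1⟩
  have hV6 : ∀ x, 0.6 ≤ ‖x‖ → |V x| ≤ m * 0.95 := fun x hx => by
    rcases le_total ‖x‖ 1 with hx1 | hx1
    · refine (hVle x).trans ((hbar x (le_trans (by norm_num) hx) hx1).trans
        (mul_le_mul_of_nonneg_left ?_ hm0.le))
      rw [div_le_iff₀ (by norm_num)]
      norm_num at hx ⊢
      nlinarith
    · rw [hV0 x hx1, abs_zero]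
      positivity
  have key := hCb _ ℓ (isNormalized_normalize hδ h.measurable h.elliptic ℓ) V hV2 (m * 0.95)
    (fun x => |f x| / δ) (by positivity) (fun x => by positivity) (h.integrable.abs.div_const δ)
    (fun x hx => by
      rw [h.rhs_eq_zero x (by norm_num at hx ⊢; linarith)]
      simp) hV6 (by
      filter_upwards [h.ellOp_normalize_abs_le hδ hV2 hVv] with x hx hx1
      rw [mem_closedBall, dist_zero_right] at hx1
      exact hx (hx1.trans_lt (by norm_num))) x₁ hx₁
  rw [(hVv x₁ (by rw [hx₁]; norm_num)).self_of_nhds, integral_div] at key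
  have hCI : 0 ≤ C / δ * ∫ x, |f x| := by positivity
  have key' : |v x₁| ≤ m * 0.95 + C / δ * ∫ x, |f x| := by
    convert! key using 2
    ring
  rcases max_cases |v x₁| ε with hc | hc
  · rw [← hm] at hc
    norm_num at key' ⊢
    linarith [hc.1]
  · rw [← hm] at hc
    linarith [hc.1]

lemma D2_mul {u w : EuclideanSpace ℝ (Fin n) → ℝ} (hu : ContDiff ℝ 2 u) (hw : ContDiff ℝ 2 w)
    (x : EuclideanSpace ℝ (Fin n)) (i j : Fin n) :
    D2 (fun y => u y * w y) x i j = u x * D2 w x i j + w x * D2 u x i j +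
      (pd i u x * pd j w x + pd j u x * pd i w x) := by
  have hdu := hu.differentiable (by norm_num)
  have hdw := hw.differentiable (by norm_num)
  have h1 : pd j (fun y => u y * w y) = fun y => u y * pd j w y + w y * pd j u y :=
    funext fun y => pd_mul (hdu y) (hdw y) j
  have h2 := differentiableAt_pd hw.contDiffAt (x := x) j
  have h3 := differentiableAt_pd hu.contDiffAt (x := x) j
  have h4 := pd_mul (hdu x) h2 i
  have h5 := pd_mul (hdw x) h3 i
  rw [pd] at h4 h5
  rw [D2_eq_pd, h1, pd, fderiv_fun_add ((hdu x).fun_mul h2) ((hdw x).fun_mul h3),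
    _root_.add_apply, h4, h5, ← D2_eq_pd, ← D2_eq_pd]
  ring

/-- The commutator of the operator with multiplication by a cutoff function. -/
lemma abs_ellOp_mul_sub_le {a : ℝ → Matrix (Fin n) (Fin n) ℝ} {Λ : ℝ}
    (ha : ∀ s i j, |a s i j| ≤ Λ) (ℓ : Fin n) {ζ u : EuclideanSpace ℝ (Fin n) → ℝ}
    (hζ : ContDiff ℝ 2 ζ) (hu : ContDiff ℝ 2 u) {x : EuclideanSpace ℝ (Fin n)} {L m : ℝ}
    (hΛ : 0 ≤ Λ) (hL : ∀ i j, |D2 ζ x i j| ≤ L) (hm : 0 < m) (hux : |u x| ≤ m) :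
    |ellOp a ℓ (fun y => ζ y * u y) x - ζ x * ellOp a ℓ u x| ≤
      n ^ 2 * (Λ * (m * L)) + Λ * n * (m * gradSq ζ x + gradSq u x / m) := by
  have h1 : ellOp a ℓ (fun y => ζ y * u y) x - ζ x * ellOp a ℓ u x =
      ∑ i, ∑ j, a (x ℓ) i j * (u x * D2 ζ x i j +
        (pd i ζ x * pd j u x + pd j ζ x * pd i u x)) := by
    simp only [ellOp, D2_mul hζ hu, Finset.mul_sum, ← Finset.sum_sub_distrib]
    exact Finset.sum_congr rfl fun i _ => Finset.sum_congr rfl fun j _ => by ring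
  have hyoung : ∀ p q : ℝ, |p * q| ≤ (m * p ^ 2 + q ^ 2 / m) / 2 := fun p q => by
    have h2 : m * p ^ 2 + q ^ 2 / m - 2 * |p * q| = (m * |p| - |q|) ^ 2 / m := by
      rw [abs_mul, ← sq_abs p, ← sq_abs q]
      field_simp
      ring
    have h3 : 0 ≤ (m * |p| - |q|) ^ 2 / m := by positivity
    linarith
  have hterm : ∀ i j, |a (x ℓ) i j * (u x * D2 ζ x i j +
      (pd i ζ x * pd j u x + pd j ζ x * pd i u x))| ≤ Λ * (m * L) +
        Λ * ((m * pd i ζ x ^ 2 + pd j u x ^ 2 / m) / 2 +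
          (m * pd j ζ x ^ 2 + pd i u x ^ 2 / m) / 2) := fun i j => by
    rw [abs_mul, ← mul_add]
    refine mul_le_mul (ha _ _ _) ((abs_add_le _ _).trans (add_le_add ?_
      ((abs_add_le _ _).trans (add_le_add (hyoung _ _) (hyoung _ _))))) (abs_nonneg _) hΛ
    rw [abs_mul]
    exact mul_le_mul hux (hL i j) (abs_nonneg _) hm.le
  rw [h1]
  refine (Finset.abs_sum_le_sum_abs _ _).trans ((Finset.sum_le_sum fun i _ =>
    (Finset.abs_sum_le_sum_abs _ _).trans (Finset.sum_le_sum fun j _ => hterm i j)).trans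
    (le_of_eq ?_))
  simp only [gradSq, Finset.sum_add_distrib, ← Finset.mul_sum, ← Finset.sum_div, Finset.sum_const,
    Finset.card_univ, Fintype.card_fin, nsmul_eq_mul]
  ring

/-- A cutoff function equal to one for `0.58 ≤ ‖x‖ ≤ 0.62` and supported in a larger annulus. -/
lemma exists_annulus_cutoff (n : ℕ) : ∃ ζ : EuclideanSpace ℝ (Fin n) → ℝ, ContDiff ℝ 2 ζ ∧
    HasCompactSupport ζ ∧ (∀ x, 0.58 ≤ ‖x‖ → ‖x‖ ≤ 0.62 → ζ x = 1) ∧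
      ∀ x ∈ tsupport ζ, 0.56 ≤ ‖x‖ ∧ ‖x‖ ≤ 0.64 := by
  obtain ⟨M, -, hM⟩ := exists_cutoff n
  obtain ⟨ζ₁, h1, -, h1one, h1s, -⟩ := hM 0 0.62 0.64 (by norm_num) (by norm_num)
  obtain ⟨ζ₂, h2, -, h2one, h2s, -⟩ := hM 0 0.56 0.57 (by norm_num) (by norm_num)
  have hc : HasCompactSupport ζ₁ :=
    (isCompact_closedBall _ _).of_isClosed_subset (isClosed_tsupport _) h1s
  refine ⟨fun x => ζ₁ x * (1 - ζ₂ x), h1.mul (contDiff_const.sub h2), hc.mul_right,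
    fun x hx hx' => ?_, fun x hx => ⟨?_, ?_⟩⟩
  · have h3 : x ∉ tsupport ζ₂ := fun h => by
      have := h2s h
      rw [mem_closedBall, dist_zero_right] at this
      norm_num at hx this
      linarith
    dsimp only
    rw [h1one x (by simpa using hx'), image_eq_zero_of_notMem_tsupport h3]
    norm_num
  · have hsub : tsupport (fun x => ζ₁ x * (1 - ζ₂ x)) ⊆
        {x : EuclideanSpace ℝ (Fin n) | 0.56 ≤ ‖x‖} := by
      refine closure_minimal (fun y hy => ?_) (isClosed_le continuous_const continuous_norm)
      by_contra hlt
      rw [mem_ofPred_eq, not_le] at hlt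
      refine hy ?_
      simp [h2one y (by simpa using hlt.le)]
    exact hsub hx
  · have := h1s (tsupport_mul_subset_left hx)
    simpa using this

lemma exists_weak_type_unit (hn : 2 ≤ n) {δ Λ : ℝ} (hδ : 0 < δ) (hΛ : 0 < Λ) :
    ∃ C : ℝ, 0 < C ∧ ∀ (abar : ℝ → Matrix (Fin n) (Fin n) ℝ) (ℓ : Fin n)
      (η f v : EuclideanSpace ℝ (Fin n) → ℝ), IsUnitSolution δ Λ abar ℓ η f v →
      ∀ t : ℝ, 0 < t → ENNReal.ofReal t *
        volume {x | ‖x‖ < 1 / 2 ∧ t < Real.sqrt (∑ i, ∑ j, D2 v x i j ^ 2)} ≤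
          ENNReal.ofReal (C * ∫ x, |f x|) := by
  obtain ⟨C, hC, hsup⟩ := exists_abs_le_of_isUnitSolution hn hδ hΛ
  obtain ⟨M, hM0, hM⟩ := exists_cutoff n
  obtain ⟨ζ, hζ, hζ01, hζ1, hζs, hζg⟩ := hM 0 0.58 0.62 (by norm_num) (by norm_num)
  obtain ⟨χ, hχ, hχc, hχ1, hχs⟩ := exists_annulus_cutoff n
  have hζc : HasCompactSupport ζ :=
    (isCompact_closedBall _ _).of_isClosed_subset (isClosed_tsupport _) hζs
  obtain ⟨L, hL0, hL⟩ := exists_forall_abs_D2_le hζ hζc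
  set G₁ : ℝ := (M / (0.62 - 0.58)) ^ 2 with hG₁
  have hG₁0 : 0 ≤ G₁ := sq_nonneg _
  set G₂ : ℝ := ∫ x, gradSq χ x with hG₂
  have hG₂0 : 0 ≤ G₂ := integral_nonneg fun x => gradSq_nonneg _ _
  set B : Set (EuclideanSpace ℝ (Fin n)) := closedBall 0 1 with hB
  set D₁ : ℝ := n ^ 2 * (Λ * L) + Λ * n * G₁ with hD₁
  have hD₁0 : 0 ≤ D₁ := by positivity
  set D₂ : ℝ := (2 * n * (3 * (Λ / δ)) / (δ / Λ)) ^ 2 * G₂ with hD₂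
  have hD₂0 : 0 ≤ D₂ := by positivity
  set D : ℝ := D₁ * volume.real B + Λ * n * D₂ with hD
  have hD0 : 0 ≤ D := by positivity
  set H : ℝ := max (hessConst n δ Λ) 1 with hH
  have hH0 : 0 < H := lt_max_of_lt_right one_pos
  refine ⟨H * (1 + D * C), by positivity, fun abar ℓ η f v h t ht => ?_⟩
  set I : ℝ := ∫ x, |f x| with hI
  have hI0 : 0 ≤ I := integral_nonneg fun x => abs_nonneg _
  obtain ⟨V, hV2, hVc, hVv, hVle, -⟩ := exists_contDiff_extension h.contDiffOn
  have hV1 : ContDiff ℝ 1 V := hV2.of_le (by norm_num)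
  have key : ∀ ε : ℝ, 0 < ε → ENNReal.ofReal t *
      volume {x | ‖x‖ < 1 / 2 ∧ t < Real.sqrt (∑ i, ∑ j, D2 v x i j ^ 2)} ≤
        ENNReal.ofReal (H * (I + D * (ε + C * I))) := by
    intro ε hε
    obtain ⟨m, hm0, hmle, hm⟩ := hsup abar ℓ η f v h ε hε
    have hVm : ∀ x, 0.55 ≤ ‖x‖ → ‖x‖ ≤ 1 → |V x| ≤ m := fun x h1 h2 =>
      (hVle x).trans (hm x h1 h2)
    have hcacc : ∫ x, χ x ^ 2 * gradSq V x ≤ D₂ * m ^ 2 := by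
      have h1 := (isNormalized_normalize hδ h.measurable h.elliptic ℓ).integral_sq_mul_gradSq_le
        (by positivity) (by positivity) hV2 (hχ.of_le (by norm_num)) hχc (by
          filter_upwards [h.ellOp_normalize_abs_le hδ hV2 hVv] with x hx
          by_cases hxs : x ∈ tsupport χ
          · obtain ⟨h2, h3⟩ := hχs x hxs
            have h4 := hx (h3.trans_lt (by norm_num))
            rw [h.rhs_eq_zero x (le_trans (by norm_num) h2), abs_zero, zero_div] at h4
            rw [abs_nonpos_iff.1 h4]
            simp
          · simp [image_eq_zero_of_notMem_tsupport hxs])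
      have hgχ : Integrable (gradSq χ) :=
        (continuous_gradSq (hχ.of_le (by norm_num))).integrable_of_hasCompactSupport
          (hχc.mono' fun x hx => by
            by_contra hx'
            exact hx (gradSq_eq_zero_of_notMem hx'))
      have h2 : ∫ x, V x ^ 2 * gradSq χ x ≤ m ^ 2 * G₂ := by
        rw [hG₂, ← integral_const_mul]
        refine integral_mono_of_nonneg (Eventually.of_forall fun x =>
          mul_nonneg (sq_nonneg _) (gradSq_nonneg _ _)) (hgχ.const_mul _)
          (Eventually.of_forall fun x => ?_)
        by_cases hxs : x ∈ tsupport χ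
        · obtain ⟨h2, h3⟩ := hχs x hxs
          refine mul_le_mul_of_nonneg_right ?_ (gradSq_nonneg _ _)
          exact sq_le_sq.2 ((hVm x (le_trans (by norm_num) h2)
            (h3.trans (by norm_num))).trans (le_abs_self m))
        · simp [gradSq_eq_zero_of_notMem hxs]
      refine h1.trans ((mul_le_mul_of_nonneg_left h2 (sq_nonneg _)).trans (le_of_eq ?_))
      rw [hD₂]
      ring
    set w : EuclideanSpace ℝ (Fin n) → ℝ := fun x => ζ x * V x with hw
    have hw2 : ContDiff ℝ 2 w := hζ.mul hV2
    have hwc : HasCompactSupport w := hζc.mul_right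
    have hwV : ∀ x, ‖x‖ < 0.58 → w =ᶠ[𝓝 x] V := fun x hx => by
      filter_upwards [isOpen_ball.mem_nhds (mem_ball_zero_iff.2 hx)] with y hy
      rw [hw]
      dsimp only
      rw [hζ1 y (ball_subset_closedBall hy), one_mul]
    set R : EuclideanSpace ℝ (Fin n) → ℝ := fun x =>
      |f x| + (B.indicator (fun _ => D₁ * m) x + Λ * n / m * (χ x ^ 2 * gradSq V x)) with hR
    have hRi : Integrable R := by
      have h1 : Integrable fun x => B.indicator (fun _ => D₁ * m) x :=
        (integrable_indicator_iff measurableSet_closedBall).2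
          (integrableOn_const (measure_closedBall_lt_top).ne)
      have h2 : Integrable fun x => χ x ^ 2 * gradSq V x := by
        have h3 : HasCompactSupport fun x => χ x ^ 2 := by
          have h4 : HasCompactSupport fun x => χ x * χ x := hχc.mul_right
          simpa only [sq] using h4
        exact ((hχ.continuous.pow 2).mul (continuous_gradSq hV1)).integrable_of_hasCompactSupport
          h3.mul_right
      exact h.integrable.abs.add (h1.add (h2.const_mul _))
    have hR0 : ∀ x, 0 ≤ R x := fun x => by
      have h1 : 0 ≤ B.indicator (fun _ => D₁ * m) x :=
        indicator_nonneg (fun _ _ => by positivity) x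
      have h2 := gradSq_nonneg V x
      positivity
    have hRint : ∫ x, R x ≤ I + D * m := by
      have h1 : Integrable fun x => B.indicator (fun _ => D₁ * m) x :=
        (integrable_indicator_iff measurableSet_closedBall).2
          (integrableOn_const (measure_closedBall_lt_top).ne)
      have h2 : Integrable fun x => Λ * n / m * (χ x ^ 2 * gradSq V x) := by
        have h3 := (hRi.sub h.integrable.abs).sub h1
        refine h3.congr (Eventually.of_forall fun x => ?_)
        simp [hR]
      have h12 : Integrable fun x => B.indicator (fun _ => D₁ * m) x +
        Λ * n / m * (χ x ^ 2 * gradSq V x) := h1.add h2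
      have h3 : Λ * n / m * ∫ x, χ x ^ 2 * gradSq V x ≤ Λ * n * D₂ * m := by
        refine (mul_le_mul_of_nonneg_left hcacc (by positivity)).trans (le_of_eq ?_)
        field_simp
      have h4 : ∫ x, B.indicator (fun _ => D₁ * m) x = volume.real B * (D₁ * m) := by
        rw [integral_indicator measurableSet_closedBall, setIntegral_const, smul_eq_mul]
      rw [hR, integral_add h.integrable.abs h12, integral_add h1 h2, integral_const_mul, h4, hD]
      linarith
    have hbound : ∀ᵐ x, |∑ i, ∑ j, abar (x ℓ) i j * D2 w x i j| ≤ R x := by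
      filter_upwards [h.ellOp_eq hVv] with x hx
      change |ellOp abar ℓ w x| ≤ R x
      have hg := gradSq_nonneg V x
      have hind : 0 ≤ B.indicator (fun _ => D₁ * m) x :=
        indicator_nonneg (fun _ _ => by positivity) x
      have hlast : 0 ≤ Λ * n / m * (χ x ^ 2 * gradSq V x) := by positivity
      rcases lt_or_ge ‖x‖ 0.58 with h1 | h1
      · have h2 : ellOp abar ℓ w x = f x := by
          rw [← hx (h1.trans (by norm_num))]
          simp only [ellOp, D2_congr (hwV x h1)]
        rw [h2]
        simp only [hR]
        linarith
      rcases lt_or_ge 0.62 ‖x‖ with h2 | h2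
      · rw [IsNormalized.ellOp_eq_zero_of_notMem fun hxs => ?_, abs_zero]
        · exact hR0 x
        · have := hζs (tsupport_mul_subset_left hxs)
          rw [mem_closedBall, dist_zero_right] at this
          exact this.not_gt h2
      · have h3 : ellOp abar ℓ V x = 0 := by
          rw [hx (h2.trans_lt (by norm_num)), h.rhs_eq_zero x (le_trans (by norm_num) h1)]
        have h4 := abs_ellOp_mul_sub_le (a := abar) (fun s => (h.elliptic s).2.2) ℓ hζ hV2
          (x := x) hΛ.le (hL x) hm0 (hVm x (le_trans (by norm_num) h1) (h2.trans (by norm_num)))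
        rw [h3, mul_zero, sub_zero] at h4
        have h5 : x ∈ B := by
          rw [hB, mem_closedBall, dist_zero_right]
          exact h2.trans (by norm_num)
        have h6 := mul_le_mul_of_nonneg_left (hζg x) (by positivity : 0 ≤ Λ * n * m)
        refine h4.trans ?_
        simp only [hR]
        rw [indicator_of_mem h5, hχ1 x h1 h2, hD₁]
        have h7 := abs_nonneg (f x)
        have h8 : Λ * n / m * (1 ^ 2 * gradSq V x) = Λ * n * (gradSq V x / m) := by ring
        rw [h8]
        linarith
    calc _ ≤ ENNReal.ofReal t *
          volume {z | t < Real.sqrt (∑ i, ∑ j, D2 w z i j ^ 2)} := by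
          refine mul_le_mul_right (measure_mono ?_) _
          rintro x ⟨hx1, hx2⟩
          rw [mem_ofPred_eq]
          have hev := (hwV x (hx1.trans (by norm_num))).trans (hVv x (hx1.trans (by norm_num)))
          simpa only [D2_congr hev] using hx2
      _ ≤ ENNReal.ofReal (hessConst n δ Λ) *
          ∫⁻ z, ENNReal.ofReal |∑ i, ∑ j, abar (z ℓ) i j * D2 w z i j| :=
          weak_type_hessian hδ hΛ h.measurable h.elliptic ℓ hw2 hwc ht
      _ ≤ ENNReal.ofReal H * ∫⁻ z, ENNReal.ofReal (R z) := by
          refine mul_le_mul' (ENNReal.ofReal_le_ofReal (le_max_left _ _)) (lintegral_mono_ae ?_)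
          filter_upwards [hbound] with x hx
          exact ENNReal.ofReal_le_ofReal hx
      _ = ENNReal.ofReal (H * ∫ z, R z) := by
          rw [← ofReal_integral_eq_lintegral_ofReal hRi (Eventually.of_forall hR0),
            ENNReal.ofReal_mul hH0.le]
      _ ≤ _ := by
          refine ENNReal.ofReal_le_ofReal (mul_le_mul_of_nonneg_left (hRint.trans ?_) hH0.le)
          linarith [mul_le_mul_of_nonneg_left hmle hD0]
  have hlim : Tendsto (fun ε : ℝ => ENNReal.ofReal (H * (I + D * (ε + C * I)))) (𝓝[>] 0)
      (𝓝 (ENNReal.ofReal (H * (I + D * (0 + C * I))))) :=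
    (ENNReal.continuous_ofReal.comp (by fun_prop : Continuous fun ε : ℝ =>
      H * (I + D * (ε + C * I)))).continuousAt.tendsto.mono_left nhdsWithin_le_nhds
  have hfin := ge_of_tendsto hlim (eventually_mem_nhdsWithin.mono fun ε hε => key ε hε)
  convert! hfin using 2
  ring

lemma D2_comp_affine (u : EuclideanSpace ℝ (Fin n) → ℝ) (x₀ y : EuclideanSpace ℝ (Fin n)) (r : ℝ)
    (i j : Fin n) : D2 (fun y => u (x₀ + r • y)) y i j = r ^ 2 * D2 u (x₀ + r • y) i j := by
  have h : ∀ (w : EuclideanSpace ℝ (Fin n) → ℝ) y k,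
      pd k (fun y => w (x₀ + r • y)) y = r * pd k w (x₀ + r • y) := fun w y k => by
    have h1 := fderiv_comp_smul (𝕜 := ℝ) (f := fun z => w (x₀ + z)) (x := y) r
    rw [fderiv_comp_add_left] at h1
    rw [pd, h1]
    rfl
  have h2 : pd j (fun y => u (x₀ + r • y)) = r • fun y => pd j u (x₀ + r • y) :=
    funext fun y => h u y j
  rw [D2_eq_pd, h2, pd, fderiv_const_smul_field, Pi.smul_apply, _root_.smul_apply, smul_eq_mul]
  have h3 := h (pd j u) y i
  rw [pd] at h3
  rw [h3, D2_eq_pd]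
  ring

lemma volume_preimage_affine (x₀ : EuclideanSpace ℝ (Fin n)) {r : ℝ} (hr : 0 < r)
    (S : Set (EuclideanSpace ℝ (Fin n))) :
    volume ((fun y => x₀ + r • y) ⁻¹' S) = ENNReal.ofReal (r ^ n)⁻¹ * volume S := by
  have h := Measure.addHaar_preimage_smul (volume : Measure (EuclideanSpace ℝ (Fin n))) hr.ne'
    ((x₀ + ·) ⁻¹' S)
  rw [measure_preimage_add, finrank_euclideanSpace_fin, abs_of_pos (by positivity)] at h
  exact h

lemma ae_comp_affine (x₀ : EuclideanSpace ℝ (Fin n)) {r : ℝ} (hr : 0 < r)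
    {P : EuclideanSpace ℝ (Fin n) → Prop} (h : ∀ᵐ x, P x) : ∀ᵐ y, P (x₀ + r • y) := by
  have h1 := volume_preimage_affine x₀ hr {x | ¬P x}
  rw [ae_iff.1 h, mul_zero] at h1
  exact ae_iff.2 h1

lemma integral_comp_affine (g : EuclideanSpace ℝ (Fin n) → ℝ) (x₀ : EuclideanSpace ℝ (Fin n))
    {r : ℝ} (hr : 0 < r) : ∫ y, g (x₀ + r • y) = (r ^ n)⁻¹ * ∫ x, g x := by
  have h := Measure.integral_comp_smul (volume : Measure (EuclideanSpace ℝ (Fin n)))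
    (fun z => g (x₀ + z)) r
  rwa [integral_add_left_eq_self, finrank_euclideanSpace_fin, abs_of_pos (by positivity)] at h

lemma norm_lt_iff_mem_ball (x₀ y : EuclideanSpace ℝ (Fin n)) {r : ℝ} (hr : 0 < r) (s : ℝ) :
    x₀ + r • y ∈ ball x₀ (r * s) ↔ ‖y‖ < s := by
  rw [mem_ball, dist_eq_norm, add_sub_cancel_left, norm_smul, Real.norm_of_nonneg hr.le,
    mul_lt_mul_iff_right₀ hr]

lemma integrableOn_of_rpow {F : EuclideanSpace ℝ (Fin n) → ℝ} {p : ℝ} (hp : 1 < p)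
    (hF : Measurable F) {S : Set (EuclideanSpace ℝ (Fin n))} (hS : volume S ≠ ∞)
    (hFp : IntegrableOn (fun x => |F x| ^ p) S) : IntegrableOn F S := by
  have h1 : IntegrableOn (fun x => 1 + |F x| ^ p) S := (integrableOn_const hS).add hFp
  refine h1.mono' hF.aestronglyMeasurable (Eventually.of_forall fun x => ?_)
  rw [Real.norm_eq_abs]
  have h2 := Real.rpow_nonneg (abs_nonneg (F x)) p
  rcases le_total |F x| 1 with h | h
  · linarith
  · have := Real.rpow_le_rpow_of_exponent_le h hp.le
    rw [Real.rpow_one] at this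
    linarith

end DirichletWeakType

/-- weak-type `(1,1)` estimate for `D²v` where `v` solves the Dirichlet
problem for the modified operator `ã^{ij} D_{ij}` with data `F 1_{B_{r/2}}`. -/
theorem stmt_13 (n : ℕ) (hn : 2 ≤ n) (p δ Λ : ℝ)
    (hp : 1 < p) (hδ : δ ∈ Set.Ioo (0 : ℝ) 1) (hΛ : 0 < Λ) :
    ∃ C : ℝ, 0 < C ∧
      ∀ (x₀ : EuclideanSpace ℝ (Fin n)) (r : ℝ), 0 < r →
      ∀ abar : ℝ → Matrix (Fin n) (Fin n) ℝ,
        (∀ i j, Measurable fun s => abar s i j) →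
        (∀ s, IsElliptic n δ Λ (abar s)) →
      ∀ η : EuclideanSpace ℝ (Fin n) → ℝ, ContDiff ℝ (⊤ : ℕ∞) η →
        (∀ x, 0 ≤ η x ∧ η x ≤ 1) →
        (∀ x ∈ ball x₀ (2 * r / 3), η x = 1) →
        (∀ x, x ∉ ball x₀ r → η x = 0) →
        (∀ x, ‖fderiv ℝ η x‖ ≤ 5 / r) →
      ∀ F : EuclideanSpace ℝ (Fin n) → ℝ, Measurable F →
        IntegrableOn (fun x => |F x| ^ p) (ball x₀ (r / 2)) →
      ∀ v : EuclideanSpace ℝ (Fin n) → ℝ, ContDiffOn ℝ 2 v (closedBall x₀ r) →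
        (∀ x ∈ sphere x₀ r, v x = 0) →
        (∀ᵐ x ∂(volume.restrict (ball x₀ r)),
          (∑ i, ∑ j, (η x * abar (x (⟨n - 1, by omega⟩ : Fin n)) i j +
            δ * (1 - η x) * (1 : Matrix (Fin n) (Fin n) ℝ) i j) * D2 v x i j) =
            Set.indicator (ball x₀ (r / 2)) F x) →
      ∀ t : ℝ, 0 < t →
        volume {x ∈ ball x₀ (r / 2) | t < Real.sqrt (∑ i, ∑ j, D2 v x i j ^ 2)} ≤
          ENNReal.ofReal (C / t * ∫ x in ball x₀ (r / 2), |F x|) := by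
  obtain ⟨C, hC, hunit⟩ := DirichletWeakType.exists_weak_type_unit hn hδ.1 hΛ
  refine ⟨C, hC, fun x₀ r hr abar ham ha η _ hη hη1 _ _ F hF hFp v hv hv0 heq t ht => ?_⟩
  set ℓ : Fin n := ⟨n - 1, by omega⟩ with hℓ
  have hmem := fun y => DirichletWeakType.norm_lt_iff_mem_ball x₀ y hr
  have hr2 : r / 2 = r * (1 / 2) := by ring
  have hFi : Integrable ((ball x₀ (r / 2)).indicator F) :=
    (integrable_indicator_iff measurableSet_ball).2
      (DirichletWeakType.integrableOn_of_rpow hp hF measure_ball_lt_top.ne hFp)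
  have hsol : DirichletWeakType.IsUnitSolution δ Λ (fun s => abar (x₀ ℓ + r * s)) ℓ
      (fun y => η (x₀ + r • y))
      (fun y => r ^ 2 * (ball x₀ (r / 2)).indicator F (x₀ + r • y))
      (fun y => v (x₀ + r • y)) :=
    { measurable := fun i j => (ham i j).comp (by fun_prop)
      elliptic := fun s => ha _
      cutoff_mem := fun y => hη _
      cutoff_eq_one := fun y hy => hη1 _ <| by
        rw [show 2 * r / 3 = r * (2 / 3) by ring]
        exact (hmem y _).2 hy
      contDiffOn := hv.comp (by fun_prop) fun y hy => by
        rw [mem_closedBall, dist_zero_right] at hy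
        rw [mem_closedBall, dist_eq_norm, add_sub_cancel_left, norm_smul, Real.norm_of_nonneg hr.le]
        exact mul_le_of_le_one_right hr.le hy
      boundary := fun y hy => hv0 _ <| by
        rw [mem_sphere, dist_eq_norm, add_sub_cancel_left, norm_smul, Real.norm_of_nonneg hr.le, hy,
          mul_one]
      integrable := ((hFi.comp_add_left x₀).comp_smul hr.ne').const_mul (r ^ 2)
      rhs_eq_zero := fun y hy => by
        rw [indicator_of_notMem, mul_zero]
        rw [hr2, hmem]
        exact not_lt.2 hy
      equation := by
        filter_upwards [DirichletWeakType.ae_comp_affine x₀ hr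
          ((ae_restrict_iff' measurableSet_ball).1 heq)] with y hy hy1
        rw [← hy (by have h1 := (hmem y 1).2 hy1; rwa [mul_one] at h1)]
        simp only [DirichletWeakType.D2_comp_affine, Finset.mul_sum]
        refine Finset.sum_congr rfl fun i _ => Finset.sum_congr rfl fun j _ => ?_
        simp only [PiLp.add_apply, PiLp.smul_apply, smul_eq_mul]
        ring }
  have h := hunit _ _ _ _ _ hsol (r ^ 2 * t) (by positivity)
  have hset : {y : EuclideanSpace ℝ (Fin n) | ‖y‖ < 1 / 2 ∧ r ^ 2 * t <
      Real.sqrt (∑ i, ∑ j, D2 (fun y => v (x₀ + r • y)) y i j ^ 2)} = (fun y => x₀ + r • y) ⁻¹'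
      {x ∈ ball x₀ (r / 2) | t < Real.sqrt (∑ i, ∑ j, D2 v x i j ^ 2)} := by
    ext y
    have hsqrt : Real.sqrt (∑ i, ∑ j, D2 (fun y => v (x₀ + r • y)) y i j ^ 2) =
        r ^ 2 * Real.sqrt (∑ i, ∑ j, D2 v (x₀ + r • y) i j ^ 2) := by
      simp only [DirichletWeakType.D2_comp_affine, mul_pow, ← Finset.mul_sum]
      rw [Real.sqrt_mul (by positivity), Real.sqrt_sq (by positivity)]
    rw [mem_preimage, mem_ofPred_eq, mem_ofPred_eq, hr2, hmem, hsqrt,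
      mul_lt_mul_iff_right₀ (by positivity : 0 < r ^ 2)]
  have hInt : ∫ y, |r ^ 2 * (ball x₀ (r / 2)).indicator F (x₀ + r • y)| =
      r ^ 2 * ((r ^ n)⁻¹ * ∫ x in ball x₀ (r / 2), |F x|) := by
    simp only [abs_mul, abs_of_pos (by positivity : 0 < r ^ 2)]
    rw [integral_const_mul, DirichletWeakType.integral_comp_affine
      (fun x => |(ball x₀ (r / 2)).indicator F x|) x₀ hr, ← integral_indicator measurableSet_ball]
    congr 2
    refine integral_congr_ae (Filter.Eventually.of_forall fun x => ?_)
    exact congrFun (indicator_comp_of_zero (g := fun s : ℝ => |s|) abs_zero).symm x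
  have hc : (0 : ℝ) < r ^ 2 * t * (r ^ n)⁻¹ := by positivity
  rw [hset, DirichletWeakType.volume_preimage_affine x₀ hr, hInt, ← mul_assoc,
    ← ENNReal.ofReal_mul (by positivity)] at h
  have hfin : C * (r ^ 2 * ((r ^ n)⁻¹ * ∫ x in ball x₀ (r / 2), |F x|)) =
      (r ^ 2 * t * (r ^ n)⁻¹) * (C / t * ∫ x in ball x₀ (r / 2), |F x|) := by
    field_simp
  rw [hfin, ENNReal.ofReal_mul hc.le] at h
  exact (ENNReal.mul_le_mul_iff_right (ENNReal.ofReal_pos.2 hc).ne' ENNReal.ofReal_ne_top).1 h
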